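/- Let φ be a norm on ℝ², let Ω ⊆ ℝ² be a bounded convex open set, let m > 0, let u be a minimizer of problem (1), let j̄ = ‖u‖_∞ ∈ ℕ (finite since minimizers are essentially bounded), and let E_j = {u ≥ j} (identified with its set of Lebesgue-density-1 points). Then one of the following four cases holds: (a) there exists r̄ ∈ [r_Ω, R_Ω) such that cl(E_j) = cl(Ω^{r̄}) for all 1 ≤ j ≤ j̄, and u = j̄·1_{Ω^{r̄}} a.e.; (b) there exist r̄ ∈ (r_Ω, R_Ω) and x ∈ Ω with W_{r̄}(x) ⊆ Ω^{r̄} such that cl(E_{j̄}) = cl(W_{r̄}(x)), cl(E_j) = cl(Ω^{r̄}) for all 1 ≤ j < j̄, and u = 1_{W_{r̄}(x)} + (j̄−1)·1_{Ω^{r̄}} a.e.; (c) there exist r̄ ∈ (0, r_Ω] and x ∈ Ω with W_{r̄}(x) ⊆ Ω such that cl(E_{j̄}) = cl(W_{r̄}(x)), cl(E_j) = cl(Ω) for all 1 ≤ j < j̄, and u = 1_{W_{r̄}(x)} + (j̄−1)·1_Ω a.e. (possible only when r_Ω > 0); (d) for every 1 ≤ j ≤ j̄, cl(E_j) is the closure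 of a convex set F_j which is a union of Wulff balls of radius R_Ω (i.e. F_j is convex and F_j = F_j^{R_Ω}). -/

import Mathlib

open MeasureTheory Set ENNReal Filter

noncomputable section

/-- `φ` is a norm on `ℝⁿ` (represented as `Fin n → ℝ`). -/
structure IsNorm {n : ℕ} (φ : (Fin n → ℝ) → ℝ) : Prop where
  nonneg : ∀ x, 0 ≤ φ x
  eq_zero_iff : ∀ x, φ x = 0 ↔ x = 0
  smul_eq : ∀ (a : ℝ) (x : Fin n → ℝ), φ (a • x) = |a| * φ x
  add_le : ∀ x y, φ (x + y) ≤ φ x + φ y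

/-- The divergence of a vector field `η : ℝⁿ → ℝⁿ`. -/
def diverg {n : ℕ} (η : (Fin n → ℝ) → (Fin n → ℝ)) (x : Fin n → ℝ) : ℝ :=
  ∑ i, fderiv ℝ η x (Pi.single i 1) i

/-- The anisotropic total variation `∫ φ*(Du)` of `u : ℝⁿ → ℝ`:
`sup { ∫ u div η dx : η ∈ C¹_c(ℝⁿ;ℝⁿ), φ(η(x)) ≤ 1 ∀ x }`, as an extended real. -/
def anisoTV {n : ℕ} (φ : (Fin n → ℝ) → ℝ) (u : (Fin n → ℝ) → ℝ) : ℝ≥0∞ :=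
  ⨆ η ∈ {η : (Fin n → ℝ) → (Fin n → ℝ) |
      ContDiff ℝ 1 η ∧ HasCompactSupport η ∧ ∀ x, φ (η x) ≤ 1},
    ENNReal.ofReal (∫ x, u x * diverg η x)

/-- `u ∈ BV(ℝⁿ)` (with respect to the anisotropic total variation). -/
def IsBV {n : ℕ} (φ : (Fin n → ℝ) → ℝ) (u : (Fin n → ℝ) → ℝ) : Prop :=
  Integrable u volume ∧ anisoTV φ u ≠ ⊤

/-- `u` is admissible for problem (1): `u ∈ BV(ℝⁿ)`, `u = 0` a.e. outside `Ω`,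
`u` is a.e. `ℕ`-valued, and `∫_Ω u = m`. -/
def Admissible {n : ℕ} (φ : (Fin n → ℝ) → ℝ) (Ω : Set (Fin n → ℝ)) (m : ℝ)
    (u : (Fin n → ℝ) → ℝ) : Prop :=
  IsBV φ u ∧ (∀ᵐ x ∂volume, x ∉ Ω → u x = 0) ∧
    (∀ᵐ x ∂volume, ∃ k : ℕ, u x = k) ∧ (∫ x in Ω, u x) = m

/-- `u` is a minimizer of problem (1). -/
def IsMinimizer {n : ℕ} (φ : (Fin n → ℝ) → ℝ) (Ω : Set (Fin n → ℝ)) (m : ℝ)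
    (u : (Fin n → ℝ) → ℝ) : Prop :=
  Admissible φ Ω m u ∧ ∀ v, Admissible φ Ω m v → anisoTV φ u ≤ anisoTV φ v

/-- The anisotropic perimeter `P_φ(E)` of a set `E ⊆ ℝⁿ`. -/
def anisoPerimeter {n : ℕ} (φ : (Fin n → ℝ) → ℝ) (E : Set (Fin n → ℝ)) : ℝ≥0∞ :=
  anisoTV φ (E.indicator (1 : (Fin n → ℝ) → ℝ))

/-- The Wulff ball `W_r(x) = {y : φ(y-x) < r}`. -/
def wulffBall {n : ℕ} (φ : (Fin n → ℝ) → ℝ) (x : Fin n → ℝ) (r : ℝ) : Set (Fin n → ℝ) :=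
  {y | φ (y - x) < r}

/-- `E` satisfies the `rW_φ`-condition. -/
def rWCond {n : ℕ} (φ : (Fin n → ℝ) → ℝ) (E : Set (Fin n → ℝ)) (r : ℝ) : Prop :=
  ∀ x ∈ frontier E, ∃ y, wulffBall φ y r ⊆ E ∧ x ∈ frontier (wulffBall φ y r)

/-- The Wulff plaquette `E^r`, the union of all Wulff balls of radius `r` contained
in `E` (with `E^0 = E`). -/
def plaquette {n : ℕ} (φ : (Fin n → ℝ) → ℝ) (E : Set (Fin n → ℝ)) (r : ℝ) :
    Set (Fin n → ℝ) :=
  if r = 0 then E else ⋃ (x) (_ : wulffBall φ x r ⊆ E), wulffBall φ x r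

/-- `R_Ω`: the maximal `R > 0` such that some Wulff ball of radius `R` is contained in `Ω`. -/
def maxInradius {n : ℕ} (φ : (Fin n → ℝ) → ℝ) (Ω : Set (Fin n → ℝ)) : ℝ :=
  sSup {R | 0 < R ∧ ∃ x, wulffBall φ x R ⊆ Ω}

/-- `r_Ω`: the maximal `r > 0` such that `Ω` satisfies the `rW_φ`-condition
(`0` if there is none, since `sSup ∅ = 0`). -/
def maxRollRadius {n : ℕ} (φ : (Fin n → ℝ) → ℝ) (Ω : Set (Fin n → ℝ)) : ℝ :=
  sSup {r | 0 < r ∧ rWCond φ Ω r}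

/-- The set of points of Lebesgue density `1` of `E`. -/
def densityPoints {n : ℕ} (E : Set (Fin n → ℝ)) : Set (Fin n → ℝ) :=
  {x | Tendsto (fun r : ℝ => volume (E ∩ Metric.ball x r) / volume (Metric.ball x r))
    (nhdsWithin 0 (Ioi 0)) (nhds 1)}

/-- `E` is a minimizer of problem (10): the constrained isoperimetric problem
minimizing `P_φ` among measurable subsets of `Ω` of prescribed measure `m`. -/
def IsIsopMinimizer {n : ℕ} (φ : (Fin n → ℝ) → ℝ) (Ω : Set (Fin n → ℝ)) (m : ℝ)
    (E : Set (Fin n → ℝ)) : Prop :=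
  MeasurableSet E ∧ E ⊆ Ω ∧ (volume E).toReal = m ∧
    ∀ F, MeasurableSet F → F ⊆ Ω → (volume F).toReal = m →
      anisoPerimeter φ E ≤ anisoPerimeter φ F

/-- The Euclidean norm on `ℝ²`. -/
def euclNorm (v : Fin 2 → ℝ) : ℝ := Real.sqrt (v 0 ^ 2 + v 1 ^ 2)

/-- The crystalline norm `φ(ν) = |ν₁| + |ν₂|` on `ℝ²`. -/
def crysNorm (v : Fin 2 → ℝ) : ℝ := |v 0| + |v 1|

/-- The open unit square `(0,1)² ⊆ ℝ²`. -/
def unitSquare : Set (Fin 2 → ℝ) := univ.pi fun _ => Ioo (0 : ℝ) 1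

/-- The closed unit square `[0,1]² ⊆ ℝ²`. -/
def closedUnitSquare : Set (Fin 2 → ℝ) := univ.pi fun _ => Icc (0 : ℝ) 1

/-- `j` is the essential supremum `‖u‖_∞` of `u`. -/
def IsEssSup (u : (Fin 2 → ℝ) → ℝ) (j : ℕ) : Prop :=
  (∀ᵐ x ∂volume, u x ≤ (j : ℝ)) ∧ ∀ c : ℝ, (∀ᵐ x ∂volume, u x ≤ c) → (j : ℝ) ≤ c

namespace Wulff

open scoped Pointwise Topology

/-- The plane. -/
abbrev Plane := Fin 2 → ℝ

/-- The area of a planar set. -/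
abbrev area (A : Set Plane) : ℝ := volume.real A

/-- The determinant of the pair `(ξ, x)`, as a linear form in `x`. -/
def cross (ξ : Plane) : Plane →ₗ[ℝ] ℝ :=
  ξ 0 • LinearMap.proj 1 - ξ 1 • LinearMap.proj 0

lemma cross_apply (ξ x : Plane) : cross ξ x = ξ 0 * x 1 - ξ 1 * x 0 := by
  simp [cross]

lemma continuous_cross (ξ : Plane) : Continuous (cross ξ) :=
  (cross ξ).continuous_of_finiteDimensional

/-- The segment `[-ξ, ξ]`. -/
def seg (ξ : Plane) : Set Plane := (fun s : ℝ => s • ξ) '' Icc (-1) 1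

/-- The width of `A` across the direction `ξ`, multiplied by the length of `ξ`. -/
def wid (ξ : Plane) (A : Set Plane) : ℝ := sSup (cross ξ '' A) - sInf (cross ξ '' A)

/-- A vector completing `ξ` to a unimodular frame. -/
def conj (ξ : Plane) : Plane :=
  ![-ξ 1 / (ξ 0 ^ 2 + ξ 1 ^ 2), ξ 0 / (ξ 0 ^ 2 + ξ 1 ^ 2)]

lemma sq_add_sq_ne {ξ : Plane} (h : ξ ≠ 0) : ξ 0 ^ 2 + ξ 1 ^ 2 ≠ 0 := by
  intro h0
  apply h
  have h1 : ξ 0 = 0 := by nlinarith [sq_nonneg (ξ 0), sq_nonneg (ξ 1)]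
  have h2 : ξ 1 = 0 := by nlinarith [sq_nonneg (ξ 0), sq_nonneg (ξ 1)]
  ext i; fin_cases i <;> simp [h1, h2]

lemma cross_conj {ξ : Plane} (h : ξ ≠ 0) : cross ξ (conj ξ) = 1 := by
  have := sq_add_sq_ne h
  rw [cross_apply]; simp [conj]; field_simp; ring

lemma cross_self (ξ : Plane) : cross ξ ξ = 0 := by rw [cross_apply]; ring

/-- Coordinates in the frame `(ξ, conj ξ)`. -/
def frame (ξ : Plane) (p : ℝ × ℝ) : Plane := p.1 • ξ + p.2 • conj ξ

lemma cross_frame {ξ : Plane} (h : ξ ≠ 0) (p : ℝ × ℝ) : cross ξ (frame ξ p) = p.2 := by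
  simp [frame, cross_self, cross_conj h]

lemma frame_surj {ξ : Plane} (h : ξ ≠ 0) (x : Plane) : ∃ s, x = frame ξ (s, cross ξ x) := by
  have := sq_add_sq_ne h
  refine ⟨(ξ 0 * x 0 + ξ 1 * x 1) / (ξ 0 ^ 2 + ξ 1 ^ 2), ?_⟩
  ext i; fin_cases i <;> simp [frame, conj, cross_apply] <;> field_simp <;> ring

lemma continuous_frame (ξ : Plane) : Continuous (frame ξ) := by
  unfold frame; fun_prop

lemma measurePreserving_frame {ξ : Plane} (h : ξ ≠ 0) :
    MeasurePreserving (frame ξ) volume volume := by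
  set M : Matrix (Fin 2) (Fin 2) ℝ := !![ξ 0, conj ξ 0; ξ 1, conj ξ 1] with hM
  have hdet : M.det = 1 := by
    have := cross_conj h
    rw [cross_apply] at this
    rw [hM, Matrix.det_fin_two_of]; linarith
  have h1 : MeasurePreserving (Matrix.toLin' M) (volume : Measure Plane) volume := by
    refine ⟨(Matrix.toLin' M).continuous_of_finiteDimensional.measurable, ?_⟩
    rw [Real.map_matrix_volume_pi_eq_smul_volume_pi (by rw [hdet]; exact one_ne_zero)]
    simp [hdet]
  have h2 := (volume_preserving_finTwoArrow ℝ).symm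
  have h3 := h1.comp h2
  convert h3 using 1
  funext p
  ext i
  fin_cases i <;> simp [frame, hM, MeasurableEquiv.finTwoArrow, Matrix.mulVec, dotProduct, Fin.sum_univ_two, mul_comm]

/-- The slice of `A` along `ξ` at height `y`. -/
def slice (ξ : Plane) (A : Set Plane) (y : ℝ) : Set ℝ := {s | frame ξ (s, y) ∈ A}

lemma volume_eq_slice {ξ : Plane} (h : ξ ≠ 0) {A : Set Plane} (hA : MeasurableSet A) :
    volume A = ∫⁻ y, volume (slice ξ A y) := by
  rw [← (measurePreserving_frame h).measure_preimage hA.nullMeasurableSet]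
  rw [Measure.volume_eq_prod, Measure.prod_apply_symm ((continuous_frame ξ).measurable hA)]
  rfl

lemma isClosed_slice (ξ : Plane) {A : Set Plane} (hA : IsClosed A) (y : ℝ) :
    IsClosed (slice ξ A y) :=
  hA.preimage ((continuous_frame ξ).comp (by fun_prop : Continuous fun s : ℝ => (s, y)))

lemma isCompact_slice {ξ : Plane} (h : ξ ≠ 0) {A : Set Plane} (hA : IsCompact A) (y : ℝ) :
    IsCompact (slice ξ A y) := by
  have h1 : slice ξ A y ⊆ (fun x : Plane => (ξ 0 * x 0 + ξ 1 * x 1) / (ξ 0 ^ 2 + ξ 1 ^ 2)) '' A := by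
    intro s hs
    refine ⟨_, hs, ?_⟩
    have := sq_add_sq_ne h
    simp [frame, conj]; field_simp; ring
  exact (hA.image (by fun_prop)).of_isClosed_subset (isClosed_slice ξ hA.isClosed y) h1

lemma slice_nonempty_iff {ξ : Plane} (h : ξ ≠ 0) {A : Set Plane} {y : ℝ} :
    (slice ξ A y).Nonempty ↔ y ∈ cross ξ '' A := by
  constructor
  · rintro ⟨s, hs⟩
    exact ⟨_, hs, cross_frame h _⟩
  · rintro ⟨x, hx, rfl⟩
    obtain ⟨s, hs⟩ := frame_surj h x
    exact ⟨s, by rw [slice, mem_ofPred_eq, ← hs]; exact hx⟩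

lemma seg_compact (ξ : Plane) : IsCompact (seg ξ) :=
  isCompact_Icc.image (by fun_prop)

lemma mem_smul_seg {r : ℝ} (hr : 0 ≤ r) (ξ x : Plane) :
    x ∈ r • seg ξ ↔ ∃ t ∈ Icc (-r) r, x = t • ξ := by
  constructor
  · rintro ⟨_, ⟨s, hs, rfl⟩, rfl⟩
    exact ⟨r * s, ⟨by nlinarith [hs.1], by nlinarith [hs.2]⟩, by simp [smul_smul]⟩
  · rintro ⟨t, ht, rfl⟩
    rcases hr.eq_or_lt with rfl | hr
    · have : t = 0 := by have := ht.1; have := ht.2; linarith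
      exact ⟨_, ⟨0, by simp, rfl⟩, by simp [this]⟩
    · refine ⟨_, ⟨t / r, ⟨?_, ?_⟩, rfl⟩, ?_⟩
      · rw [le_div_iff₀ hr]; linarith [ht.1]
      · rw [div_le_iff₀ hr]; linarith [ht.2]
      · simp only [smul_smul]; congr 1; field_simp

lemma slice_add_seg {r : ℝ} (hr : 0 ≤ r) (ξ : Plane) (A : Set Plane) (y : ℝ) :
    slice ξ (A + r • seg ξ) y = slice ξ A y + Icc (-r) r := by
  ext s
  constructor
  · rintro ⟨a, ha, b, hb, hab⟩
    obtain ⟨t, ht, rfl⟩ := (mem_smul_seg hr ξ b).1 hb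
    refine ⟨s - t, ?_, t, ht, by simp⟩
    have : frame ξ (s - t, y) = a := by
      have h2 : a = frame ξ (s, y) - t • ξ := by rw [← hab]; simp
      rw [h2]; simp only [frame, sub_smul]; abel
    simpa [slice, this] using ha
  · rintro ⟨s', hs', t, ht, rfl⟩
    refine ⟨_, hs', t • ξ, (mem_smul_seg hr ξ _).2 ⟨t, ht, rfl⟩, ?_⟩
    simp only [frame, add_smul]; abel

lemma volume_add_Icc_ge {B : Set ℝ} (hB : IsCompact B) (hne : B.Nonempty) {r : ℝ} (hr : 0 ≤ r) :
    volume B + ENNReal.ofReal (2 * r) ≤ volume (B + Icc (-r) r) := by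
  obtain ⟨b, hb, hmin⟩ := hB.exists_isLeast hne
  have h1 : (fun x => r + x) '' B ∪ Ico (b - r) (b + r) ⊆ B + Icc (-r) r := by
    rintro x (⟨y, hy, rfl⟩ | hx)
    · exact ⟨y, hy, r, ⟨by linarith, le_rfl⟩, by simp [add_comm]⟩
    · exact ⟨b, hb, x - b, ⟨by linarith [hx.1], by linarith [hx.2]⟩, by simp⟩
  have h2 : Disjoint ((fun x => r + x) '' B) (Ico (b - r) (b + r)) := by
    rw [Set.disjoint_left]
    rintro _ ⟨y, hy, rfl⟩ hx
    have := hmin hy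
    have h3 := hx.2
    simp only at h3
    linarith
  calc volume B + ENNReal.ofReal (2 * r) = volume ((fun x => r + x) '' B) + volume (Ico (b - r) (b + r)) := by
        rw [image_add_left, measure_preimage_add, Real.volume_Ico]; congr 2; ring
    _ = volume ((fun x => r + x) '' B ∪ Ico (b - r) (b + r)) := (measure_union h2 measurableSet_Ico).symm
    _ ≤ _ := measure_mono h1

lemma compact_convex_eq_Icc {B : Set ℝ} (hB : IsCompact B) (hc : Convex ℝ B) (hne : B.Nonempty) :
    ∃ a b, a ≤ b ∧ B = Icc a b := by
  have := eq_Icc_of_connected_compact ⟨hne, hc.isPreconnected⟩ hB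
  exact ⟨_, _, by rw [this] at hne; exact nonempty_Icc.1 hne, this⟩

lemma convex_slice (ξ : Plane) {A : Set Plane} (hA : Convex ℝ A) (y : ℝ) :
    Convex ℝ (slice ξ A y) := by
  intro s hs t ht a b ha hb hab
  have h := hA hs ht ha hb hab
  have : a • frame ξ (s, y) + b • frame ξ (t, y) = frame ξ (a • s + b • t, y) := by
    simp only [frame, smul_add, smul_smul, add_smul, smul_eq_mul]
    have : y • conj ξ = (a * y) • conj ξ + (b * y) • conj ξ := by
      rw [← add_smul, ← add_mul, hab, one_mul]
    rw [this]; abel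
  rw [this] at h
  exact h

lemma image_cross_eq_Icc {Q : Set Plane} (hQ : IsCompact Q) (hc : IsConnected Q) (ξ : Plane) :
    cross ξ '' Q = Icc (sInf (cross ξ '' Q)) (sSup (cross ξ '' Q)) :=
  eq_Icc_of_connected_compact (hc.image _ (continuous_cross ξ).continuousOn)
    (hQ.image (continuous_cross ξ))

lemma wid_nonneg {Q : Set Plane} (hQ : IsCompact Q) (hne : Q.Nonempty) (ξ : Plane) :
    0 ≤ wid ξ Q := by
  have hc := hQ.image (continuous_cross ξ)
  obtain ⟨x, hx⟩ := hne.image (cross ξ)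
  have h1 := csInf_le hc.bddBelow hx
  have h2 := le_csSup hc.bddAbove hx
  unfold wid; linarith

lemma lintegral_indicator_wid {Q : Set Plane} (hQ : IsCompact Q) (hc : IsConnected Q) (ξ : Plane)
    {r : ℝ} (hr : 0 ≤ r) :
    ∫⁻ y, (cross ξ '' Q).indicator (fun _ => ENNReal.ofReal (2 * r)) y
      = ENNReal.ofReal (2 * r * wid ξ Q) := by
  have hm : MeasurableSet (cross ξ '' Q) := (hQ.image (continuous_cross ξ)).isClosed.measurableSet
  rw [lintegral_indicator hm, setLIntegral_const]
  nth_rewrite 1 [image_cross_eq_Icc hQ hc ξ]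
  rw [Real.volume_Icc, ← ENNReal.ofReal_mul (by positivity)]
  rfl

lemma wid_zero {Q : Set Plane} (hne : Q.Nonempty) : wid 0 Q = 0 := by
  have h : (cross (0 : Plane)) '' Q = {0} := by
    ext y; constructor
    · rintro ⟨x, _, rfl⟩; simp [cross_apply]
    · rintro rfl; obtain ⟨x, hx⟩ := hne; exact ⟨x, hx, by simp [cross_apply]⟩
  simp [wid, h]

lemma seg_zero : seg 0 = {0} := by
  ext x; constructor
  · rintro ⟨s, _, rfl⟩; simp
  · rintro rfl; exact ⟨0, by simp, by simp⟩

lemma volume_add_seg_ge {A Q : Set Plane} (hA : IsCompact A) (hQ : IsCompact Q)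
    (hc : IsConnected Q) (hQA : Q ⊆ A) (ξ : Plane) {r : ℝ} (hr : 0 ≤ r) :
    volume A + ENNReal.ofReal (2 * r * wid ξ Q) ≤ volume (A + r • seg ξ) := by
  by_cases h : ξ = 0
  · subst h; simp [wid_zero hc.nonempty, seg_zero, smul_set_singleton]
  have hA' : IsCompact (A + r • seg ξ) := hA.add ((seg_compact ξ).smul r)
  rw [volume_eq_slice h hA.isClosed.measurableSet, volume_eq_slice h hA'.isClosed.measurableSet,
    ← lintegral_indicator_wid hQ hc ξ hr, ← lintegral_add_right]
  · refine lintegral_mono fun y => ?_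
    rw [slice_add_seg hr]
    by_cases hy : y ∈ cross ξ '' Q
    · rw [indicator_of_mem hy]
      exact volume_add_Icc_ge (isCompact_slice h hA y)
        ((slice_nonempty_iff h).2 (image_mono hQA hy)) hr
    · rw [indicator_of_notMem hy, add_zero]
      refine measure_mono fun s hs => ⟨s, hs, 0, ⟨by linarith, hr⟩, by simp⟩
  · exact measurable_const.indicator (hQ.image (continuous_cross ξ)).isClosed.measurableSet

lemma volume_add_seg_le {C : Set Plane} (hC : IsCompact C) (hconv : Convex ℝ C)
    (hne : C.Nonempty) (ξ : Plane) {r : ℝ} (hr : 0 ≤ r) :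
    volume (C + r • seg ξ) ≤ volume C + ENNReal.ofReal (2 * r * wid ξ C) := by
  by_cases h : ξ = 0
  · subst h; simp [wid_zero hne, seg_zero, smul_set_singleton]
  have hc : IsConnected C := hconv.isConnected hne
  have hA' : IsCompact (C + r • seg ξ) := hC.add ((seg_compact ξ).smul r)
  rw [volume_eq_slice h hC.isClosed.measurableSet, volume_eq_slice h hA'.isClosed.measurableSet,
    ← lintegral_indicator_wid hC hc ξ hr, ← lintegral_add_right]
  · refine lintegral_mono fun y => ?_
    rw [slice_add_seg hr]
    by_cases hy : y ∈ cross ξ '' C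
    · rw [indicator_of_mem hy]
      obtain ⟨a, b, hab, he⟩ := compact_convex_eq_Icc (isCompact_slice h hC y)
        (convex_slice ξ hconv y) ((slice_nonempty_iff h).2 hy)
      rw [he, Real.volume_Icc, ← ENNReal.ofReal_add (by linarith) (by linarith)]
      refine (measure_mono (Icc_add_Icc_subset a b (-r) r)).trans ?_
      rw [Real.volume_Icc]
      apply ENNReal.ofReal_le_ofReal; linarith
    · have : slice ξ C y = ∅ := by
        rw [← not_nonempty_iff_eq_empty, slice_nonempty_iff h]; exact hy
      simp [this]
  · exact measurable_const.indicator (hC.image (continuous_cross ξ)).isClosed.measurableSet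

lemma volume_add_seg {C : Set Plane} (hC : IsCompact C) (hconv : Convex ℝ C)
    (hne : C.Nonempty) (ξ : Plane) {r : ℝ} (hr : 0 ≤ r) :
    area (C + r • seg ξ) = area C + 2 * r * wid ξ C := by
  have h := le_antisymm (volume_add_seg_le hC hconv hne ξ hr)
    (volume_add_seg_ge hC hC (hconv.isConnected hne) subset_rfl ξ hr)
  have hw := wid_nonneg hC hne ξ
  rw [area, measureReal_def, h, ENNReal.toReal_add hC.measure_lt_top.ne ENNReal.ofReal_ne_top,
    ENNReal.toReal_ofReal (by positivity)]
  rfl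

/-- Minkowski erosion of `C` by `K`. -/
def er (C K : Set Plane) : Set Plane := {x | ∀ k ∈ K, x + k ∈ C}

lemma isClosed_er {C : Set Plane} (hC : IsClosed C) (K : Set Plane) : IsClosed (er C K) := by
  have : er C K = ⋂ k ∈ K, (fun x => x + k) ⁻¹' C := by ext x; simp [er]
  rw [this]
  exact isClosed_biInter fun k _ => hC.preimage (by fun_prop)

lemma convex_er {C : Set Plane} (hC : Convex ℝ C) (K : Set Plane) : Convex ℝ (er C K) := by
  intro x hx y hy a b ha hb hab k hk
  have := hC (hx k hk) (hy k hk) ha hb hab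
  have h2 : a • (x + k) + b • (y + k) = a • x + b • y + k := by
    have : k = a • k + b • k := by rw [← add_smul, hab, one_smul]
    nth_rewrite 3 [this]
    simp only [smul_add]; abel
  rwa [h2] at this

lemma er_anti {C K K' : Set Plane} (h : K ⊆ K') : er C K' ⊆ er C K :=
  fun _ hx k hk => hx k (h hk)

lemma er_add_subset (C K : Set Plane) : er C K + K ⊆ C := by
  rintro _ ⟨x, hx, k, hk, rfl⟩; exact hx k hk

lemma er_er (C K L : Set Plane) : er (er C K) L = er C (L + K) := by
  ext x; constructor
  · rintro h _ ⟨l, hl, k, hk, rfl⟩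
    have := h l hl k hk; rwa [add_assoc] at this
  · intro h l hl k hk
    have := h (l + k) ⟨l, hl, k, hk, rfl⟩
    rwa [← add_assoc] at this

lemma isCompact_er {C K : Set Plane} (hC : IsCompact C) (hK : K.Nonempty) : IsCompact (er C K) := by
  obtain ⟨k, hk⟩ := hK
  refine (hC.image (by fun_prop : Continuous fun x : Plane => x - k)).of_isClosed_subset
    (isClosed_er hC.isClosed K) fun x hx => ⟨x + k, hx k hk, by simp⟩

lemma seg_nonempty (ξ : Plane) : (seg ξ).Nonempty := ⟨_, 0, by simp, rfl⟩

lemma volume_er_seg {C : Set Plane} (hC : IsCompact C) (hconv : Convex ℝ C)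
    (hne : C.Nonempty) (ξ : Plane) {r : ℝ} (hr : 0 ≤ r) :
    area C ≤ area (er C (r • seg ξ)) + 2 * r * wid ξ C := by
  have hE : IsCompact (er C (r • seg ξ)) := isCompact_er hC ((seg_nonempty ξ).smul_set)
  have hw := wid_nonneg hC hne ξ
  suffices h : volume C ≤ volume (er C (r • seg ξ)) + ENNReal.ofReal (2 * r * wid ξ C) by
    rw [area, area, measureReal_def, measureReal_def]
    have h2 := ENNReal.toReal_mono (by simp [hE.measure_lt_top.ne]) h
    rwa [ENNReal.toReal_add hE.measure_lt_top.ne ENNReal.ofReal_ne_top,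
      ENNReal.toReal_ofReal (by positivity)] at h2
  by_cases h : ξ = 0
  · subst h; simp [wid_zero hne, seg_zero, smul_set_singleton, er]
  have hc : IsConnected C := hconv.isConnected hne
  rw [volume_eq_slice h hC.isClosed.measurableSet, volume_eq_slice h hE.isClosed.measurableSet,
    ← lintegral_indicator_wid hC hc ξ hr, ← lintegral_add_right]
  · refine lintegral_mono fun y => ?_
    by_cases hy : y ∈ cross ξ '' C
    · rw [indicator_of_mem hy]
      obtain ⟨a, b, hab, he⟩ := compact_convex_eq_Icc (isCompact_slice h hC y)
        (convex_slice ξ hconv y) ((slice_nonempty_iff h).2 hy)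
      have hsub : Icc (a + r) (b - r) ⊆ slice ξ (er C (r • seg ξ)) y := by
        intro s hs k hk
        obtain ⟨t, ht, rfl⟩ := (mem_smul_seg hr ξ k).1 hk
        have : s + t ∈ slice ξ C y := by
          rw [he]; exact ⟨by linarith [hs.1, ht.1], by linarith [hs.2, ht.2]⟩
        have h3 : frame ξ (s, y) + t • ξ = frame ξ (s + t, y) := by
          simp only [frame, add_smul]; abel
        rw [h3]; exact this
      rw [he]
      calc volume (Icc a b) ≤ volume (Icc (a + r) (b - r)) + ENNReal.ofReal (2 * r) := by
            rw [Real.volume_Icc, Real.volume_Icc]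
            refine le_trans (ENNReal.ofReal_le_ofReal ?_) ENNReal.ofReal_add_le
            linarith
        _ ≤ _ := by gcongr
    · have : slice ξ C y = ∅ := by
        rw [← not_nonempty_iff_eq_empty, slice_nonempty_iff h]; exact hy
      simp [this]
  · exact measurable_const.indicator (hC.image (continuous_cross ξ)).isClosed.measurableSet

/-- Nonempty compact convex planar sets. -/
structure CC (C : Set Plane) : Prop where
  compact : IsCompact C
  convex : Convex ℝ C
  nonempty : C.Nonempty

lemma CC.add {A B : Set Plane} (hA : CC A) (hB : CC B) : CC (A + B) :=
  ⟨hA.compact.add hB.compact, hA.convex.add hB.convex, hA.nonempty.add hB.nonempty⟩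

lemma CC.smul {A : Set Plane} (hA : CC A) (r : ℝ) : CC (r • A) :=
  ⟨hA.compact.smul r, hA.convex.smul r, hA.nonempty.smul_set⟩

lemma CC.singleton (x : Plane) : CC {x} :=
  ⟨isCompact_singleton, convex_singleton x, singleton_nonempty x⟩

lemma CC.seg (ξ : Plane) : CC (seg ξ) := by
  refine ⟨seg_compact ξ, ?_, seg_nonempty ξ⟩
  have : Wulff.seg ξ = (LinearMap.toSpanSingleton ℝ Plane ξ) '' Icc (-1) 1 := rfl
  rw [this]
  exact (convex_Icc _ _).linear_image _

lemma CC.er {C K : Set Plane} (hC : CC C) (hK : K.Nonempty) (hne : (er C K).Nonempty) :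
    CC (er C K) := ⟨isCompact_er hC.compact hK, convex_er hC.convex K, hne⟩

lemma CC.bdd {A : Set Plane} (hA : CC A) (ξ : Plane) :
    BddAbove (cross ξ '' A) ∧ BddBelow (cross ξ '' A) :=
  ⟨(hA.compact.image (continuous_cross ξ)).bddAbove, (hA.compact.image (continuous_cross ξ)).bddBelow⟩

lemma wid_add {A B : Set Plane} (hA : CC A) (hB : CC B) (ξ : Plane) :
    wid ξ (A + B) = wid ξ A + wid ξ B := by
  unfold wid
  rw [image_add, csSup_add (hA.nonempty.image _) (hA.bdd ξ).1 (hB.nonempty.image _) (hB.bdd ξ).1,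
    csInf_add (hA.nonempty.image _) (hA.bdd ξ).2 (hB.nonempty.image _) (hB.bdd ξ).2]
  ring

lemma wid_smul {r : ℝ} (hr : 0 ≤ r) (ξ : Plane) (A : Set Plane) :
    wid ξ (r • A) = r * wid ξ A := by
  unfold wid
  rw [image_smul_set, Real.sSup_smul_of_nonneg hr, Real.sInf_smul_of_nonneg hr]
  simp only [smul_eq_mul]; ring

lemma wid_mono {A B : Set Plane} (hA : A.Nonempty) (hB : IsCompact B) (h : A ⊆ B) (ξ : Plane) :
    wid ξ A ≤ wid ξ B := by
  have hc := hB.image (continuous_cross ξ)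
  have h1 := csSup_le_csSup hc.bddAbove (hA.image (cross ξ)) (image_mono h)
  have h2 := csInf_le_csInf hc.bddBelow (hA.image (cross ξ)) (image_mono h)
  unfold wid; linarith

/-- The zonotope generated by a list of segments. -/
def zon : List Plane → Set Plane
  | [] => {0}
  | ξ :: l => seg ξ + zon l

/-- The perimeter of `C` relative to the zonotope of `l`. -/
def perZ (l : List Plane) (C : Set Plane) : ℝ := (l.map fun ξ => 2 * wid ξ C).sum

/-- The area of the zonotope of `l`. -/
def kap : List Plane → ℝ
  | [] => 0
  | ξ :: l => perZ l (seg ξ) + kap l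

@[simp] lemma perZ_nil (C : Set Plane) : perZ [] C = 0 := rfl

@[simp] lemma perZ_cons (ξ : Plane) (l : List Plane) (C : Set Plane) :
    perZ (ξ :: l) C = 2 * wid ξ C + perZ l C := by simp [perZ]

lemma perZ_add (l : List Plane) {A B : Set Plane} (hA : CC A) (hB : CC B) :
    perZ l (A + B) = perZ l A + perZ l B := by
  induction l with
  | nil => simp
  | cons ξ l ih => simp only [perZ_cons, ih, wid_add hA hB]; ring

lemma perZ_smul (l : List Plane) {r : ℝ} (hr : 0 ≤ r) (A : Set Plane) :
    perZ l (r • A) = r * perZ l A := by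
  induction l with
  | nil => simp
  | cons ξ l ih => simp only [perZ_cons, ih, wid_smul hr]; ring

lemma perZ_mono (l : List Plane) {A B : Set Plane} (hA : A.Nonempty) (hB : IsCompact B)
    (h : A ⊆ B) : perZ l A ≤ perZ l B := by
  induction l with
  | nil => simp
  | cons ξ l ih => simp only [perZ_cons]; linarith [wid_mono hA hB h ξ]

lemma CC.zon (l : List Plane) : CC (zon l) := by
  induction l with
  | nil => exact CC.singleton 0
  | cons ξ l ih => exact (CC.seg ξ).add ih

lemma zon_append (l l' : List Plane) : zon (l ++ l') = zon l + zon l' := by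
  induction l with
  | nil => simp [Wulff.zon]
  | cons ξ l ih => simp [Wulff.zon, ih, add_assoc]

lemma neg_mem_zon {l : List Plane} {x : Plane} (h : x ∈ zon l) : -x ∈ zon l := by
  induction l generalizing x with
  | nil => simp_all [Wulff.zon]
  | cons ξ l ih =>
    obtain ⟨_, ⟨s, hs, rfl⟩, b, hb, rfl⟩ := h
    exact ⟨_, ⟨-s, ⟨by linarith [hs.2], by linarith [hs.1]⟩, rfl⟩, -b, ih hb, by
      simp only [neg_smul]; abel⟩

lemma zero_mem_zon (l : List Plane) : (0 : Plane) ∈ zon l := by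
  induction l with
  | nil => simp [Wulff.zon]
  | cons ξ l ih => exact ⟨0, ⟨0, by simp, by simp⟩, 0, ih, by simp⟩

lemma area_add_zon (l : List Plane) {r : ℝ} (hr : 0 ≤ r) {C : Set Plane} (hC : CC C) :
    area (C + r • zon l) = area C + r * perZ l C + r ^ 2 * kap l := by
  induction l generalizing C with
  | nil => simp [zon, kap, smul_set_singleton]
  | cons ξ l ih =>
    have hs := (CC.seg ξ).smul r
    rw [zon, smul_add, ← add_assoc, ih (hC.add hs), perZ_add l hC hs, perZ_smul l hr,
      volume_add_seg hC.compact hC.convex hC.nonempty ξ hr, perZ_cons, kap]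
    ring

lemma area_singleton (x : Plane) : area {x} = 0 := by simp [area, measureReal_def]

lemma wid_singleton (ξ x : Plane) : wid ξ {x} = 0 := by simp [wid]

lemma perZ_singleton (l : List Plane) (x : Plane) : perZ l {x} = 0 := by
  simp [perZ, wid_singleton]

lemma area_zon (l : List Plane) : area (zon l) = kap l := by
  have := area_add_zon l zero_le_one (CC.singleton 0)
  simpa [area_singleton, perZ_singleton] using this

lemma area_er_zon (l : List Plane) {r : ℝ} (hr : 0 ≤ r) {C : Set Plane} (hC : CC C)
    (hne : (er C (r • zon l)).Nonempty) :
    area C ≤ area (er C (r • zon l)) + r * perZ l C - r ^ 2 * kap l := by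
  induction l generalizing C with
  | nil => simp [zon, kap, smul_set_singleton, er]
  | cons ξ l ih =>
    have he : er C (r • zon (ξ :: l)) = er (er C (r • seg ξ)) (r • zon l) := by
      rw [er_er, zon, smul_add, add_comm]
    rw [he] at hne ⊢
    have hne' : (er C (r • seg ξ)).Nonempty := by
      obtain ⟨x, hx⟩ := hne
      have := hx 0 ⟨0, zero_mem_zon l, by simp⟩
      exact ⟨_, this⟩
    have hC' := hC.er ((seg_nonempty ξ).smul_set) hne'
    have h1 := ih hC' hne
    have h2 := volume_er_seg hC.compact hC.convex hC.nonempty ξ hr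
    have h3 := perZ_mono l (hC'.add ((CC.seg ξ).smul r)).nonempty hC.compact (er_add_subset C _)
    rw [perZ_add l hC' ((CC.seg ξ).smul r), perZ_smul l hr] at h3
    rw [perZ_cons, kap]
    nlinarith

/-! ### Approximating the unit ball of a norm by zonotopes -/

/-- The closed unit ball of `φ`. -/
def ball (φ : Plane → ℝ) : Set Plane := {x | φ x ≤ 1}

lemma _root_.IsNorm.map_zero {φ : Plane → ℝ} (hφ : IsNorm φ) : φ 0 = 0 := (hφ.eq_zero_iff 0).2 rfl

lemma _root_.IsNorm.map_neg {φ : Plane → ℝ} (hφ : IsNorm φ) (x : Plane) : φ (-x) = φ x := by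
  have := hφ.smul_eq (-1) x
  simpa using this

lemma _root_.IsNorm.le_mul {φ : Plane → ℝ} (hφ : IsNorm φ) :
    ∃ M, 0 < M ∧ ∀ x, φ x ≤ M * ‖x‖ := by
  refine ⟨φ (Pi.single 0 1) + φ (Pi.single 1 1) + 1, ?_, fun x => ?_⟩
  · linarith [hφ.nonneg (Pi.single 0 1), hφ.nonneg (Pi.single 1 1)]
  · have hx : x = x 0 • Pi.single 0 1 + x 1 • Pi.single 1 1 := by
      ext i; fin_cases i <;> simp
    have h0 : |x 0| ≤ ‖x‖ := norm_le_pi_norm x 0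
    have h1 : |x 1| ≤ ‖x‖ := norm_le_pi_norm x 1
    calc φ x = φ (x 0 • Pi.single 0 1 + x 1 • Pi.single 1 1) := by rw [← hx]
      _ ≤ |x 0| * φ (Pi.single 0 1) + |x 1| * φ (Pi.single 1 1) := by
        rw [← hφ.smul_eq, ← hφ.smul_eq]; exact hφ.add_le _ _
      _ ≤ ‖x‖ * φ (Pi.single 0 1) + ‖x‖ * φ (Pi.single 1 1) := by
        have := hφ.nonneg (Pi.single 0 1)
        have := hφ.nonneg (Pi.single 1 1)
        gcongr
      _ ≤ _ := by nlinarith [norm_nonneg x]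

lemma _root_.IsNorm.continuous {φ : Plane → ℝ} (hφ : IsNorm φ) : Continuous φ := by
  obtain ⟨M, hM, h⟩ := hφ.le_mul
  refine (LipschitzWith.of_dist_le_mul (K := M.toNNReal) fun x y => ?_).continuous
  rw [Real.dist_eq, dist_eq_norm, abs_le]
  have h1 := hφ.add_le (x - y) y
  have h2 := hφ.add_le (y - x) x
  have h3 := h (x - y)
  have h4 := h (y - x)
  rw [norm_sub_rev] at h4
  simp only [sub_add_cancel] at h1 h2
  rw [Real.coe_toNNReal M hM.le]
  constructor <;> linarith

lemma _root_.IsNorm.ge_mul {φ : Plane → ℝ} (hφ : IsNorm φ) :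
    ∃ c, 0 < c ∧ ∀ x, c * ‖x‖ ≤ φ x := by
  obtain ⟨y, hy, hmin⟩ := (isCompact_sphere (0 : Plane) 1).exists_isMinOn
    ⟨fun _ => 1, by simp⟩ hφ.continuous.continuousOn
  have hy0 : y ≠ 0 := by rintro rfl; simp at hy
  refine ⟨φ y, lt_of_le_of_ne (hφ.nonneg y) fun h => hy0 ((hφ.eq_zero_iff y).1 h.symm), fun x => ?_⟩
  by_cases hx : x = 0
  · simp [hx, hφ.map_zero]
  have hn : 0 < ‖x‖ := norm_pos_iff.2 hx
  have := hmin (show ‖x‖⁻¹ • x ∈ Metric.sphere (0 : Plane) 1 by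
    simp [norm_smul, hn.ne'])
  simp only [mem_ofPred_eq, hφ.smul_eq, abs_inv, abs_norm] at this
  rw [inv_mul_eq_div, le_div_iff₀ hn] at this
  exact this

lemma CC.ball {φ : Plane → ℝ} (hφ : IsNorm φ) : CC (ball φ) := by
  refine ⟨?_, ?_, 0, by simp [Wulff.ball, hφ.map_zero]⟩
  · obtain ⟨c, hc, h⟩ := hφ.ge_mul
    refine (isCompact_closedBall (0 : Plane) c⁻¹).of_isClosed_subset
      (isClosed_le hφ.continuous continuous_const) fun x hx => ?_
    rw [mem_closedBall_zero_iff, inv_eq_one_div, le_div_iff₀ hc]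
    have h2 : φ x ≤ 1 := hx
    linarith [h x]
  · intro x hx y hy a b ha hb hab
    have hx : φ x ≤ 1 := hx
    have hy : φ y ≤ 1 := hy
    have := hφ.add_le (a • x) (b • y)
    rw [hφ.smul_eq, hφ.smul_eq, abs_of_nonneg ha, abs_of_nonneg hb] at this
    change φ _ ≤ 1
    nlinarith

lemma mem_smul_ball {φ : Plane → ℝ} (hφ : IsNorm φ) {r : ℝ} (hr : 0 ≤ r) {x : Plane} :
    x ∈ r • ball φ ↔ φ x ≤ r := by
  constructor
  · rintro ⟨y, hy, rfl⟩
    have hy : φ y ≤ 1 := hy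
    simp only [hφ.smul_eq, abs_of_nonneg hr]
    nlinarith
  · intro h
    rcases hr.eq_or_lt with rfl | hr
    · have := (hφ.eq_zero_iff x).1 (le_antisymm h (hφ.nonneg x))
      exact ⟨0, by simp [ball, hφ.map_zero], by simp [this]⟩
    · refine ⟨r⁻¹ • x, ?_, by simp [smul_smul, hr.ne']⟩
      change φ _ ≤ 1
      rw [hφ.smul_eq, abs_of_pos (inv_pos.2 hr), inv_mul_eq_div, div_le_one hr]
      exact h

/-- A sequence on the unit sphere of `φ` that turns by a half turn in `N` steps. -/
structure Polygon (φ : Plane → ℝ) (N : ℕ) (p : ℕ → Plane) : Prop where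
  antiper : ∀ i, p (i + N) = -p i
  norm_one : ∀ i, φ (p i) = 1
  between : ∀ i j k, i < j → j < k → k < i + N →
    ∃ α β : ℝ, 0 ≤ α ∧ 0 ≤ β ∧ 1 ≤ α + β ∧ p j = α • p i + β • p k

lemma sum_range_shift {N : ℕ} {g : ℕ → ℝ} (hg : ∀ i, g (i + N) = g i) (k : ℕ) :
    ∑ i ∈ Finset.range N, g (k + i) = ∑ i ∈ Finset.range N, g i := by
  induction k with
  | zero => simp
  | succ k ih =>
    rw [← ih]
    have h1 := Finset.sum_range_succ (fun i => g (k + i)) N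
    have h2 := Finset.sum_range_succ' (fun i => g (k + i)) N
    rw [h1] at h2
    rw [hg] at h2
    simp only [add_zero] at h2
    have h3 : ∀ i, k + 1 + i = k + (i + 1) := fun i => by ring
    simp only [h3]
    linarith

lemma Polygon.sum_abs_le {φ : Plane → ℝ} {N : ℕ} {p : ℕ → Plane} (hp : Polygon φ N p)
    (hN : 0 < N) (f : Plane →ₗ[ℝ] ℝ) {M : ℝ} (hM : ∀ i, f (p i) ≤ M) :
    ∑ i ∈ Finset.range N, |f (p (i + 1)) - f (p i)| ≤ 2 * M := by
  set a : ℕ → ℝ := fun i => f (p i) with ha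
  have hanti : ∀ i, a (i + N) = -a i := fun i => by simp [ha, hp.antiper]
  obtain ⟨i0, -, hmax⟩ := (Finset.range (2 * N)).exists_max_image a ⟨0, by simp [hN]⟩
  have hper : ∀ i q, a (i + q * (2 * N)) = a i := by
    intro i q
    induction q with
    | zero => simp
    | succ q ih =>
      have : i + (q + 1) * (2 * N) = i + q * (2 * N) + N + N := by ring
      rw [this, hanti, hanti, neg_neg, ih]
  have hmax' : ∀ i, a i ≤ a i0 := by
    intro i
    have := hper (i % (2 * N)) (i / (2 * N))
    rw [Nat.mod_add_div'] at this
    rw [this]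
    exact hmax _ (Finset.mem_range.2 (Nat.mod_lt _ (by omega)))
  have hmin' : ∀ i, -a i0 ≤ a i := fun i => by
    have := hmax' (i + N); rw [hanti] at this; linarith
  have hQ : ∀ i j, i0 ≤ i → i ≤ j → j ≤ i0 + N → a j ≤ a i := by
    intro i j hi hij hj
    rcases hi.eq_or_lt with rfl | hi
    · exact hmax' _
    rcases hij.eq_or_lt with rfl | hij
    · exact le_rfl
    rcases hj.eq_or_lt with rfl | hj
    · rw [hanti]; exact hmin' _
    by_cases h0 : 0 ≤ a j
    · obtain ⟨α, β, hα, hβ, hab, he⟩ := hp.between i0 i j hi hij hj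
      have : a i = α * a i0 + β * a j := by simp [ha, he]
      have h2 := hmax' j
      rw [this]; nlinarith
    · by_cases h1 : 0 ≤ a i
      · linarith
      obtain ⟨α, β, hα, hβ, hab, he⟩ := hp.between i j (i0 + N) hij hj (by omega)
      have : a j = α * a i + β * a (i0 + N) := by simp [ha, he]
      have h2 := hmin' i
      rw [hanti] at this
      rw [this]; nlinarith
  have hg : ∀ i, |a (i + N + 1) - a (i + N)| = |a (i + 1) - a i| := by
    intro i
    have : i + N + 1 = i + 1 + N := by ring
    rw [this, hanti, hanti, ← abs_neg]; congr 1; ring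
  have h1 := sum_range_shift (g := fun i => |a (i + 1) - a i|) hg i0
  change ∑ i ∈ Finset.range N, |a (i + 1) - a i| ≤ 2 * M
  rw [← h1]
  have h2 : ∑ i ∈ Finset.range N, |a (i0 + i + 1) - a (i0 + i)|
      = ∑ i ∈ Finset.range N, (a (i0 + i) - a (i0 + (i + 1))) := by
    refine Finset.sum_congr rfl fun i hi => ?_
    have hi := Finset.mem_range.1 hi
    have := hQ (i0 + i) (i0 + i + 1) (by omega) (by omega) (by omega)
    rw [abs_of_nonpos (by linarith), neg_sub, add_assoc]
  rw [h2, Finset.sum_range_sub' (fun i => a (i0 + i)), hanti, add_zero]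
  have := hM i0
  linarith

/-- The half-edges of a polygon. -/
def edges (p : ℕ → Plane) (N : ℕ) : List Plane :=
  (List.range N).map fun i => (2⁻¹ : ℝ) • (p (i + 1) - p i)

lemma apply_le_of_mem_zon (f : Plane →ₗ[ℝ] ℝ) (l : List Plane) {z : Plane} (hz : z ∈ zon l) :
    f z ≤ (l.map fun ξ => |f ξ|).sum := by
  induction l generalizing z with
  | nil => simp_all [zon]
  | cons ξ l ih =>
    obtain ⟨_, ⟨s, hs, rfl⟩, b, hb, rfl⟩ := hz
    have h1 := ih hb
    have h2 : s * f ξ ≤ |f ξ| := by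
      calc s * f ξ ≤ |s * f ξ| := le_abs_self _
        _ = |s| * |f ξ| := abs_mul _ _
        _ ≤ 1 * |f ξ| := by gcongr; exact abs_le.2 hs
        _ = _ := one_mul _
    simp only [map_add, map_smul, smul_eq_mul, List.map_cons, List.sum_cons]
    linarith

lemma Polygon.zon_subset {φ : Plane → ℝ} (hφ : IsNorm φ) {N : ℕ} {p : ℕ → Plane}
    (hp : Polygon φ N p) (hN : 0 < N) : zon (edges p N) ⊆ ball φ := by
  intro z hz
  by_contra hzW
  obtain ⟨f, u, h1, h2⟩ := geometric_hahn_banach_closed_point (CC.ball hφ).convex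
    (CC.ball hφ).compact.isClosed hzW
  have h3 := apply_le_of_mem_zon (f : Plane →ₗ[ℝ] ℝ) _ hz
  have h4 := hp.sum_abs_le hN (f : Plane →ₗ[ℝ] ℝ) (M := u) fun i => (h1 _ (hp.norm_one i).le).le
  have h5 : ((edges p N).map fun ξ => |(f : Plane →ₗ[ℝ] ℝ) ξ|).sum =
      2⁻¹ * ∑ i ∈ Finset.range N, |f (p (i + 1)) - f (p i)| := by
    rw [edges, List.map_map, Finset.mul_sum]
    rw [← List.sum_toFinset _ List.nodup_range]
    rw [List.toFinset_range]
    refine Finset.sum_congr rfl fun i _ => ?_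
    simp [abs_mul]
  rw [h5] at h3
  simp only [ContinuousLinearMap.coe_coe] at h3 h4
  linarith

lemma sum_mem_zon (q : ℕ → Plane) (s : ℕ → ℝ) (hs : ∀ i, s i ∈ Icc (-1 : ℝ) 1) (N : ℕ) :
    ∑ i ∈ Finset.range N, s i • q i ∈ zon ((List.range N).map q) := by
  induction N with
  | zero => simp [zon]
  | succ N ih =>
    rw [Finset.sum_range_succ, List.range_succ, List.map_append, zon_append]
    exact ⟨_, ih, _, ⟨_, ⟨s N, hs N, rfl⟩, 0, by simp [zon], by simp⟩, rfl⟩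

lemma Polygon.vertex_mem_of_le {φ : Plane → ℝ} {N : ℕ} {p : ℕ → Plane}
    (hp : Polygon φ N p) {j : ℕ} (hj : j ≤ N) : p j ∈ zon (edges p N) := by
  have key : ∀ n, ∑ i ∈ Finset.range n, (if i < j then (1 : ℝ) else -1) • (2⁻¹ : ℝ) • (p (i + 1) - p i)
      = (2⁻¹ : ℝ) • (if n ≤ j then p n - p 0 else (2 : ℝ) • p j - p 0 - p n) := by
    intro n
    induction n with
    | zero => simp
    | succ n ih =>
      rw [Finset.sum_range_succ, ih]
      rcases lt_trichotomy n j with h | h | h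
      · simp only [h, h.le, Nat.succ_le_of_lt h, if_true]; module
      · subst h; simp only [le_refl, lt_irrefl, if_true, if_false, Nat.not_succ_le_self]; module
      · have h1 : ¬ n ≤ j := by omega
        have h2 : ¬ n < j := by omega
        have h3 : ¬ n + 1 ≤ j := by omega
        simp only [h1, h2, h3, if_false]; module
  have h1 := key N
  have hN : p N = - p 0 := by have := hp.antiper 0; simpa using this
  have h2 : (2⁻¹ : ℝ) • (if N ≤ j then p N - p 0 else (2 : ℝ) • p j - p 0 - p N) = p j := by
    split_ifs with h
    · have : j = N := le_antisymm hj h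
      subst this; rw [hN]; module
    · rw [hN]; module
  rw [h2] at h1
  rw [← h1]
  exact sum_mem_zon (fun i => (2⁻¹ : ℝ) • (p (i + 1) - p i)) (fun i => if i < j then 1 else -1)
    (fun i => by split_ifs <;> simp) N

lemma Polygon.vertex_mem {φ : Plane → ℝ} {N : ℕ} {p : ℕ → Plane}
    (hp : Polygon φ N p) (hN : 0 < N) (j : ℕ) : p j ∈ zon (edges p N) := by
  induction j using Nat.strong_induction_on with
  | _ j ih =>
    rcases le_or_gt j N with h | h
    · exact hp.vertex_mem_of_le h
    · have := hp.antiper (j - N)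
      rw [Nat.sub_add_cancel h.le] at this
      rw [this]
      exact neg_mem_zon (ih _ (by omega))

/-- The unit vector at angle `t`. -/
def dir (t : ℝ) : Plane := ![Real.cos t, Real.sin t]

lemma dir_ne (t : ℝ) : dir t ≠ 0 := by
  intro h
  have h0 := congrFun h 0
  have h1 := congrFun h 1
  simp [dir] at h0 h1
  have := Real.sin_sq_add_cos_sq t
  rw [h0, h1] at this; norm_num at this

lemma continuous_dir : Continuous dir := by
  unfold dir
  refine continuous_pi fun i => ?_
  fin_cases i
  · exact Real.continuous_cos
  · exact Real.continuous_sin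

lemma dir_between (x y z : ℝ) :
    Real.sin (z - x) • dir y = Real.sin (z - y) • dir x + Real.sin (y - x) • dir z := by
  ext i; fin_cases i
  · simp [dir, Real.sin_sub]
    ring
  · simp [dir, Real.sin_sub]
    ring

lemma _root_.IsNorm.pos {φ : Plane → ℝ} (hφ : IsNorm φ) {x : Plane} (hx : x ≠ 0) : 0 < φ x :=
  lt_of_le_of_ne (hφ.nonneg x) fun h => hx ((hφ.eq_zero_iff x).1 h.symm)

/-- The point of the unit sphere of `φ` at angle `t`. -/
def sph (φ : Plane → ℝ) (t : ℝ) : Plane := (φ (dir t))⁻¹ • dir t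

lemma norm_sph {φ : Plane → ℝ} (hφ : IsNorm φ) (t : ℝ) : φ (sph φ t) = 1 := by
  have := hφ.pos (dir_ne t)
  rw [sph, hφ.smul_eq, abs_of_pos (inv_pos.2 this), inv_mul_cancel₀ this.ne']

lemma continuous_sph {φ : Plane → ℝ} (hφ : IsNorm φ) : Continuous (sph φ) := by
  unfold sph
  exact ((hφ.continuous.comp continuous_dir).inv₀ fun t => (hφ.pos (dir_ne t)).ne').smul
    continuous_dir

lemma sph_add_pi {φ : Plane → ℝ} (hφ : IsNorm φ) (t : ℝ) : sph φ (t + Real.pi) = -sph φ t := by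
  have : dir (t + Real.pi) = -dir t := by ext i; fin_cases i <;> simp [dir]
  rw [sph, this, hφ.map_neg, sph, smul_neg]

lemma sph_between {φ : Plane → ℝ} (hφ : IsNorm φ) {x y z : ℝ} (hxy : x ≤ y) (hyz : y ≤ z) (hxz : x < z) (hz : z < x + Real.pi) :
    ∃ α β : ℝ, 0 ≤ α ∧ 0 ≤ β ∧ sph φ y = α • sph φ x + β • sph φ z := by
  have hx := hφ.pos (dir_ne x)
  have hy := hφ.pos (dir_ne y)
  have hz' := hφ.pos (dir_ne z)
  have hs : 0 < Real.sin (z - x) := Real.sin_pos_of_pos_of_lt_pi (by linarith) (by linarith)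
  have h1 : 0 ≤ Real.sin (z - y) := Real.sin_nonneg_of_nonneg_of_le_pi (by linarith) (by linarith)
  have h2 : 0 ≤ Real.sin (y - x) := Real.sin_nonneg_of_nonneg_of_le_pi (by linarith) (by linarith)
  refine ⟨Real.sin (z - y) / Real.sin (z - x) * φ (dir x) / φ (dir y),
    Real.sin (y - x) / Real.sin (z - x) * φ (dir z) / φ (dir y), by positivity, by positivity, ?_⟩
  have h3 : dir y = (Real.sin (z - x))⁻¹ • (Real.sin (z - y) • dir x + Real.sin (y - x) • dir z) := by
    rw [← dir_between, smul_smul, inv_mul_cancel₀ hs.ne', one_smul]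
  set c := φ (dir y) with hc
  rw [sph, ← hc, h3]
  simp only [sph, smul_add, smul_smul]
  congr 2 <;> field_simp

lemma polygon_sph {φ : Plane → ℝ} (hφ : IsNorm φ) {N : ℕ} (hN : 0 < N) : Polygon φ N fun i => sph φ (Real.pi * i / N) := by
  have hN' : (0 : ℝ) < N := by exact_mod_cast hN
  refine ⟨fun i => ?_, fun i => norm_sph hφ _, fun i j k hij hjk hk => ?_⟩
  · rw [← sph_add_pi hφ]; congr 1; push_cast; field_simp
  · have hij' : (i : ℝ) < j := by exact_mod_cast hij
    have hjk' : (j : ℝ) < k := by exact_mod_cast hjk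
    have hk' : (k : ℝ) < i + N := by exact_mod_cast hk
    have hpi := Real.pi_pos
    obtain ⟨α, β, hα, hβ, he⟩ := sph_between hφ (x := Real.pi * i / N) (y := Real.pi * j / N)
      (z := Real.pi * k / N) (by gcongr) (by gcongr) (by gcongr; linarith)
      (by rw [div_add' _ _ _ hN'.ne', ← mul_add]; gcongr)
    refine ⟨α, β, hα, hβ, ?_, he⟩
    have h1 := hφ.add_le (α • sph φ (Real.pi * i / N)) (β • sph φ (Real.pi * k / N))
    rw [← he, norm_sph hφ, hφ.smul_eq, hφ.smul_eq, norm_sph hφ, norm_sph hφ, abs_of_nonneg hα,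
      abs_of_nonneg hβ] at h1
    linarith

lemma exists_angle {φ : Plane → ℝ} (hφ : IsNorm φ) (w : Plane) : ∃ t ρ : ℝ, 0 ≤ t ∧ t ≤ 3 * Real.pi ∧ 0 ≤ ρ ∧ w = ρ • sph φ t := by
  set z : ℂ := ⟨w 0, w 1⟩ with hz
  have h1 := Complex.norm_mul_cos_arg z
  have h2 := Complex.norm_mul_sin_arg z
  refine ⟨z.arg + 2 * Real.pi, ‖z‖ * φ (dir (z.arg + 2 * Real.pi)), ?_, ?_, ?_, ?_⟩
  · linarith [Complex.neg_pi_lt_arg z, Real.pi_pos]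
  · linarith [Complex.arg_le_pi z]
  · exact mul_nonneg (norm_nonneg _) (hφ.nonneg _)
  · have hp := hφ.pos (dir_ne (z.arg + 2 * Real.pi))
    rw [sph, smul_smul, mul_assoc, mul_inv_cancel₀ hp.ne', mul_one]
    ext i; fin_cases i
    · simp [dir, hz]
    · simp [dir, hz]

lemma exists_zon {φ : Plane → ℝ} (hφ : IsNorm φ) {δ : ℝ} (hδ : 0 < δ) (hδ1 : δ < 1) :
    ∃ l, zon l ⊆ ball φ ∧ (1 - δ) • ball φ ⊆ zon l := by
  have huc : UniformContinuousOn (sph φ) (Icc 0 (4 * Real.pi)) :=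
    isCompact_Icc.uniformContinuousOn_of_continuous (continuous_sph hφ).continuousOn
  obtain ⟨M, hM, hφM⟩ := hφ.le_mul
  obtain ⟨ε, hε, hunif⟩ := Metric.uniformContinuousOn_iff.1 huc (δ / M) (by positivity)
  obtain ⟨N, hN⟩ := exists_nat_gt (max 2 (Real.pi / ε))
  have hN2 : (2 : ℝ) < N := (le_max_left _ _).trans_lt hN
  have hNε : Real.pi / ε < N := (le_max_right _ _).trans_lt hN
  have hN0 : 0 < N := by have : (0 : ℝ) < N := by linarith
                         exact_mod_cast this
  have hN' : (0 : ℝ) < N := by linarith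
  have hp := polygon_sph hφ hN0
  have hpi := Real.pi_pos
  refine ⟨edges _ N, hp.zon_subset hφ hN0, ?_⟩
  intro w hw
  rw [mem_smul_ball hφ (by linarith)] at hw
  obtain ⟨t, ρ, ht, ht3, hρ, rfl⟩ := exists_angle hφ w
  rw [hφ.smul_eq, norm_sph hφ, abs_of_nonneg hρ, mul_one] at hw
  set i := ⌊t * N / Real.pi⌋₊ with hi
  have hi1 : (i : ℝ) ≤ t * N / Real.pi := Nat.floor_le (by positivity)
  have hi2 : t * N / Real.pi < i + 1 := Nat.lt_floor_add_one _
  rw [le_div_iff₀ hpi] at hi1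
  rw [div_lt_iff₀ hpi] at hi2
  have hd : Real.pi * ((i + 1 : ℕ) : ℝ) / N - Real.pi * i / N = Real.pi / N := by
    push_cast; field_simp; ring
  have hlt : Real.pi / N < ε := by
    rw [div_lt_iff₀ hN']; rw [div_lt_iff₀ hε] at hNε; linarith
  have hlt2 : Real.pi / N < Real.pi := by rw [div_lt_iff₀ hN']; nlinarith
  have hpos : 0 < Real.pi / N := by positivity
  obtain ⟨α, β, hα, hβ, he⟩ := sph_between hφ (x := Real.pi * i / N) (y := t)
      (z := Real.pi * (i + 1 : ℕ) / N) (by rw [div_le_iff₀ hN']; linarith)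
      (by rw [le_div_iff₀ hN']; push_cast; linarith) (by linarith) (by linarith)
  have hit : Real.pi * i / N ≤ t := by rw [div_le_iff₀ hN']; linarith
  have hdist := hunif (Real.pi * (i + 1 : ℕ) / N) ⟨by positivity, by linarith⟩
    (Real.pi * i / N) ⟨by positivity, by linarith⟩
    (by rw [Real.dist_eq, hd, abs_of_pos hpos]; exact hlt)
  rw [dist_eq_norm] at hdist
  set P := sph φ (Real.pi * i / N) with hP
  set P' := sph φ (Real.pi * (i + 1 : ℕ) / N) with hP'
  have hsm : φ (P' - P) ≤ δ := by
    refine (hφM _).trans ?_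
    rw [lt_div_iff₀ hM] at hdist; linarith
  have hsum : (α + β) * (1 - δ) ≤ 1 := by
    have h1 := hφ.add_le (sph φ t) ((-β) • (P' - P))
    have h2 : sph φ t + (-β) • (P' - P) = (α + β) • P := by rw [he]; module
    rw [h2, hφ.smul_eq, norm_sph hφ, norm_sph hφ, hφ.smul_eq, abs_neg, abs_of_nonneg hβ,
      abs_of_nonneg (by linarith)] at h1
    nlinarith
  have hm1 : P ∈ zon (edges (fun i : ℕ => sph φ (Real.pi * i / N)) N) := hp.vertex_mem hN0 i
  have hm2 : P' ∈ zon (edges (fun i : ℕ => sph φ (Real.pi * i / N)) N) := hp.vertex_mem hN0 (i + 1)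
  have hm0 := zero_mem_zon (edges (fun i : ℕ => sph φ (Real.pi * i / N)) N)
  have hcv := (CC.zon (edges (fun i : ℕ => sph φ (Real.pi * i / N)) N)).convex
  have hle : ρ * α + ρ * β ≤ 1 := by nlinarith
  rw [he]
  have := hcv.sum_mem (t := Finset.univ) (w := ![ρ * α, ρ * β, 1 - (ρ * α + ρ * β)])
    (z := ![P, P', 0]) (by intro k _; fin_cases k <;> simp <;> first | positivity | linarith)
    (by simp [Fin.sum_univ_three]) (by intro k _; fin_cases k <;> simp [hm1, hm2, hm0])
  simpa [Fin.sum_univ_three, smul_add, smul_smul] using this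

section

lemma area_mono {A B : Set Plane} (hB : IsCompact B) (h : A ⊆ B) : area A ≤ area B :=
  measureReal_mono h hB.measure_lt_top.ne

lemma area_smul (r : ℝ) (A : Set Plane) : area (r • A) = r ^ 2 * area A := by
  rw [area, measureReal_def, Measure.addHaar_smul]
  simp [measureReal_def, ENNReal.toReal_mul, sq_nonneg]

lemma area_translate (x : Plane) (A : Set Plane) : area ({x} + A) = area A := by
  rw [area, measureReal_def, singleton_add, image_add_left, measure_preimage_add]
  rfl

lemma CC.interior_nonempty {C : Set Plane} (hC : CC C) (h : 0 < area C) : (interior C).Nonempty := by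
  by_contra hne
  rw [not_nonempty_iff_eq_empty] at hne
  have h1 := hC.convex.addHaar_frontier volume
  rw [hC.compact.isClosed.frontier_eq, hne, sdiff_empty] at h1
  simp [area, measureReal_def, h1] at h

lemma CC.eq_of_area_le {C D : Set Plane} (hC : CC C) (hD : IsClosed D) (hDC : D ⊆ C)
    (hpos : 0 < area C) (h : area C ≤ area D) : D = C := by
  refine hDC.antisymm ?_
  have hi := hC.interior_nonempty hpos
  have h1 : interior C ⊆ D := by
    by_contra hne
    rw [not_subset] at hne
    have hU : (interior C \ D).Nonempty := by
      obtain ⟨x, hx, hxD⟩ := hne; exact ⟨x, hx, hxD⟩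
    have hpos := (isOpen_interior.sdiff hD).measure_pos volume hU
    have h2 : volume D + volume (interior C \ D) ≤ volume C := by
      rw [← measure_union (disjoint_sdiff_right) (isOpen_interior.sdiff hD).measurableSet]
      exact measure_mono (union_subset hDC (sdiff_subset.trans interior_subset))
    have hfin : volume C ≠ ⊤ := hC.compact.measure_lt_top.ne
    have hDfin : volume D ≠ ⊤ := ne_top_of_le_ne_top hfin (measure_mono hDC)
    have h3 : volume C ≤ volume D := (ENNReal.toReal_le_toReal hfin hDfin).1 h
    have h4 := h2.trans h3
    have h5 := ENNReal.lt_add_right hDfin hpos.ne'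
    exact absurd h4 (not_le.2 h5)
  calc C = closure C := hC.compact.isClosed.closure_eq.symm
    _ = closure (interior C) := (hC.convex.closure_interior_eq_closure_of_nonempty_interior hi).symm
    _ ⊆ D := closure_minimal h1 hD

/-- The perimeter of a convex body relative to the unit ball of `φ`. -/
def per (φ : Plane → ℝ) (C : Set Plane) : ℝ := area (C + ball φ) - area C - area (ball φ)

/-- The erosion of `C` by the ball of radius `r`. -/
def ero (φ : Plane → ℝ) (C : Set Plane) (r : ℝ) : Set Plane := er C (r • ball φ)

/-- The closed ball of `φ` with centre `x` and radius `r`. -/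
def cball (φ : Plane → ℝ) (x : Plane) (r : ℝ) : Set Plane := {x} + r • ball φ

/-- The error in the zonotope approximation. -/
def dl (n : ℕ) : ℝ := 1 / ((n : ℝ) + 2)

lemma dl_pos (n : ℕ) : 0 < dl n := by unfold dl; positivity

lemma dl_lt (n : ℕ) : dl n < 1 := by
  unfold dl; rw [div_lt_one (by positivity)]; have : (0 : ℝ) ≤ n := n.cast_nonneg
  linarith

lemma dl_tendsto : Tendsto dl atTop (𝓝 0) := by
  have h := (tendsto_one_div_add_atTop_nhds_zero_nat (𝕜 := ℝ)).comp (tendsto_add_atTop_nat 1)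
  refine h.congr fun n => ?_
  simp only [Function.comp, dl]; push_cast; congr 1; ring

lemma dl_antitone : Antitone dl := by
  intro m n h
  unfold dl
  have : (m : ℝ) ≤ n := by exact_mod_cast h
  gcongr

lemma exists_zseq {φ : Plane → ℝ} (hφ : IsNorm φ) :
    ∃ l : ℕ → List Plane, ∀ n, zon (l n) ⊆ ball φ ∧ (1 - dl n) • ball φ ⊆ zon (l n) :=
  ⟨fun n => (exists_zon hφ (dl_pos n) (dl_lt n)).choose,
    fun n => (exists_zon hφ (dl_pos n) (dl_lt n)).choose_spec⟩

/-- A sequence of generators of zonotopes converging to the unit ball. -/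
structure ZSeq (φ : Plane → ℝ) (l : ℕ → List Plane) : Prop where
  sub : ∀ n, zon (l n) ⊆ ball φ
  sup : ∀ n, (1 - dl n) • ball φ ⊆ zon (l n)

lemma one_sub_dl_pos (n : ℕ) : 0 < 1 - dl n := by linarith [dl_lt n]

lemma one_sub_dl_tendsto : Tendsto (fun n => 1 - dl n) atTop (𝓝 1) := by
  simpa using dl_tendsto.const_sub 1

lemma smul_ball_subset_smul_zon {φ : Plane → ℝ} {l : List Plane} {δ : ℝ} (hδ : 0 < 1 - δ)
    (h : (1 - δ) • ball φ ⊆ zon l) (r : ℝ) : r • ball φ ⊆ (r / (1 - δ)) • zon l := by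
  have : r • ball φ = (r / (1 - δ)) • ((1 - δ) • ball φ) := by
    rw [smul_smul, div_mul_cancel₀ _ hδ.ne']
  rw [this]
  exact smul_set_mono h

lemma ZSeq.tendsto_kap {φ : Plane → ℝ} (hφ : IsNorm φ) {l : ℕ → List Plane} (hl : ZSeq φ l) :
    Tendsto (fun n => kap (l n)) atTop (𝓝 (area (ball φ))) := by
  have h1 : Tendsto (fun n => (1 - dl n) ^ 2 * area (ball φ)) atTop (𝓝 (area (ball φ))) := by
    simpa using (one_sub_dl_tendsto.pow 2).mul_const (area (ball φ))
  refine tendsto_of_tendsto_of_tendsto_of_le_of_le h1 tendsto_const_nhds (fun n => ?_) fun n => ?_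
  · have := area_mono (CC.zon (l n)).compact (hl.sup n)
    rwa [area_smul, area_zon] at this
  · have := area_mono (CC.ball hφ).compact (hl.sub n)
    rwa [area_zon] at this

lemma ZSeq.tendsto_perZ {φ : Plane → ℝ} (hφ : IsNorm φ) {l : ℕ → List Plane} (hl : ZSeq φ l)
    {C : Set Plane} (hC : CC C) : Tendsto (fun n => perZ (l n) C) atTop (𝓝 (per φ C)) := by
  have hk := hl.tendsto_kap hφ
  have h1 : Tendsto (fun n => (1 - dl n) * (per φ C + area (ball φ)) - kap (l n) / (1 - dl n)) atTop
      (𝓝 (1 * (per φ C + area (ball φ)) - area (ball φ) / 1)) :=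
    (one_sub_dl_tendsto.mul_const _).sub (hk.div one_sub_dl_tendsto one_ne_zero)
  have h2 : Tendsto (fun n => per φ C + area (ball φ) - kap (l n)) atTop
      (𝓝 (per φ C + area (ball φ) - area (ball φ))) := hk.const_sub _
  rw [one_mul, div_one, add_sub_cancel_right] at h1
  rw [add_sub_cancel_right] at h2
  refine tendsto_of_tendsto_of_tendsto_of_le_of_le h1 h2 (fun n => ?_) fun n => ?_
  · have hp := one_sub_dl_pos n
    have hz := smul_ball_subset_smul_zon hp (hl.sup n) 1
    rw [one_smul] at hz
    have h3 := area_mono (hC.add ((CC.zon (l n)).smul (1 / (1 - dl n)))).compact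
      (add_subset_add_left (s := C) hz)
    rw [area_add_zon _ (by positivity) hC] at h3
    have h4 : (1 - dl n) * (area C + 1 / (1 - dl n) * perZ (l n) C + (1 / (1 - dl n)) ^ 2 * kap (l n))
        = (1 - dl n) * area C + perZ (l n) C + kap (l n) / (1 - dl n) := by field_simp
    have h5 := mul_le_mul_of_nonneg_left h3 hp.le
    rw [h4] at h5
    simp only [per]
    linarith
  · have h3 := area_mono (hC.add (CC.ball hφ)).compact (add_subset_add_left (s := C) (hl.sub n))
    have h4 := area_add_zon (l n) zero_le_one hC
    rw [one_smul] at h4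
    simp only [per]
    linarith

lemma steiner {φ : Plane → ℝ} (hφ : IsNorm φ) {C : Set Plane} (hC : CC C) {r : ℝ} (hr : 0 ≤ r) :
    area (C + r • ball φ) = area C + r * per φ C + r ^ 2 * area (ball φ) := by
  obtain ⟨l, hl'⟩ := exists_zseq hφ
  have hl : ZSeq φ l := ⟨fun n => (hl' n).1, fun n => (hl' n).2⟩
  have hk := hl.tendsto_kap hφ
  have hp := hl.tendsto_perZ hφ hC
  have h1 : Tendsto (fun n => area C + r * perZ (l n) C + r ^ 2 * kap (l n)) atTop
      (𝓝 (area C + r * per φ C + r ^ 2 * area (ball φ))) :=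
    ((hp.const_mul r).const_add _).add (hk.const_mul _)
  have hs : Tendsto (fun n => r / (1 - dl n)) atTop (𝓝 r) := by
    have h := (tendsto_const_nhds (x := r)).div one_sub_dl_tendsto one_ne_zero
    rw [div_one] at h
    exact h
  have h2 : Tendsto (fun n => area C + r / (1 - dl n) * perZ (l n) C
      + (r / (1 - dl n)) ^ 2 * kap (l n)) atTop
      (𝓝 (area C + r * per φ C + r ^ 2 * area (ball φ))) :=
    ((hs.mul hp).const_add _).add ((hs.pow 2).mul hk)
  refine le_antisymm (ge_of_tendsto' h2 fun n => ?_) (le_of_tendsto' h1 fun n => ?_)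
  · have hq := one_sub_dl_pos n
    rw [← area_add_zon _ (by positivity) hC]
    exact area_mono (hC.add ((CC.zon (l n)).smul _)).compact
      (add_subset_add_left (smul_ball_subset_smul_zon hq (hl.sup n) r))
  · rw [← area_add_zon _ hr hC]
    exact area_mono (hC.add ((CC.ball hφ).smul _)).compact
      (add_subset_add_left (smul_set_mono (hl.sub n)))

section
variable {φ : Plane → ℝ}

lemma per_add (hφ : IsNorm φ) {A B : Set Plane} (hA : CC A) (hB : CC B) :
    per φ (A + B) = per φ A + per φ B := by
  obtain ⟨l, hl'⟩ := exists_zseq hφ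
  have hl : ZSeq φ l := ⟨fun n => (hl' n).1, fun n => (hl' n).2⟩
  refine tendsto_nhds_unique (hl.tendsto_perZ hφ (hA.add hB)) ?_
  simp only [perZ_add _ hA hB]
  exact (hl.tendsto_perZ hφ hA).add (hl.tendsto_perZ hφ hB)

lemma per_smul (hφ : IsNorm φ) {A : Set Plane} (hA : CC A) {r : ℝ} (hr : 0 ≤ r) :
    per φ (r • A) = r * per φ A := by
  obtain ⟨l, hl'⟩ := exists_zseq hφ
  have hl : ZSeq φ l := ⟨fun n => (hl' n).1, fun n => (hl' n).2⟩
  refine tendsto_nhds_unique (hl.tendsto_perZ hφ (hA.smul r)) ?_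
  simp only [perZ_smul _ hr]
  exact (hl.tendsto_perZ hφ hA).const_mul r

lemma per_mono (hφ : IsNorm φ) {A B : Set Plane} (hA : CC A) (hB : CC B) (h : A ⊆ B) :
    per φ A ≤ per φ B := by
  obtain ⟨l, hl'⟩ := exists_zseq hφ
  have hl : ZSeq φ l := ⟨fun n => (hl' n).1, fun n => (hl' n).2⟩
  exact le_of_tendsto_of_tendsto' (hl.tendsto_perZ hφ hA) (hl.tendsto_perZ hφ hB)
    fun n => perZ_mono _ hA.nonempty hB.compact h

lemma per_singleton (x : Plane) : per φ {x} = 0 := by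
  rw [per, area_translate, area_singleton]; ring

lemma per_nonneg (hφ : IsNorm φ) {A : Set Plane} (hA : CC A) : 0 ≤ per φ A := by
  obtain ⟨x, hx⟩ := hA.nonempty
  rw [← per_singleton (φ := φ) x]
  exact per_mono hφ (CC.singleton x) hA (singleton_subset_iff.2 hx)

lemma per_ball (hφ : IsNorm φ) : per φ (ball φ) = 2 * area (ball φ) := by
  have h : ball φ + ball φ = (2 : ℝ) • ball φ := by
    have := (CC.ball hφ).convex.add_smul (zero_le_one' ℝ) (zero_le_one' ℝ)
    rw [one_smul] at this
    rw [← this]; norm_num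
  rw [per, h, area_smul]; ring

lemma area_ball_pos (hφ : IsNorm φ) : 0 < area (ball φ) := by
  have hU : IsOpen {x : Plane | φ x < 1} := isOpen_lt hφ.continuous continuous_const
  have h1 : 0 < volume {x : Plane | φ x < 1} :=
    hU.measure_pos volume ⟨0, by simp [hφ.map_zero]⟩
  have h2 : 0 < volume (ball φ) := h1.trans_le (measure_mono fun x (hx : φ x < 1) => hx.le)
  exact ENNReal.toReal_pos h2.ne' (CC.ball hφ).compact.measure_lt_top.ne

lemma CC.cball (hφ : IsNorm φ) (x : Plane) (r : ℝ) : CC (cball φ x r) :=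
  (CC.singleton x).add ((CC.ball hφ).smul r)

lemma area_cball (x : Plane) (r : ℝ) : area (cball φ x r) = r ^ 2 * area (ball φ) := by
  rw [cball, area_translate, area_smul]

lemma per_cball (hφ : IsNorm φ) (x : Plane) {r : ℝ} (hr : 0 ≤ r) :
    per φ (cball φ x r) = 2 * r * area (ball φ) := by
  rw [cball, per_add hφ (CC.singleton x) ((CC.ball hφ).smul r), per_singleton,
    per_smul hφ (CC.ball hφ) hr, per_ball hφ]
  ring

lemma mem_ero {C : Set Plane} {x : Plane} {r : ℝ} : x ∈ ero φ C r ↔ cball φ x r ⊆ C := by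
  constructor
  · rintro h _ ⟨_, rfl, w, hw, rfl⟩; exact h w hw
  · intro h w hw; exact h ⟨x, rfl, w, hw, rfl⟩

lemma smul_ball_mono (hφ : IsNorm φ) {r s : ℝ} (hr : 0 ≤ r) (h : r ≤ s) :
    r • ball φ ⊆ s • ball φ := by
  intro x hx
  rw [mem_smul_ball hφ hr] at hx
  rw [mem_smul_ball hφ (hr.trans h)]
  exact hx.trans h

lemma smul_ball_add (hφ : IsNorm φ) {r s : ℝ} (hr : 0 ≤ r) (hs : 0 ≤ s) :
    r • ball φ + s • ball φ = (r + s) • ball φ :=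
  ((CC.ball hφ).convex.add_smul hr hs).symm

lemma ero_anti (hφ : IsNorm φ) (C : Set Plane) {r s : ℝ} (hr : 0 ≤ r) (h : r ≤ s) :
    ero φ C s ⊆ ero φ C r := er_anti (smul_ball_mono hφ hr h)

lemma ball_nonempty (hφ : IsNorm φ) : (ball φ).Nonempty := (CC.ball hφ).nonempty

lemma ero_zero (hφ : IsNorm φ) (C : Set Plane) : ero φ C 0 = C := by
  rw [ero, zero_smul_set (ball_nonempty hφ)]
  ext x; simp [er]

lemma ero_ero (hφ : IsNorm φ) (C : Set Plane) {r s : ℝ} (hr : 0 ≤ r) (hs : 0 ≤ s) :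
    ero φ (ero φ C r) s = ero φ C (r + s) := by
  rw [ero, ero, er_er, smul_ball_add hφ hs hr, add_comm s r]; rfl

lemma CC.ero (hφ : IsNorm φ) {C : Set Plane} (hC : CC C) {r : ℝ} (hne : (ero φ C r).Nonempty) :
    CC (ero φ C r) := CC.er hC (ball_nonempty hφ).smul_set hne

lemma isCompact_ero (hφ : IsNorm φ) {C : Set Plane} (hC : IsCompact C) (r : ℝ) :
    IsCompact (Wulff.ero φ C r) := isCompact_er hC (ball_nonempty hφ).smul_set

/-- Radii increasing to `r`. -/
def rs (r : ℝ) (n : ℕ) : ℝ := r * (1 - dl n)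

lemma rs_nonneg {r : ℝ} (hr : 0 ≤ r) (n : ℕ) : 0 ≤ rs r n := mul_nonneg hr (one_sub_dl_pos n).le

lemma rs_mono {r : ℝ} (hr : 0 ≤ r) : Monotone (rs r) := fun m n h => by
  have := dl_antitone h
  unfold rs; gcongr

lemma rs_le {r : ℝ} (hr : 0 ≤ r) (n : ℕ) : rs r n ≤ r := by
  have := dl_pos n
  unfold rs; nlinarith

lemma rs_tendsto (r : ℝ) : Tendsto (rs r) atTop (𝓝 r) := by
  have h := one_sub_dl_tendsto.const_mul r
  rw [mul_one] at h
  exact h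

lemma iInter_ero (hφ : IsNorm φ) {C : Set Plane} (hC : IsClosed C) {r : ℝ} (hr : 0 ≤ r) :
    ⋂ n, ero φ C (rs r n) = ero φ C r := by
  refine subset_antisymm ?_ (subset_iInter fun n => ero_anti hφ C (rs_nonneg hr n) (rs_le hr n))
  rintro x hx _ ⟨w, hw, rfl⟩
  rw [mem_iInter] at hx
  have h1 : ∀ n, x + rs r n • w ∈ C := fun n => hx n _ ⟨w, hw, rfl⟩
  have h2 : Tendsto (fun n => x + rs r n • w) atTop (𝓝 (x + r • w)) :=
    ((rs_tendsto r).smul_const w).const_add x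
  exact hC.mem_of_tendsto h2 (Eventually.of_forall h1)

lemma ero_rs_antitone (hφ : IsNorm φ) (C : Set Plane) {r : ℝ} (hr : 0 ≤ r) :
    Antitone fun n => ero φ C (rs r n) := fun _ _ h =>
  ero_anti hφ C (rs_nonneg hr _) (rs_mono hr h)

lemma tendsto_area_ero (hφ : IsNorm φ) {C : Set Plane} (hC : IsCompact C) {r : ℝ} (hr : 0 ≤ r) :
    Tendsto (fun n => area (ero φ C (rs r n))) atTop (𝓝 (area (ero φ C r))) := by
  have h := tendsto_measure_iInter_atTop (μ := volume) (s := fun n => ero φ C (rs r n))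
    (fun n => (isCompact_ero hφ hC _).isClosed.measurableSet.nullMeasurableSet)
    (ero_rs_antitone hφ C hr) ⟨0, (isCompact_ero hφ hC _).measure_lt_top.ne⟩
  rw [iInter_ero hφ hC.isClosed hr] at h
  exact (ENNReal.tendsto_toReal (isCompact_ero hφ hC _).measure_lt_top.ne).comp h

/-- The Bonnesen-type bound for the area lost by erosion. -/
lemma area_le_ero (hφ : IsNorm φ) {C : Set Plane} (hC : CC C) {r : ℝ} (hr : 0 ≤ r)
    (hne : (ero φ C r).Nonempty) :
    area C ≤ area (ero φ C r) + r * per φ C - r ^ 2 * area (ball φ) := by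
  obtain ⟨l, hl'⟩ := exists_zseq hφ
  have hl : ZSeq φ l := ⟨fun n => (hl' n).1, fun n => (hl' n).2⟩
  have hk := hl.tendsto_kap hφ
  have hp := hl.tendsto_perZ hφ hC
  have h1 := ((tendsto_area_ero hφ hC.compact hr).add (hp.const_mul r)).sub (hk.const_mul (r ^ 2))
  refine ge_of_tendsto' h1 fun n => ?_
  have h2 : ero φ C r ⊆ er C (r • zon (l n)) := er_anti (smul_set_mono (hl.sub n))
  have h3 : er C (r • zon (l n)) ⊆ ero φ C (rs r n) := by
    refine er_anti ?_
    rw [rs, ← smul_smul]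
    exact smul_set_mono (hl.sup n)
  have h4 := area_er_zon (l n) hr hC (hne.mono h2)
  have h5 := area_mono (isCompact_ero hφ hC.compact _) h3
  linarith

/-- The opening of `C` by the ball of radius `r`. -/
def opn (φ : Plane → ℝ) (C : Set Plane) (r : ℝ) : Set Plane := ero φ C r + r • ball φ

lemma opn_subset (C : Set Plane) (r : ℝ) : opn φ C r ⊆ C := er_add_subset _ _

lemma CC.opn (hφ : IsNorm φ) {C : Set Plane} (hC : CC C) {r : ℝ} (hne : (Wulff.ero φ C r).Nonempty) :
    CC (opn φ C r) := (hC.ero hφ hne).add ((CC.ball hφ).smul r)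

lemma per_opn (hφ : IsNorm φ) {C : Set Plane} (hC : CC C) {r : ℝ} (hr : 0 ≤ r)
    (hne : (ero φ C r).Nonempty) :
    per φ (opn φ C r) = per φ (ero φ C r) + 2 * r * area (ball φ) := by
  rw [opn, per_add hφ (hC.ero hφ hne) ((CC.ball hφ).smul r), per_smul hφ (CC.ball hφ) hr,
    per_ball hφ]; ring

lemma area_opn (hφ : IsNorm φ) {C : Set Plane} (hC : CC C) {r : ℝ} (hr : 0 ≤ r)
    (hne : (ero φ C r).Nonempty) :
    area (opn φ C r) = area (ero φ C r) + r * per φ (ero φ C r) + r ^ 2 * area (ball φ) :=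
  steiner hφ (hC.ero hφ hne) hr

lemma per_le_of_antitone (hφ : IsNorm φ) {A : ℕ → Set Plane} {B : Set Plane} (hA : ∀ n, CC (A n))
    (hanti : Antitone A) (hB : CC B) (hAB : ⋂ n, A n ⊆ B) {c : ℝ} (hc : ∀ n, c ≤ per φ (A n)) :
    c ≤ per φ B := by
  refine le_of_forall_pos_le_add fun ε hε => ?_
  set η := ε / (2 * area (ball φ)) with hη
  have hW := area_ball_pos hφ
  have hη0 : 0 < η := by positivity
  have hU : IsOpen (B + {x : Plane | φ x < η}) :=
    (isOpen_lt hφ.continuous continuous_const).add_left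
  obtain ⟨n, hn⟩ := exists_subset_nhds_of_isCompact (V := A) hanti.directed_ge
    (fun n => (hA n).compact) (U := B + {x : Plane | φ x < η})
    (fun x hx => hU.mem_nhds ⟨x, hAB hx, 0, by simpa [hφ.map_zero] using hη0, by simp⟩)
  have h1 : A n ⊆ B + η • ball φ := hn.trans (add_subset_add_left fun x (hx : φ x < η) =>
    (mem_smul_ball hφ hη0.le).2 hx.le)
  have h2 := per_mono hφ (hA n) (hB.add ((CC.ball hφ).smul η)) h1
  rw [per_add hφ hB ((CC.ball hφ).smul η), per_smul hφ (CC.ball hφ) hη0.le, per_ball hφ] at h2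
  have h3 : η * (2 * area (ball φ)) = ε := by rw [hη]; field_simp
  linarith [hc n]

lemma eq_opn_of_area_eq (hφ : IsNorm φ) {C : Set Plane} (hC : CC C) {r : ℝ} (hr : 0 < r)
    (hne : (ero φ C r).Nonempty)
    (h : area (ero φ C r) + r * per φ C - r ^ 2 * area (ball φ) ≤ area C) :
    opn φ C r = C := by
  have hW := area_ball_pos hφ
  have hE := hC.ero hφ hne
  have hne' : ∀ s, 0 ≤ s → s ≤ r → (ero φ C s).Nonempty := fun s h0 hs =>
    hne.mono (ero_anti hφ C h0 hs)
  have key : per φ C - 2 * r * area (ball φ) ≤ per φ (ero φ C r) := by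
    refine per_le_of_antitone hφ (A := fun n => ero φ C (rs r n))
      (fun n => hC.ero hφ (hne' _ (rs_nonneg hr.le n) (rs_le hr.le n)))
      (ero_rs_antitone hφ C hr.le) hE (iInter_ero hφ hC.compact.isClosed hr.le).subset fun n => ?_
    set s := rs r n with hs
    have hs0 : 0 ≤ s := rs_nonneg hr.le n
    have hsr : s < r := by
      have := dl_pos n
      rw [hs]; unfold rs; nlinarith
    have hCs := hC.ero hφ (hne' s hs0 hsr.le)
    have he : ero φ (ero φ C s) (r - s) = ero φ C r := by
      rw [ero_ero hφ C hs0 (by linarith)]; congr 1; ring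
    have h1 := area_le_ero hφ hC hs0 (hne' s hs0 hsr.le)
    have h2 := area_le_ero hφ hCs (r := r - s) (by linarith) (by rw [he]; exact hne)
    rw [he] at h2
    have h3 : (r - s) * (per φ C - 2 * r * area (ball φ)) ≤ (r - s) * per φ (ero φ C s) := by
      nlinarith [mul_nonneg (mul_nonneg (sub_nonneg.2 hsr.le) (sub_nonneg.2 hsr.le)) hW.le]
    exact le_of_mul_le_mul_left h3 (by linarith)
  have hO := hC.opn hφ hne
  have hmono := area_mono hC.compact (opn_subset (φ := φ) C r)
  have ha := area_opn hφ hC hr.le hne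
  have h4 : area C ≤ area (opn φ C r) := by
    have := area_le_ero hφ hC hr.le hne
    nlinarith
  have hpos : 0 < area C := by
    refine lt_of_lt_of_le ?_ hmono
    rw [ha]
    have := per_nonneg hφ hE
    have h0 : 0 ≤ area (ero φ C r) := measureReal_nonneg
    positivity
  exact hC.eq_of_area_le hO.compact.isClosed (opn_subset C r) hpos h4

/-- Inradius of a convex body. -/
lemma exists_inradius (hφ : IsNorm φ) {C : Set Plane} (hC : CC C) :
    ∃ ρ, 0 ≤ ρ ∧ (ero φ C ρ).Nonempty ∧ area (ero φ C ρ) = 0 ∧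
      ∀ r, 0 ≤ r → (ero φ C r).Nonempty → r ≤ ρ := by
  set T : Set (Plane × ℝ) := {p | 0 ≤ p.2 ∧ ∀ w ∈ ball φ, p.1 + p.2 • w ∈ C} with hT
  have hTc : IsClosed T := by
    have : T = {p : Plane × ℝ | 0 ≤ p.2} ∩ ⋂ w ∈ ball φ, (fun p : Plane × ℝ => p.1 + p.2 • w) ⁻¹' C := by
      ext p; simp [hT]
    rw [this]
    exact (isClosed_le continuous_const continuous_snd).inter
      (isClosed_biInter fun w _ => hC.compact.isClosed.preimage (by fun_prop))
  obtain ⟨B, hB⟩ := hC.compact.isBounded.exists_norm_le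
  set w0 := sph φ 0
  have hw0 : φ w0 = 1 := norm_sph hφ 0
  obtain ⟨M, hM, hle⟩ := hφ.le_mul
  have hsub : T ⊆ C ×ˢ Icc 0 (M * (2 * B)) := by
    rintro ⟨x, r⟩ ⟨h0, h⟩
    have h1 : x ∈ C := by
      have := h 0 (by simp [ball, hφ.map_zero]); simpa using this
    refine ⟨h1, h0, ?_⟩
    have h2 := hB _ (h w0 hw0.le)
    have h3 := hle (r • w0)
    rw [hφ.smul_eq, hw0, mul_one, abs_of_nonneg h0] at h3
    have h4 : ‖r • w0‖ ≤ 2 * B := by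
      have : r • w0 = (x + r • w0) - x := by abel
      rw [this]
      exact (norm_sub_le _ _).trans (by linarith [hB x h1])
    exact h3.trans (by gcongr)
  have hTcomp : IsCompact T := (hC.compact.prod isCompact_Icc).of_isClosed_subset hTc hsub
  have hmem : ∀ x r, 0 ≤ r → (x ∈ ero φ C r ↔ (x, r) ∈ T) := by
    intro x r hr
    constructor
    · intro h; exact ⟨hr, fun w hw => h _ ⟨w, hw, rfl⟩⟩
    · rintro ⟨-, h⟩ _ ⟨w, hw, rfl⟩; exact h w hw
  have hTne : T.Nonempty := by
    obtain ⟨x, hx⟩ := hC.nonempty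
    exact ⟨(x, 0), (hmem x 0 le_rfl).1 (by rw [ero_zero hφ]; exact hx)⟩
  obtain ⟨⟨x, ρ⟩, hxρ, hmax⟩ := hTcomp.exists_isMaxOn hTne continuous_snd.continuousOn
  have hρ : 0 ≤ ρ := hxρ.1
  have hmax' : ∀ r, 0 ≤ r → (ero φ C r).Nonempty → r ≤ ρ := by
    rintro r hr ⟨y, hy⟩
    exact hmax ((hmem y r hr).1 hy)
  have hne : (ero φ C ρ).Nonempty := ⟨x, (hmem x ρ hρ).2 hxρ⟩
  refine ⟨ρ, hρ, hne, ?_, hmax'⟩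
  by_contra h0
  have hpos : 0 < area (ero φ C ρ) := lt_of_le_of_ne measureReal_nonneg (Ne.symm h0)
  obtain ⟨y, hy⟩ := (hC.ero hφ hne).interior_nonempty hpos
  obtain ⟨c, hc, hge⟩ := hφ.ge_mul
  obtain ⟨ε, hε, hball⟩ := Metric.isOpen_iff.1 isOpen_interior y hy
  have h1 : y ∈ ero φ (ero φ C ρ) (c * ε / 2) := by
    rintro _ ⟨w, hw, rfl⟩
    refine interior_subset (hball ?_)
    have hw : φ w ≤ 1 := hw
    have h2 := hge w
    have h3 : ‖(c * ε / 2) • w‖ < ε := by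
      rw [norm_smul, Real.norm_eq_abs, abs_of_pos (by positivity)]
      nlinarith
    simpa [Metric.mem_ball, dist_eq_norm] using h3
  rw [ero_ero hφ C hρ (by positivity)] at h1
  have := hmax' _ (by positivity) ⟨y, h1⟩
  nlinarith

lemma isoperimetric (hφ : IsNorm φ) {C : Set Plane} (hC : CC C) :
    ∃ ρ x, 0 ≤ ρ ∧ cball φ x ρ ⊆ C ∧ area C + ρ ^ 2 * area (ball φ) ≤ ρ * per φ C := by
  obtain ⟨ρ, hρ, ⟨x, hx⟩, h0, -⟩ := exists_inradius hφ hC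
  have := area_le_ero hφ hC hρ ⟨x, hx⟩
  exact ⟨ρ, x, hρ, mem_ero.1 hx, by linarith⟩

end

end

section

lemma diverg_eq (η : Plane → Plane) (x : Plane) :
    diverg η x = fderiv ℝ η x (Pi.single 0 1) 0 + fderiv ℝ η x (Pi.single 1 1) 1 := by
  simp [diverg, Fin.sum_univ_two]

lemma continuous_diverg {η : Plane → Plane} (hη : ContDiff ℝ 1 η) : Continuous (diverg η) := by
  have h := hη.continuous_fderiv one_ne_zero
  have : diverg η = fun x => fderiv ℝ η x (Pi.single 0 1) 0 + fderiv ℝ η x (Pi.single 1 1) 1 :=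
    funext (diverg_eq η)
  rw [this]
  fun_prop

/-- The Jacobian determinant of `η`. -/
def jac (η : Plane → Plane) (x : Plane) : ℝ :=
  fderiv ℝ η x (Pi.single 0 1) 0 * fderiv ℝ η x (Pi.single 1 1) 1 -
    fderiv ℝ η x (Pi.single 1 1) 0 * fderiv ℝ η x (Pi.single 0 1) 1

lemma continuous_jac {η : Plane → Plane} (hη : ContDiff ℝ 1 η) : Continuous (jac η) := by
  have h := hη.continuous_fderiv one_ne_zero
  unfold jac
  fun_prop

lemma det_eq (L : Plane →L[ℝ] Plane) : L.det =
    L (Pi.single 0 1) 0 * L (Pi.single 1 1) 1 - L (Pi.single 1 1) 0 * L (Pi.single 0 1) 1 := by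
  have h : L.det = LinearMap.det (L : Plane →ₗ[ℝ] Plane) := rfl
  rw [h, ← LinearMap.det_toMatrix', Matrix.det_fin_two]
  simp [LinearMap.toMatrix'_apply]

lemma det_perturb (η : Plane → Plane) (x : Plane) (ε : ℝ) :
    (ContinuousLinearMap.id ℝ Plane + ε • fderiv ℝ η x).det =
      1 + ε * diverg η x + ε ^ 2 * jac η x := by
  rw [det_eq, diverg_eq, jac]
  simp
  ring

lemma integral_diverg_le {φ : Plane → ℝ} (hφ : IsNorm φ) {C : Set Plane} (hC : CC C)
    {η : Plane → Plane} (hη : ContDiff ℝ 1 η) (hs : HasCompactSupport η) (hb : ∀ x, φ (η x) ≤ 1) :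
    ∫ x in C, diverg η x ≤ per φ C := by
  obtain ⟨K, hK⟩ := hη.lipschitzWith_of_hasCompactSupport hs one_ne_zero
  have hCm := hC.compact.isClosed.measurableSet
  have hint : ∀ {f : Plane → ℝ}, Continuous f → IntegrableOn f C := fun hf =>
    hf.continuousOn.integrableOn_compact hC.compact
  set J := ∫ x in C, jac η x with hJ
  have key : ∀ ε : ℝ, 0 < ε → ε * (K + 1) < 1 →
      ∫ x in C, diverg η x ≤ per φ C + ε * (area (ball φ) - J) := by
    intro ε hε hεK
    set f : Plane → Plane := fun x => x + ε • η x with hf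
    have hinj : InjOn f C := by
      intro x _ y _ hxy
      by_contra hne
      have hd : 0 < dist x y := dist_pos.2 hne
      have h1 : x - y = ε • (η y - η x) := by
        simp only [hf] at hxy
        rw [smul_sub, sub_eq_sub_iff_add_eq_add, hxy, add_comm]
      have h2 : dist x y ≤ ε * (K * dist x y) := by
        rw [dist_eq_norm x y]
        nth_rewrite 1 [h1]
        rw [norm_smul, Real.norm_eq_abs, abs_of_pos hε, ← dist_eq_norm, ← dist_eq_norm, dist_comm x y]
        gcongr
        exact hK.dist_le_mul _ _
      nlinarith [K.2]
    have hderiv : ∀ x ∈ C, HasFDerivWithinAt f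
        (ContinuousLinearMap.id ℝ Plane + ε • fderiv ℝ η x) C x := by
      intro x _
      have := (hη.differentiable one_ne_zero x).hasFDerivAt
      exact ((hasFDerivAt_id x).add (this.const_smul ε)).hasFDerivWithinAt
    have h1 := lintegral_abs_det_fderiv_eq_addHaar_image volume hCm hderiv hinj
    have h2 : f '' C ⊆ C + ε • ball φ := by
      rintro _ ⟨x, hx, rfl⟩
      exact ⟨x, hx, _, ⟨η x, hb x, rfl⟩, rfl⟩
    have hCε := hC.add ((CC.ball hφ).smul ε)
    have h3 : ∫ x in C, |(ContinuousLinearMap.id ℝ Plane + ε • fderiv ℝ η x).det| ≤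
        area (C + ε • ball φ) := by
      rw [integral_eq_lintegral_of_nonneg_ae (Eventually.of_forall fun x => abs_nonneg _), h1]
      · exact ENNReal.toReal_mono hCε.compact.measure_lt_top.ne (measure_mono h2)
      · simp only [det_perturb]
        have := continuous_diverg hη
        have := continuous_jac hη
        exact Continuous.aestronglyMeasurable (by fun_prop)
    have hcd := continuous_diverg hη
    have hcj := continuous_jac hη
    have h4 : ∫ x in C, (1 + ε * diverg η x + ε ^ 2 * jac η x) ≤
        ∫ x in C, |(ContinuousLinearMap.id ℝ Plane + ε • fderiv ℝ η x).det| := by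
      simp only [det_perturb]
      exact integral_mono (hint (by fun_prop)) (hint (by fun_prop)) fun x => le_abs_self _
    have h5 : ∫ x in C, (1 + ε * diverg η x + ε ^ 2 * jac η x) =
        area C + ε * (∫ x in C, diverg η x) + ε ^ 2 * J := by
      rw [integral_add (hint (by fun_prop)) (hint (by fun_prop)),
        integral_add (hint (by fun_prop)) (hint (by fun_prop)), integral_const_mul,
        integral_const_mul]
      simp [area, measureReal_def, hJ]
    rw [steiner hφ hC hε.le] at h3
    rw [h5] at h4
    have h6 : ε * (∫ x in C, diverg η x) ≤ ε * (per φ C + ε * (area (ball φ) - J)) := by nlinarith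
    exact le_of_mul_le_mul_left h6 hε
  have hK0 : (0 : ℝ) ≤ K := K.2
  have ht : Tendsto (fun ε : ℝ => per φ C + ε * (area (ball φ) - J)) (𝓝[>] 0) (𝓝 (per φ C)) := by
    have : Continuous fun ε : ℝ => per φ C + ε * (area (ball φ) - J) := by fun_prop
    have h := this.tendsto 0
    simp only [zero_mul, add_zero] at h
    exact h.mono_left nhdsWithin_le_nhds
  refine ge_of_tendsto ht ?_
  have hpos : (0 : ℝ) < 1 / (K + 1) := by positivity
  filter_upwards [Ioo_mem_nhdsGT hpos] with ε hε
  refine key ε hε.1 ?_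
  have := hε.2
  rw [lt_div_iff₀ (by positivity)] at this
  exact this

/-- The sum of the indicators of a family of sets. -/
def vsum {ι : Type} (D : ι → Set Plane) (x : Plane) : ℝ :=
  (∑' i, (D i).indicator (1 : Plane → ℝ≥0∞) x).toReal

lemma vsum_eq_tsum {ι : Type} (D : ι → Set Plane) (x : Plane) :
    vsum D x = ∑' i, (D i).indicator (1 : Plane → ℝ) x := by
  rw [vsum, ENNReal.tsum_toReal_eq fun i => by by_cases h : x ∈ D i <;> simp [h]]
  congr 1; funext i
  by_cases h : x ∈ D i <;> simp [h]

lemma tsum_volume_eq {ι : Type} {D : ι → Set Plane} (hD : ∀ i, CC (D i)) (hs : Summable fun i => area (D i)) :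
    ∑' i, volume (D i) = ENNReal.ofReal (∑' i, area (D i)) := by
  rw [ENNReal.ofReal_tsum_of_nonneg (fun i => measureReal_nonneg) hs]
  congr 1; funext i
  simp only [measureReal_def]
  rw [ENNReal.ofReal_toReal (hD i).compact.measure_lt_top.ne]

lemma vsum_eq_ncard {ι : Type} {D : ι → Set Plane} {x : Plane} (h : {i | x ∈ D i}.Finite) :
    vsum D x = ({i | x ∈ D i}.ncard : ℝ) := by
  rw [vsum_eq_tsum, tsum_eq_sum (s := h.toFinset)]
  · rw [ncard_eq_toFinset_card _ h, Finset.card_eq_sum_ones, Nat.cast_sum]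
    refine Finset.sum_congr rfl fun i hi => ?_
    have : x ∈ D i := by simpa using hi
    simp [this]
  · intro i hi
    have : x ∉ D i := by simpa using hi
    simp [this]

section
variable {ι : Type} [Countable ι] {D : ι → Set Plane}

lemma lintegral_vsum (hD : ∀ i, CC (D i)) (hs : Summable fun i => area (D i)) :
    ∫⁻ x, ∑' i, (D i).indicator (1 : Plane → ℝ≥0∞) x = ENNReal.ofReal (∑' i, area (D i)) := by
  rw [lintegral_tsum fun i => (measurable_one.indicator
    (hD i).compact.isClosed.measurableSet).aemeasurable, ← tsum_volume_eq hD hs]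
  congr 1; funext i
  rw [lintegral_indicator_one (hD i).compact.isClosed.measurableSet]

lemma measurable_vsum (hD : ∀ i, CC (D i)) :
    Measurable fun x => ∑' i, (D i).indicator (1 : Plane → ℝ≥0∞) x :=
  Measurable.tsum fun i => measurable_one.indicator (hD i).compact.isClosed.measurableSet

lemma integrable_vsum (hD : ∀ i, CC (D i)) (hs : Summable fun i => area (D i)) :
    Integrable (vsum D) := by
  refine integrable_toReal_of_lintegral_ne_top (measurable_vsum hD).aemeasurable ?_
  rw [lintegral_vsum hD hs]
  exact ENNReal.ofReal_ne_top

lemma integral_vsum (hD : ∀ i, CC (D i)) (hs : Summable fun i => area (D i)) :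
    ∫ x, vsum D x = ∑' i, area (D i) := by
  have hne : ∫⁻ x, ∑' i, (D i).indicator (1 : Plane → ℝ≥0∞) x ≠ ⊤ := by
    rw [lintegral_vsum hD hs]; exact ENNReal.ofReal_ne_top
  unfold vsum
  rw [integral_toReal (measurable_vsum hD).aemeasurable
    (ae_lt_top (measurable_vsum hD) hne), lintegral_vsum hD hs,
    ENNReal.toReal_ofReal (tsum_nonneg fun i => measureReal_nonneg)]

lemma ae_finite_mem (hD : ∀ i, CC (D i)) (hs : Summable fun i => area (D i)) :
    ∀ᵐ x ∂(volume : Measure Plane), {i | x ∈ D i}.Finite :=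
  ae_finite_setOfPred_mem (by rw [tsum_volume_eq hD hs]; exact ENNReal.ofReal_ne_top)

lemma anisoTV_vsum_le {φ : Plane → ℝ} (hφ : IsNorm φ) (hD : ∀ i, CC (D i))
    (hs : Summable fun i => area (D i)) (hp : Summable fun i => per φ (D i)) :
    anisoTV φ (vsum D) ≤ ENNReal.ofReal (∑' i, per φ (D i)) := by
  unfold anisoTV
  refine iSup₂_le fun η hη => ENNReal.ofReal_le_ofReal ?_
  obtain ⟨h1, h2, h3⟩ := hη
  have hcd := continuous_diverg h1
  have hcs : HasCompactSupport (diverg η) := by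
    refine h2.fderiv (𝕜 := ℝ) |>.mono fun x hx => ?_
    contrapose! hx
    have : fderiv ℝ η x = 0 := by simpa using hx
    simp [diverg_eq, this]
  obtain ⟨B, hB⟩ := hcd.bounded_above_of_compact_support hcs
  have hB0 : 0 ≤ B := (norm_nonneg _).trans (hB 0)
  set F : ι → Plane → ℝ := fun i => (D i).indicator (diverg η) with hF
  have hm : ∀ i, MeasurableSet (D i) := fun i => (hD i).compact.isClosed.measurableSet
  have hFi : ∀ i, Integrable (F i) := fun i =>
    (hcd.continuousOn.integrableOn_compact (hD i).compact).integrable_indicator (hm i)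
  have hsum : Summable fun i => ∫ x, ‖F i x‖ := by
    refine Summable.of_nonneg_of_le (fun i => integral_nonneg fun x => norm_nonneg _) (fun i => ?_)
      (hs.mul_left B)
    have : (fun x => ‖F i x‖) = (D i).indicator fun x => ‖diverg η x‖ := by
      funext x; by_cases h : x ∈ D i <;> simp [hF, h]
    rw [this, integral_indicator (hm i)]
    have h4 := norm_setIntegral_le_of_norm_le_const (μ := volume) (f := fun x => ‖diverg η x‖)
      (s := D i) (C := B) (hD i).compact.measure_lt_top (fun x _ => by simpa using hB x)
    exact (le_abs_self _).trans h4
  have h5 := hasSum_integral_of_summable_integral_norm hFi hsum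
  have h6 : ∀ x, ∑' i, F i x = vsum D x * diverg η x := by
    intro x
    rw [vsum_eq_tsum, ← tsum_mul_right]
    congr 1; funext i
    by_cases h : x ∈ D i <;> simp [hF, h]
  simp only [h6] at h5
  rw [← h5.tsum_eq]
  refine Summable.tsum_le_tsum (fun i => ?_) h5.summable hp
  rw [hF, integral_indicator (hm i)]
  exact integral_diverg_le hφ (hD i) h1 h2 h3

lemma admissible_vsum {φ : Plane → ℝ} (hφ : IsNorm φ) {Ω : Set Plane} (hΩo : IsOpen Ω)
    (hΩ : Convex ℝ Ω) (hD : ∀ i, CC (D i)) (hDΩ : ∀ i, D i ⊆ closure Ω)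
    (hs : Summable fun i => area (D i)) (hp : Summable fun i => per φ (D i)) :
    Admissible φ Ω (∑' i, area (D i)) (vsum D) := by
  have h1 : ∀ᵐ x ∂(volume : Measure Plane), x ∉ Ω → vsum D x = 0 := by
    have := hΩ.addHaar_frontier volume
    filter_upwards [compl_mem_ae_iff.2 this] with x hx hxΩ
    have hxD : ∀ i, x ∉ D i := fun i hi => hx (by
      rw [hΩo.frontier_eq]; exact ⟨hDΩ i hi, hxΩ⟩)
    simp [vsum, hxD]
  refine ⟨⟨integrable_vsum hD hs, ne_top_of_le_ne_top ENNReal.ofReal_ne_top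
    (anisoTV_vsum_le hφ hD hs hp)⟩, h1, ?_, ?_⟩
  · filter_upwards [ae_finite_mem hD hs] with x hx
    exact ⟨_, vsum_eq_ncard hx⟩
  · rw [← integral_vsum hD hs, ← integral_indicator hΩo.measurableSet]
    refine integral_congr_ae ?_
    filter_upwards [h1] with x hx
    by_cases h : x ∈ Ω
    · simp [h]
    · simp [h, hx h]

end

end

lemma hasCompactSupport_diverg {η : Plane → Plane} (h : HasCompactSupport η) :
    HasCompactSupport (diverg η) := by
  refine h.fderiv (𝕜 := ℝ) |>.mono fun x hx => ?_
  contrapose! hx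
  have : fderiv ℝ η x = 0 := by simpa using hx
  simp [diverg_eq, this]

lemma integral_diverg_le_of_anisoTV_le {φ u : Plane → ℝ} {T : ℝ} (hT : 0 ≤ T)
    (h : anisoTV φ u ≤ ENNReal.ofReal T) {η : Plane → Plane} (h1 : ContDiff ℝ 1 η)
    (h2 : HasCompactSupport η) (h3 : ∀ x, φ (η x) ≤ 1) : ∫ x, u x * diverg η x ≤ T := by
  have h4 : ENNReal.ofReal (∫ x, u x * diverg η x) ≤ ENNReal.ofReal T :=
    le_trans (le_iSup₂_of_le (f := fun (η : Plane → Plane) (_ : η ∈ {η : Plane → Plane |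
      ContDiff ℝ 1 η ∧ HasCompactSupport η ∧ ∀ x, φ (η x) ≤ 1}) =>
        ENNReal.ofReal (∫ x, u x * diverg η x)) η ⟨h1, h2, h3⟩ le_rfl) h
  exact (ENNReal.ofReal_le_ofReal_iff hT).1 h4

/-- A symmetric mollifier supported in a ball of radius `dl n`. -/
def bump (n : ℕ) : ContDiffBump (0 : Plane) :=
  ⟨dl n / 2, dl n, by have := dl_pos n; positivity, by have := dl_pos n; linarith⟩

/-- The mollification of `u` at scale `dl n`. -/
def moll (u : Plane → ℝ) (n : ℕ) (x : Plane) : ℝ := ∫ y, (bump n).normed volume y * u (x - y)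

lemma moll_eq (u : Plane → ℝ) (n : ℕ) : moll u n =
    convolution ((bump n).normed volume) u (ContinuousLinearMap.lsmul ℝ ℝ) volume := by
  funext x; simp [moll, convolution]

lemma contDiff_moll {u : Plane → ℝ} (hu : Integrable u) (n : ℕ) : ContDiff ℝ 2 (moll u n) := by
  rw [moll_eq]
  exact (bump n).hasCompactSupport_normed.contDiff_convolution_left (n := 2) _
    (bump n).contDiff_normed hu.locallyIntegrable

lemma moll_nonneg {u : Plane → ℝ} (hu : ∀ᵐ x, 0 ≤ u x) (n : ℕ) (x : Plane) : 0 ≤ moll u n x := by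
  refine integral_nonneg_of_ae ?_
  have h : ∀ᵐ y, 0 ≤ u (x - y) := (quasiMeasurePreserving_sub_left volume x).ae hu
  filter_upwards [h] with y hy
  exact mul_nonneg ((bump n).nonneg_normed y) hy

lemma mem_cthickening_of_moll_ne {u : Plane → ℝ} {Ω : Set Plane} (h : ∀ x ∉ Ω, u x = 0) {n : ℕ}
    {x : Plane} (hx : moll u n x ≠ 0) : x ∈ Metric.cthickening (dl n) Ω := by
  rw [moll_eq] at hx
  obtain ⟨a, ha, b, hb, rfl⟩ := support_convolution_subset _ hx
  have hb' : b ∈ Ω := by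
    by_contra hc; exact hb (h b hc)
  rw [(bump n).support_normed_eq] at ha
  refine Metric.mem_cthickening_of_dist_le (a + b) b _ _ hb' ?_
  have : dist a 0 < dl n := ha
  rw [dist_eq_norm, add_sub_cancel_right]
  rw [dist_zero_right] at this
  exact this.le

lemma hasCompactSupport_moll {u : Plane → ℝ} {Ω : Set Plane} (hΩ : Bornology.IsBounded Ω)
    (h : ∀ x ∉ Ω, u x = 0) (n : ℕ) : HasCompactSupport (moll u n) :=
  HasCompactSupport.intro (K := Metric.cthickening (dl n) Ω)
    (Metric.isCompact_of_isClosed_isBounded Metric.isClosed_cthickening hΩ.cthickening)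
    fun x hx => by
      by_contra hc; exact hx (mem_cthickening_of_moll_ne h hc)

lemma tendsto_moll {u : Plane → ℝ} (hu : Integrable u) :
    ∀ᵐ x, Tendsto (fun n => moll u n x) atTop (𝓝 (u x)) := by
  simp only [moll_eq]
  refine ContDiffBump.ae_convolution_tendsto_right_of_locallyIntegrable (K := 2) dl_tendsto
    (Eventually.of_forall fun n => ?_) hu.locallyIntegrable
  change dl n ≤ 2 * (dl n / 2)
  linarith

lemma anisoTV_moll_le {φ u : Plane → ℝ} (hu : Integrable u) {T : ℝ} (hT : 0 ≤ T)
    (h : anisoTV φ u ≤ ENNReal.ofReal T) (n : ℕ) : anisoTV φ (moll u n) ≤ ENNReal.ofReal T := by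
  unfold anisoTV
  refine iSup₂_le fun η hη => ENNReal.ofReal_le_ofReal ?_
  obtain ⟨h1, h2, h3⟩ := hη
  set ρ := (bump n).normed (volume : Measure Plane) with hρ
  have hρi : Integrable ρ := (bump n).integrable_normed
  obtain ⟨B, hB⟩ := (continuous_diverg h1).bounded_above_of_compact_support
    (hasCompactSupport_diverg h2)
  have hint : Integrable (Function.uncurry fun x y => ρ y * u (x - y) * diverg η x)
      (volume.prod volume) := by
    have h4 := hρi.convolution_integrand (ContinuousLinearMap.lsmul ℝ ℝ) hu
    refine h4.mul_bdd (g := fun p : Plane × Plane => diverg η p.1) (c := B) ?_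
      (Eventually.of_forall fun p => hB p.1)
    exact ((continuous_diverg h1).comp continuous_fst).aestronglyMeasurable
  have h5 : ∫ x, moll u n x * diverg η x = ∫ y, ρ y * ∫ x, u x * diverg η (x + y) := by
    simp only [moll, ← hρ]
    have : ∀ x, (∫ y, ρ y * u (x - y)) * diverg η x = ∫ y, ρ y * u (x - y) * diverg η x :=
      fun x => (integral_mul_const _ _).symm
    simp only [this]
    rw [integral_integral_swap hint]
    refine integral_congr_ae (Eventually.of_forall fun y => ?_)
    simp only
    rw [← integral_sub_right_eq_self (fun x => u x * diverg η (x + y)) y, ← integral_const_mul]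
    refine integral_congr_ae (Eventually.of_forall fun x => ?_)
    simp only [sub_add_cancel]
    ring
  have h6 : ∀ y, ∫ x, u x * diverg η (x + y) ≤ T := by
    intro y
    have h7 : diverg (fun x => η (x + y)) = fun x => diverg η (x + y) := by
      funext x; simp only [diverg]; rw [fderiv_comp_add_right]
    have h8 : HasCompactSupport fun x => η (x + y) :=
      h2.comp_homeomorph (Homeomorph.addRight y)
    have := integral_diverg_le_of_anisoTV_le hT h (η := fun x => η (x + y))
      (h1.comp (by fun_prop)) h8 (fun x => h3 _)
    rwa [h7] at this
  rw [h5]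
  calc ∫ y, ρ y * ∫ x, u x * diverg η (x + y) ≤ ∫ y, ρ y * T := by
        have hi : Integrable fun y => ρ y * ∫ x, u x * diverg η (x + y) := by
          have h9 := hint.integral_prod_right
          refine h9.congr (Eventually.of_forall fun y => ?_)
          simp only [Function.uncurry]
          rw [← integral_sub_right_eq_self (fun x => u x * diverg η (x + y)) y,
            ← integral_const_mul]
          refine integral_congr_ae (Eventually.of_forall fun x => ?_)
          simp only [sub_add_cancel]
          ring
        exact integral_mono hi (hρi.mul_const T) fun y =>
          mul_le_mul_of_nonneg_left (h6 y) ((bump n).nonneg_normed y)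
    _ = T := by rw [integral_mul_const, (bump n).integral_normed, one_mul]

section

/-- A smooth approximation of `-sign`. -/
def sgn (δ s : ℝ) : ℝ := -s / √(s ^ 2 + δ ^ 2)

lemma contDiff_sgn {δ : ℝ} (hδ : 0 < δ) : ContDiff ℝ 1 (sgn δ) := by
  unfold sgn
  refine ContDiff.div (by fun_prop) (ContDiff.sqrt (by fun_prop) fun s => ?_) fun s => ?_
  · positivity
  · positivity

lemma abs_sgn_le {δ : ℝ} (hδ : 0 < δ) (s : ℝ) : |sgn δ s| ≤ 1 := by
  unfold sgn
  have : 0 < √(s ^ 2 + δ ^ 2) := by positivity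
  rw [abs_div, abs_neg, abs_of_pos this, div_le_one this]
  exact Real.abs_le_sqrt (by nlinarith)

lemma le_sgn_mul {δ : ℝ} (hδ : 0 < δ) (s : ℝ) : |s| - δ ≤ -(s * sgn δ s) := by
  unfold sgn
  have h : 0 < √(s ^ 2 + δ ^ 2) := by positivity
  have h2 : √(s ^ 2 + δ ^ 2) ≤ |s| + δ := by
    rw [Real.sqrt_le_left (by positivity)]
    nlinarith [sq_abs s, abs_nonneg s]
  have h3 : -(s * (-s / √(s ^ 2 + δ ^ 2))) = s ^ 2 / √(s ^ 2 + δ ^ 2) := by ring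
  rw [h3, le_div_iff₀ h]
  rcases le_total |s| δ with h4 | h4
  · nlinarith [sq_nonneg s]
  · nlinarith [sq_abs s]

/-- The directional derivative of `g` along `ξ`. -/
def der (g : Plane → ℝ) (ξ x : Plane) : ℝ := fderiv ℝ g x ξ

/-- A test field which nearly realizes the total variation associated with the zonotope of `l`. -/
def fld (g : Plane → ℝ) (δ : ℝ) : List Plane → Plane → Plane
  | [] => fun _ => 0
  | ξ :: l => fun x => sgn δ (der g ξ x) • ξ + fld g δ l x

section
variable {g : Plane → ℝ}

lemma contDiff_der (hg : ContDiff ℝ 2 g) (ξ : Plane) : ContDiff ℝ 1 (der g ξ) := by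
  unfold der
  exact (hg.fderiv_right (m := 1) (by norm_num)).clm_apply contDiff_const

lemma hasCompactSupport_der (hs : HasCompactSupport g) (ξ : Plane) :
    HasCompactSupport (der g ξ) := hs.fderiv_apply (𝕜 := ℝ) ξ

lemma contDiff_fld (hg : ContDiff ℝ 2 g) {δ : ℝ} (hδ : 0 < δ) (l : List Plane) :
    ContDiff ℝ 1 (fld g δ l) := by
  induction l with
  | nil => exact contDiff_const
  | cons ξ l ih => exact (((contDiff_sgn hδ).comp (contDiff_der hg ξ)).smul contDiff_const).add ih

lemma hasCompactSupport_sgn (hs : HasCompactSupport g) (δ : ℝ) (ξ : Plane) :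
    HasCompactSupport fun x => sgn δ (der g ξ x) :=
  (hasCompactSupport_der hs ξ).comp_left (g := sgn δ) (by simp [sgn])

lemma hasCompactSupport_fld (hs : HasCompactSupport g) (δ : ℝ) (l : List Plane) :
    HasCompactSupport (fld g δ l) := by
  induction l with
  | nil => exact HasCompactSupport.zero
  | cons ξ l ih => exact ((hasCompactSupport_sgn hs δ ξ).smul_right).add ih

lemma fld_mem_zon {δ : ℝ} (hδ : 0 < δ) (l : List Plane) (x : Plane) : fld g δ l x ∈ zon l := by
  induction l with
  | nil => exact mem_singleton _
  | cons ξ l ih =>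
    exact add_mem_add ⟨_, abs_le.1 (abs_sgn_le hδ _), rfl⟩ ih

lemma diverg_smul_const {τ : Plane → ℝ} (hτ : Differentiable ℝ τ) (ξ x : Plane) :
    diverg (fun y => τ y • ξ) x = der τ ξ x := by
  have h1 : fderiv ℝ (fun y => τ y • ξ) x = (fderiv ℝ τ x).smulRight ξ :=
    (hτ x).hasFDerivAt.smul_const ξ |>.fderiv
  have h2 : ξ = ξ 0 • Pi.single 0 1 + ξ 1 • Pi.single 1 1 := by
    ext i; fin_cases i <;> simp
  rw [diverg_eq, h1, der]
  conv_rhs => rw [h2, map_add, map_smul, map_smul]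
  simp only [ContinuousLinearMap.smulRight_apply, Pi.smul_apply, smul_eq_mul]
  ring

lemma integral_mul_diverg_fld (hg : ContDiff ℝ 2 g) (hs : HasCompactSupport g) {δ : ℝ}
    (hδ : 0 < δ) (l : List Plane) : ∫ x, g x * diverg (fld g δ l) x =
      (l.map fun ξ => ∫ x, -(der g ξ x * sgn δ (der g ξ x))).sum := by
  induction l with
  | nil => simp [fld, diverg]
  | cons ξ l ih =>
    have hτ : ContDiff ℝ 1 fun x => sgn δ (der g ξ x) := (contDiff_sgn hδ).comp (contDiff_der hg ξ)
    have hτd : Differentiable ℝ fun x => sgn δ (der g ξ x) := hτ.differentiable one_ne_zero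
    have hgd : Differentiable ℝ g := hg.differentiable two_ne_zero
    have hl := contDiff_fld hg hδ l
    have h1 : ∀ x, diverg (fld g δ (ξ :: l)) x =
        der (fun x => sgn δ (der g ξ x)) ξ x + diverg (fld g δ l) x := by
      intro x
      rw [← diverg_smul_const hτd]
      simp only [diverg_eq, fld]
      rw [fderiv_fun_add ((hτd x).smul_const ξ) (hl.differentiable one_ne_zero x)]
      simp only [_root_.add_apply, Pi.add_apply]
      ring
    have hc1 : Continuous (der (fun x => sgn δ (der g ξ x)) ξ) :=
      (hτ.continuous_fderiv one_ne_zero).clm_apply continuous_const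
    have hcg := hg.continuous
    have hcd : Continuous (der g ξ) := (contDiff_der hg ξ).continuous
    have hi : ∀ {f : Plane → ℝ}, Continuous f → Integrable fun x => g x * f x := fun hf =>
      (hcg.mul hf).integrable_of_hasCompactSupport hs.mul_right
    simp only [h1, mul_add, List.map_cons, List.sum_cons]
    rw [integral_add (hi hc1) (hi (continuous_diverg hl)), ih]
    congr 1
    rw [integral_neg]
    refine integral_mul_fderiv_eq_neg_fderiv_mul_of_integrable ?_ (hi hc1) (hi hτ.continuous)
      (fun x _ => hgd x) (fun x _ => hτd x)
    exact (hcd.mul hτ.continuous).integrable_of_hasCompactSupport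
      (hasCompactSupport_der hs ξ).mul_right

lemma sum_integral_der_le {φ : Plane → ℝ} (hg : ContDiff ℝ 2 g) (hs : HasCompactSupport g)
    {l : List Plane} (hl : zon l ⊆ ball φ) {T : ℝ} (hT : 0 ≤ T)
    (h : anisoTV φ g ≤ ENNReal.ofReal T) : (l.map fun ξ => ∫ x, |der g ξ x|).sum ≤ T := by
  have hcs : ∀ ξ, Integrable fun x => |der g ξ x| := fun ξ =>
    ((contDiff_der hg ξ).continuous.integrable_of_hasCompactSupport (hasCompactSupport_der hs ξ)).abs
  have key : ∀ δ > 0, (l.map fun ξ => ∫ x, |der g ξ x|).sum ≤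
      T + δ * (l.length * volume.real (tsupport g)) := by
    intro δ hδ
    have h1 := integral_diverg_le_of_anisoTV_le hT h (contDiff_fld hg hδ l)
      (hasCompactSupport_fld hs δ l) fun x => hl (fld_mem_zon hδ l x)
    rw [integral_mul_diverg_fld hg hs hδ] at h1
    have h2 : ∀ ξ, ∫ x, |der g ξ x| ≤ (∫ x, -(der g ξ x * sgn δ (der g ξ x))) +
        δ * volume.real (tsupport g) := by
      intro ξ
      have hm : MeasurableSet (tsupport g) := (isClosed_tsupport g).measurableSet
      have h3 : δ * volume.real (tsupport g) = ∫ x, (tsupport g).indicator (fun _ => δ) x := by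
        rw [integral_indicator_const _ hm, smul_eq_mul, mul_comm]
      have hi1 : Integrable fun x => -(der g ξ x * sgn δ (der g ξ x)) :=
        (((contDiff_der hg ξ).continuous.mul ((contDiff_sgn hδ).comp
          (contDiff_der hg ξ)).continuous).integrable_of_hasCompactSupport
            (hasCompactSupport_der hs ξ).mul_right).neg
      have hi2 : Integrable ((tsupport g).indicator fun _ => δ) :=
        (integrable_indicator_iff hm).2 (integrableOn_const hs.isCompact.measure_lt_top.ne)
      rw [h3, ← integral_add hi1 hi2]
      refine integral_mono (hcs ξ) (hi1.add hi2) fun x => ?_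
      by_cases hx : x ∈ tsupport g
      · have := le_sgn_mul hδ (der g ξ x)
        simp only [hx, indicator_of_mem]
        linarith
      · have : fderiv ℝ g x = 0 := by
          by_contra hc
          exact hx (support_fderiv_subset ℝ hc)
        simp [der, this, hx]
    clear hl
    have h4 : ∀ l' : List Plane, (l'.map fun ξ => ∫ x, |der g ξ x|).sum ≤
        (l'.map fun ξ => ∫ x, -(der g ξ x * sgn δ (der g ξ x))).sum +
          δ * (l'.length * volume.real (tsupport g)) := by
      intro l'
      induction l' with
      | nil => simp
      | cons ξ l' ih =>
        have := h2 ξ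
        simp only [List.map_cons, List.sum_cons, List.length_cons, Nat.cast_add, Nat.cast_one]
        linarith
    linarith [h4 l]
  have ht : Tendsto (fun δ : ℝ => T + δ * (l.length * volume.real (tsupport g))) (𝓝[>] 0)
      (𝓝 T) := by
    have : Continuous fun δ : ℝ => T + δ * (l.length * volume.real (tsupport g)) := by fun_prop
    have h := this.tendsto 0
    simp only [zero_mul, add_zero] at h
    exact h.mono_left nhdsWithin_le_nhds
  exact ge_of_tendsto ht (eventually_mem_nhdsWithin.mono fun δ hδ => key δ hδ)

end

end

lemma eventually_dl_lt {δ : ℝ} (hδ : 0 < δ) : ∀ᶠ q in atTop, dl q < δ :=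
  dl_tendsto.eventually (gt_mem_nhds hδ)

lemma add_seg_subset_thickening (A : Set Plane) {ξ : Plane} {r δ : ℝ} (hr : 0 ≤ r)
    (h : r * (‖ξ‖ + 1) < δ) : A + r • seg ξ ⊆ Metric.thickening δ A := by
  rintro _ ⟨a, ha, b, hb, rfl⟩
  obtain ⟨t, ht, rfl⟩ := (mem_smul_seg hr ξ b).1 hb
  refine Metric.mem_thickening_iff.2 ⟨a, ha, ?_⟩
  rw [dist_eq_norm, add_sub_cancel_left, norm_smul]
  refine lt_of_le_of_lt ?_ h
  exact mul_le_mul (abs_le.2 ht) (by linarith) (norm_nonneg _) hr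

/-- `Q` and `Q'` lie in complementary relatively clopen parts of `A`. -/
def Sep (A Q Q' : Set Plane) : Prop :=
  ∃ A₁ A₂, IsCompact A₁ ∧ IsCompact A₂ ∧ Disjoint A₁ A₂ ∧ A = A₁ ∪ A₂ ∧ Q ⊆ A₁ ∧ Q' ⊆ A₂

lemma Sep.inter {A Q Q' A₁ : Set Plane} (h : Sep A Q Q') (hA₁ : IsCompact A₁) (hA : A₁ ⊆ A)
    (hQ : Q ⊆ A₁) (hQ' : Q' ⊆ A₁) : Sep A₁ Q Q' := by
  obtain ⟨B₁, B₂, h1, h2, h3, rfl, h5, h6⟩ := h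
  refine ⟨A₁ ∩ B₁, A₁ ∩ B₂, hA₁.inter h1, hA₁.inter h2,
    h3.mono inter_subset_right inter_subset_right, ?_, subset_inter hQ h5, subset_inter hQ' h6⟩
  rw [← inter_union_distrib_left, inter_eq_left.2 hA]

lemma subset_or_subset_of_disjoint {Q A B : Set Plane} (hQ : IsConnected Q) (hA : IsCompact A)
    (hB : IsCompact B) (hd : Disjoint A B) (h : Q ⊆ A ∪ B) : Q ⊆ A ∨ Q ⊆ B :=
  isPreconnected_iff_subset_of_disjoint_closed.1 hQ.isPreconnected A B hA.isClosed hB.isClosed h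
    (by rw [hd.inter_eq, inter_empty])

open Classical in
lemma sum_wid_le (ξ : Plane) (S : Finset (Set Plane)) : ∀ A : Set Plane, IsCompact A →
    (∀ Q ∈ S, IsCompact Q ∧ IsConnected Q ∧ Q ⊆ A) →
    (∀ Q ∈ S, ∀ Q' ∈ S, Q ≠ Q' → Sep A Q Q') →
    ∀ᶠ q in atTop, volume A + ∑ Q ∈ S, ENNReal.ofReal (2 * dl q * wid ξ Q) ≤
      volume (A + dl q • seg ξ) := by
  induction S using Finset.strongInduction with
  | H S ih =>
  intro A hA hS hsep
  by_cases h0 : ∃ Q ∈ S, ∃ Q' ∈ S, Q ≠ Q'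
  · obtain ⟨Q, hQ, Q', hQ', hne⟩ := h0
    obtain ⟨A₁, A₂, hA₁, hA₂, hd, rfl, hQ₁, hQ₂⟩ := hsep Q hQ Q' hQ' hne
    set S₁ := S.filter fun P => P ⊆ A₁ with hS₁
    set S₂ := S.filter fun P => ¬ P ⊆ A₁ with hS₂
    have hor : ∀ P ∈ S, P ⊆ A₁ ∨ P ⊆ A₂ := fun P hP =>
      subset_or_subset_of_disjoint (hS P hP).2.1 hA₁ hA₂ hd (hS P hP).2.2
    have hlt₁ : S₁ ⊂ S := by
      refine Finset.filter_ssubset.2 ⟨Q', hQ', fun hc => ?_⟩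
      obtain ⟨z, hz⟩ := (hS Q' hQ').2.1.nonempty
      exact disjoint_left.1 hd (hc hz) (hQ₂ hz)
    have hlt₂ : S₂ ⊂ S := Finset.filter_ssubset.2 ⟨Q, hQ, fun hc => hc hQ₁⟩
    have hsub₂ : ∀ P ∈ S₂, P ∈ S ∧ P ⊆ A₂ := fun P hP => by
      rw [hS₂, Finset.mem_filter] at hP
      exact ⟨hP.1, (hor P hP.1).resolve_left hP.2⟩
    have hsub₁ : ∀ P ∈ S₁, P ∈ S ∧ P ⊆ A₁ := fun P hP => by
      rw [hS₁, Finset.mem_filter] at hP; exact hP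
    have e₁ := ih S₁ hlt₁ A₁ hA₁ (fun P hP => ⟨(hS P (hsub₁ P hP).1).1,
      (hS P (hsub₁ P hP).1).2.1, (hsub₁ P hP).2⟩) fun P hP P' hP' hn =>
        (hsep P (hsub₁ P hP).1 P' (hsub₁ P' hP').1 hn).inter hA₁ subset_union_left
          (hsub₁ P hP).2 (hsub₁ P' hP').2
    have e₂ := ih S₂ hlt₂ A₂ hA₂ (fun P hP => ⟨(hS P (hsub₂ P hP).1).1,
      (hS P (hsub₂ P hP).1).2.1, (hsub₂ P hP).2⟩) fun P hP P' hP' hn =>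
        (hsep P (hsub₂ P hP).1 P' (hsub₂ P' hP').1 hn).inter hA₂ subset_union_right
          (hsub₂ P hP).2 (hsub₂ P' hP').2
    obtain ⟨δ, hδ, hδd⟩ := hd.exists_thickenings hA₁ hA₂.isClosed
    have hn : 0 < ‖ξ‖ + 1 := by positivity
    filter_upwards [e₁, e₂, eventually_dl_lt (div_pos hδ hn)] with q h₁ h₂ h₃
    have h₃' : dl q * (‖ξ‖ + 1) < δ := (lt_div_iff₀ hn).1 h₃
    have hd2 : Disjoint (A₁ + dl q • seg ξ) (A₂ + dl q • seg ξ) :=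
      hδd.mono (add_seg_subset_thickening _ (dl_pos q).le h₃')
        (add_seg_subset_thickening _ (dl_pos q).le h₃')
    have hm : MeasurableSet (A₂ + dl q • seg ξ) :=
      (hA₂.add ((seg_compact ξ).smul _)).isClosed.measurableSet
    rw [union_add, measure_union hd2 hm, measure_union hd hA₂.isClosed.measurableSet,
      ← Finset.sum_filter_add_sum_filter_not S (fun P => P ⊆ A₁)]
    calc _ = (volume A₁ + ∑ Q ∈ S₁, ENNReal.ofReal (2 * dl q * wid ξ Q)) +
          (volume A₂ + ∑ Q ∈ S₂, ENNReal.ofReal (2 * dl q * wid ξ Q)) := by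
            rw [hS₁, hS₂]; ring
      _ ≤ _ := add_le_add h₁ h₂
  · push Not at h0
    rcases S.eq_empty_or_nonempty with rfl | ⟨Q, hQ⟩
    · refine Eventually.of_forall fun q => ?_
      simp only [Finset.sum_empty, add_zero]
      refine measure_mono fun x hx => ⟨x, hx, 0, ?_, add_zero x⟩
      exact (mem_smul_seg (dl_pos q).le ξ 0).2 ⟨0, ⟨by linarith [dl_pos q], (dl_pos q).le⟩, by simp⟩
    · have : S = {Q} := Finset.eq_singleton_iff_unique_mem.2 ⟨hQ, fun P hP => h0 P hP Q hQ⟩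
      subst this
      refine Eventually.of_forall fun q => ?_
      rw [Finset.sum_singleton]
      obtain ⟨h1, h2, h3⟩ := hS Q hQ
      exact volume_add_seg_ge hA h1 h2 h3 ξ (dl_pos q).le

/-- The difference quotient of the area of `A + r • seg ξ` at step `dl q`. -/
def exc (ξ : Plane) (A : Set Plane) (q : ℕ) : ℝ≥0∞ :=
  ENNReal.ofReal (dl q)⁻¹ * (volume (A + dl q • seg ξ) - volume A)

/-- The lower derivative of the area of `A + r • seg ξ`. -/
def slope (ξ : Plane) (A : Set Plane) : ℝ≥0∞ := liminf (exc ξ A) atTop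

lemma sum_wid_le_slope {ξ : Plane} {S : Finset (Set Plane)} {A : Set Plane} (hA : IsCompact A)
    (hS : ∀ Q ∈ S, IsCompact Q ∧ IsConnected Q ∧ Q ⊆ A)
    (hsep : ∀ Q ∈ S, ∀ Q' ∈ S, Q ≠ Q' → Sep A Q Q') :
    ∑ Q ∈ S, ENNReal.ofReal (2 * wid ξ Q) ≤ slope ξ A := by
  refine le_liminf_of_le (by isBoundedDefault) ?_
  filter_upwards [sum_wid_le ξ S A hA hS hsep] with q hq
  have h1 : ∑ Q ∈ S, ENNReal.ofReal (2 * dl q * wid ξ Q) ≤ volume (A + dl q • seg ξ) - volume A :=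
    ENNReal.le_sub_of_add_le_left hA.measure_lt_top.ne hq
  refine le_trans (le_of_eq ?_) (mul_le_mul_right h1 (ENNReal.ofReal (dl q)⁻¹))
  rw [Finset.mul_sum]
  refine Finset.sum_congr rfl fun Q _ => ?_
  have := dl_pos q
  rw [← ENNReal.ofReal_mul (by positivity)]
  congr 1; field_simp

lemma sep_of_connectedComponentIn {A : Set Plane} (hA : IsCompact A) {x y : Plane} (hx : x ∈ A)
    (hy : y ∈ A) (h : connectedComponentIn A x ≠ connectedComponentIn A y) :
    Sep A (connectedComponentIn A x) (connectedComponentIn A y) := by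
  have : CompactSpace A := isCompact_iff_compactSpace.1 hA
  have h1 : (⟨y, hy⟩ : A) ∉ connectedComponent (⟨x, hx⟩ : A) := by
    intro hc
    apply h
    rw [connectedComponentIn_eq_image hx, connectedComponentIn_eq_image hy, connectedComponent_eq hc]
  rw [connectedComponent_eq_iInter_isClopen, mem_iInter] at h1
  push Not at h1
  obtain ⟨⟨Z, hZ, hxZ⟩, hyZ⟩ := h1
  refine ⟨(↑) '' Z, (↑) '' Zᶜ, hZ.isClosed.isCompact.image continuous_subtype_val,
    hZ.compl.isClosed.isCompact.image continuous_subtype_val, ?_, ?_, ?_, ?_⟩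
  · exact (disjoint_image_iff Subtype.val_injective).2 disjoint_compl_right
  · rw [← image_union, union_compl_self, image_univ, Subtype.range_coe]
  · rw [connectedComponentIn_eq_image hx]
    exact image_mono (isPreconnected_connectedComponent.subset_isClopen hZ
      ⟨_, mem_connectedComponent, hxZ⟩)
  · rw [connectedComponentIn_eq_image hy]
    exact image_mono (isPreconnected_connectedComponent.subset_isClopen hZ.compl
      ⟨_, mem_connectedComponent, hyZ⟩)

lemma isCompact_connectedComponentIn {A : Set Plane} (hA : IsCompact A) (x : Plane) :
    IsCompact (connectedComponentIn A x) := by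
  by_cases hx : x ∈ A
  · have : CompactSpace A := isCompact_iff_compactSpace.1 hA
    rw [connectedComponentIn_eq_image hx]
    exact isClosed_connectedComponent.isCompact.image continuous_subtype_val
  · rw [connectedComponentIn_eq_empty hx]; exact isCompact_empty

open Classical in
/-- Finitely many components of a compact set exhaust, up to small measure, any open subset. -/
lemma exists_components {A U : Set Plane} (hA : IsCompact A) (hU : IsOpen U) (hUA : U ⊆ A)
    {ε : ℝ≥0∞} (hε : 0 < ε) : ∃ S : Finset (Set Plane),
      (∀ Q ∈ S, IsCompact Q ∧ IsConnected Q ∧ Q ⊆ A) ∧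
      (∀ Q ∈ S, ∀ Q' ∈ S, Q ≠ Q' → Sep A Q Q') ∧ volume (U \ ⋃ Q ∈ S, Q) ≤ ε := by
  set d := TopologicalSpace.denseSeq Plane with hd
  set c : ℕ → Set Plane := fun k => connectedComponentIn A (d k) with hc
  set S : ℕ → Finset (Set Plane) := fun N => ((Finset.range N).filter fun k => d k ∈ A).image c
    with hS
  have hmem : ∀ N, ∀ Q ∈ S N, ∃ k < N, d k ∈ A ∧ Q = c k := by
    intro N Q hQ
    simp only [hS, Finset.mem_image, Finset.mem_filter, Finset.mem_range] at hQ
    obtain ⟨k, ⟨h1, h2⟩, rfl⟩ := hQ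
    exact ⟨k, h1, h2, rfl⟩
  have h1 : ∀ N, ∀ Q ∈ S N, IsCompact Q ∧ IsConnected Q ∧ Q ⊆ A := by
    intro N Q hQ
    obtain ⟨k, -, hk, rfl⟩ := hmem N Q hQ
    exact ⟨isCompact_connectedComponentIn hA _, isConnected_connectedComponentIn_iff.2 hk,
      connectedComponentIn_subset _ _⟩
  have h2 : ∀ N, ∀ Q ∈ S N, ∀ Q' ∈ S N, Q ≠ Q' → Sep A Q Q' := by
    intro N Q hQ Q' hQ' hne
    obtain ⟨k, -, hk, rfl⟩ := hmem N Q hQ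
    obtain ⟨k', -, hk', rfl⟩ := hmem N Q' hQ'
    exact sep_of_connectedComponentIn hA hk hk' hne
  have hmono : Antitone fun N => U \ ⋃ Q ∈ S N, Q := by
    intro N N' hN
    refine sdiff_subset_sdiff_right (biUnion_subset_biUnion_left fun Q hQ => ?_)
    exact Finset.image_subset_image (Finset.filter_subset_filter _ (Finset.range_mono hN)) hQ
  have hempty : ⋂ N, (U \ ⋃ Q ∈ S N, Q) = ∅ := by
    refine eq_empty_of_forall_notMem fun x hx => ?_
    rw [mem_iInter] at hx
    have hxU := (hx 0).1
    obtain ⟨r, hr, hrU⟩ := Metric.isOpen_iff.1 hU x hxU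
    obtain ⟨k, hk⟩ : ∃ k, d k ∈ Metric.ball x r :=
      (TopologicalSpace.denseRange_denseSeq Plane).exists_mem_open Metric.isOpen_ball
        ⟨x, Metric.mem_ball_self hr⟩
    have hxk : x ∈ c k := (convex_ball x r).isPreconnected.subset_connectedComponentIn hk
      (hrU.trans hUA) (Metric.mem_ball_self hr)
    refine (hx (k + 1)).2 (mem_biUnion (Finset.mem_coe.2 ?_) hxk)
    exact Finset.mem_image_of_mem c (Finset.mem_filter.2
      ⟨Finset.mem_range.2 (Nat.lt_succ_self k), hUA (hrU hk)⟩)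
  have hlim := tendsto_measure_iInter_atTop (μ := volume) (s := fun N => U \ ⋃ Q ∈ S N, Q)
    (fun N => ((hU.measurableSet).diff
      (Finset.measurableSet_biUnion _ fun Q hQ => (h1 N Q hQ).1.isClosed.measurableSet)).nullMeasurableSet)
    hmono ⟨0, ((measure_mono (sdiff_subset.trans hUA)).trans_lt hA.measure_lt_top).ne⟩
  rw [hempty, measure_empty] at hlim
  obtain ⟨N, hN⟩ := (hlim.eventually (gt_mem_nhds hε)).exists
  exact ⟨S N, h1 N, h2 N, hN.le⟩

section

/-- The superlevel set of `g` at height `t`. -/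
def lev (g : Plane → ℝ) (t : ℝ) : Set Plane := {x | t ≤ g x}

lemma lev_anti (g : Plane → ℝ) : Antitone (lev g) := fun _ _ h _ hx => le_trans h hx

section
variable {g : Plane → ℝ}

lemma lev_subset_tsupport {t : ℝ} (ht : 0 < t) : lev g t ⊆ tsupport g := fun x hx =>
  subset_tsupport g (by
    have : t ≤ g x := hx
    simp only [Function.mem_support]; linarith)

lemma isCompact_lev (hg : Continuous g) (hs : HasCompactSupport g) {t : ℝ} (ht : 0 < t) :
    IsCompact (lev g t) :=
  hs.isCompact.of_isClosed_subset (isClosed_le continuous_const hg) (lev_subset_tsupport ht)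

lemma measurable_exc (ξ : Plane) (q : ℕ) : Measurable fun t => exc ξ (lev g t) q := by
  unfold exc
  refine Measurable.const_mul (Measurable.sub ?_ ?_) _
  · exact Antitone.measurable fun s t h => measure_mono (add_subset_add_right (lev_anti g h))
  · exact Antitone.measurable fun s t h => measure_mono (lev_anti g h)

lemma measurable_slope (ξ : Plane) : Measurable fun t => slope ξ (lev g t) :=
  Measurable.liminf fun q => measurable_exc ξ q

lemma sub_le_of_der_le (hg : ContDiff ℝ 2 g) {ξ x : Plane} {r M s : ℝ} (hs : |s| ≤ r)
    (h : ∀ s, |s| ≤ r → |der g ξ (x + s • ξ)| ≤ M) : g (x + s • ξ) ≤ g x + r * M := by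
  have hr : 0 ≤ r := (abs_nonneg s).trans hs
  have hd : ∀ s : ℝ, HasDerivAt (fun s : ℝ => g (x + s • ξ)) (der g ξ (x + s • ξ)) s := by
    intro s
    have h1 : HasDerivAt (fun s : ℝ => x + s • ξ) ξ s := by
      simpa using ((hasDerivAt_id s).smul_const ξ).const_add x
    exact (hg.differentiable two_ne_zero (x + s • ξ)).hasFDerivAt.comp_hasDerivAt s h1
  have h2 := Convex.norm_image_sub_le_of_norm_deriv_le (𝕜 := ℝ) (f := fun s : ℝ => g (x + s • ξ))
    (s := Icc (-r) r) (x := 0) (y := s) (C := M) (fun s _ => (hd s).differentiableAt)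
    (fun s hs => by rw [(hd s).deriv]; exact h s (abs_le.2 hs)) (convex_Icc _ _)
    ⟨by linarith, hr⟩ (abs_le.1 hs)
  have hM : 0 ≤ M := (abs_nonneg _).trans (h 0 (by simpa using hr))
  simp only [zero_smul, add_zero, sub_zero, Real.norm_eq_abs] at h2
  have h3 := (le_abs_self _).trans h2
  nlinarith

lemma lintegral_exc_le (hg : ContDiff ℝ 2 g) (hs : HasCompactSupport g) (h0 : ∀ x, 0 ≤ g x)
    (ξ : Plane) {κ : ℝ} (hκ : 0 < κ) : ∀ᶠ q in atTop,
      ∫⁻ t in Ioi 0, exc ξ (lev g t) q ≤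
        ENNReal.ofReal ((∫ x, |der g ξ x|) + κ * volume.real (tsupport g + seg ξ)) := by
  have hc := hg.continuous
  have hdc : Continuous (der g ξ) := (contDiff_der hg ξ).continuous
  set B := tsupport g + seg ξ with hB
  have hBc : IsCompact B := hs.isCompact.add (seg_compact ξ)
  have hBm : MeasurableSet B := hBc.isClosed.measurableSet
  have huc := (hasCompactSupport_der hs ξ).uniformContinuous_of_continuous hdc
  obtain ⟨δ, hδ, hδ'⟩ := Metric.uniformContinuous_iff.1 huc κ hκ
  have hn : 0 < ‖ξ‖ + 1 := by positivity
  filter_upwards [eventually_dl_lt (div_pos hδ hn)] with q hq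
  have hq' : dl q * (‖ξ‖ + 1) < δ := (lt_div_iff₀ hn).1 hq
  have hq0 := dl_pos q
  set h : Plane → ℝ := fun x => g x + dl q * (|der g ξ x| + B.indicator (fun _ => κ) x) with hh
  have hi1 : Integrable g := hc.integrable_of_hasCompactSupport hs
  have hi2 : Integrable fun x => |der g ξ x| :=
    (hdc.integrable_of_hasCompactSupport (hasCompactSupport_der hs ξ)).abs
  have hi3 : Integrable (B.indicator fun _ => κ) :=
    (integrable_indicator_iff hBm).2 (integrableOn_const hBc.measure_lt_top.ne)
  have hih : Integrable h := hi1.add ((hi2.add hi3).const_mul _)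
  have hind : ∀ x, 0 ≤ B.indicator (fun _ => κ) x := fun x => indicator_nonneg (fun _ _ => hκ.le) x
  have hh0 : ∀ x, 0 ≤ h x := fun x => add_nonneg (h0 x)
    (mul_nonneg hq0.le (add_nonneg (abs_nonneg _) (hind x)))
  have hint : ∫ x, h x = (∫ x, g x) + dl q * ((∫ x, |der g ξ x|) + κ * volume.real B) := by
    have hi23 : Integrable fun x => |der g ξ x| + B.indicator (fun _ => κ) x := hi2.add hi3
    simp only [hh]
    rw [integral_add hi1 (hi23.const_mul _), integral_const_mul,
      integral_add hi2 hi3, integral_indicator_const _ hBm, smul_eq_mul, mul_comm κ]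
  have hsub : ∀ t > 0, lev g t + dl q • seg ξ ⊆ lev h t := by
    rintro t ht _ ⟨y, hy, z, hz, rfl⟩
    have hzs : z ∈ seg ξ := by
      obtain ⟨s, hs, rfl⟩ := (mem_smul_seg hq0.le ξ z).1 hz
      have := dl_lt q
      exact ⟨s, ⟨by linarith [hs.1], by linarith [hs.2]⟩, rfl⟩
    have hxB : y + z ∈ B := add_mem_add (lev_subset_tsupport ht hy) hzs
    obtain ⟨s, hs, rfl⟩ := (mem_smul_seg hq0.le ξ z).1 hz
    have h1 := sub_le_of_der_le hg (ξ := ξ) (x := y + s • ξ) (r := dl q)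
      (M := |der g ξ (y + s • ξ)| + κ) (s := -s) (by rw [abs_neg]; exact abs_le.2 hs) (by
        intro s' hs'
        have h2 : dist (y + s • ξ + s' • ξ) (y + s • ξ) < δ := by
          rw [dist_eq_norm, add_sub_cancel_left, norm_smul, Real.norm_eq_abs]
          refine lt_of_le_of_lt (mul_le_mul hs' (by linarith) (norm_nonneg _) hq0.le) hq'
        have h3 := hδ' h2
        rw [Real.dist_eq] at h3
        have h4 := abs_sub_abs_le_abs_sub (der g ξ (y + s • ξ + s' • ξ)) (der g ξ (y + s • ξ))
        linarith)
    have h5 : y + s • ξ + (-s) • ξ = y := by rw [neg_smul]; abel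
    rw [h5] at h1
    have hty : t ≤ g y := hy
    change t ≤ h (y + s • ξ)
    simp only [hh, indicator_of_mem hxB]
    linarith
  have hV : ∫⁻ t in Ioi 0, volume (lev g t) = ENNReal.ofReal (∫ x, g x) := by
    rw [ofReal_integral_eq_lintegral_ofReal hi1 (Eventually.of_forall h0)]
    exact (lintegral_eq_lintegral_meas_le volume (Eventually.of_forall h0) hc.aemeasurable).symm
  have hV' : ∫⁻ t in Ioi 0, volume (lev g t + dl q • seg ξ) ≤ ENNReal.ofReal (∫ x, h x) := by
    rw [ofReal_integral_eq_lintegral_ofReal hih (Eventually.of_forall hh0),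
      lintegral_eq_lintegral_meas_le volume (Eventually.of_forall hh0) hih.aemeasurable]
    exact setLIntegral_mono' measurableSet_Ioi fun t ht => measure_mono (hsub t ht)
  unfold exc
  have hm1 : Measurable fun t => volume (lev g t + dl q • seg ξ) :=
    Antitone.measurable fun s t h => measure_mono (add_subset_add_right (lev_anti g h))
  have hm2 : Measurable fun t => volume (lev g t) :=
    Antitone.measurable fun s t h => measure_mono (lev_anti g h)
  have hm3 : Measurable fun t => volume (lev g t + dl q • seg ξ) - volume (lev g t) := by
    fun_prop
  rw [lintegral_const_mul _ hm3, lintegral_sub' hm2.aemeasurable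
    (by rw [hV]; exact ENNReal.ofReal_ne_top), hV]
  · have hg0 : 0 ≤ ∫ x, g x := integral_nonneg h0
    calc _ ≤ ENNReal.ofReal (dl q)⁻¹ * (ENNReal.ofReal (∫ x, h x) - ENNReal.ofReal (∫ x, g x)) := by
          gcongr
      _ = _ := by
          rw [← ENNReal.ofReal_sub _ hg0, ← ENNReal.ofReal_mul (by positivity), hint]
          congr 1; field_simp; ring
  · refine Eventually.of_forall fun t => measure_mono fun x hx => ⟨x, hx, 0, ?_, add_zero x⟩
    exact (mem_smul_seg hq0.le ξ 0).2 ⟨0, ⟨by linarith, hq0.le⟩, by simp⟩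

lemma lintegral_slope_le (hg : ContDiff ℝ 2 g) (hs : HasCompactSupport g) (h0 : ∀ x, 0 ≤ g x)
    (ξ : Plane) : ∫⁻ t in Ioi 0, slope ξ (lev g t) ≤ ENNReal.ofReal (∫ x, |der g ξ x|) := by
  have h1 : ∫⁻ t in Ioi 0, slope ξ (lev g t) ≤
      liminf (fun q => ∫⁻ t in Ioi 0, exc ξ (lev g t) q) atTop :=
    lintegral_liminf_le fun q => measurable_exc ξ q
  set B := volume.real (tsupport g + seg ξ)
  have h2 : ∀ κ > 0, ∫⁻ t in Ioi 0, slope ξ (lev g t) ≤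
      ENNReal.ofReal ((∫ x, |der g ξ x|) + κ * B) := fun κ hκ =>
    h1.trans (liminf_le_of_frequently_le' (lintegral_exc_le hg hs h0 ξ hκ).frequently)
  have ht : Tendsto (fun κ : ℝ => ENNReal.ofReal ((∫ x, |der g ξ x|) + κ * B)) (𝓝[>] 0)
      (𝓝 (ENNReal.ofReal (∫ x, |der g ξ x|))) := by
    have : Continuous fun κ : ℝ => (∫ x, |der g ξ x|) + κ * B := by fun_prop
    have h := this.tendsto 0
    simp only [zero_mul, add_zero] at h
    exact ENNReal.tendsto_ofReal (h.mono_left nhdsWithin_le_nhds)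
  exact ge_of_tendsto ht (eventually_mem_nhdsWithin.mono fun δ hδ => h2 δ hδ)

end

/-- The sum of the slopes over the generators of a zonotope. -/
def tot (l : List Plane) (A : Set Plane) : ℝ≥0∞ := (l.map fun ξ => slope ξ A).sum

lemma measurable_tot (l : List Plane) (g : Plane → ℝ) : Measurable fun t => tot l (lev g t) := by
  induction l with
  | nil => simp [tot]
  | cons ξ l ih =>
    simp only [tot, List.map_cons, List.sum_cons] at ih ⊢
    exact (measurable_slope ξ).add ih

lemma lintegral_tot_le {φ g : Plane → ℝ} (hg : ContDiff ℝ 2 g) (hs : HasCompactSupport g)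
    (h0 : ∀ x, 0 ≤ g x) {l : List Plane} (hl : zon l ⊆ ball φ) {T : ℝ} (hT : 0 ≤ T)
    (h : anisoTV φ g ≤ ENNReal.ofReal T) :
    ∫⁻ t in Ioi 0, tot l (lev g t) ≤ ENNReal.ofReal T := by
  refine le_trans ?_ (ENNReal.ofReal_le_ofReal (sum_integral_der_le hg hs hl hT h))
  clear hl
  induction l with
  | nil => simp [tot]
  | cons ξ l ih =>
    have : ∀ t, tot (ξ :: l) (lev g t) = slope ξ (lev g t) + tot l (lev g t) := fun t => by
      simp [tot]
    simp only [this, List.map_cons, List.sum_cons]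
    rw [lintegral_add_left (measurable_slope ξ), ENNReal.ofReal_add
      (integral_nonneg fun x => abs_nonneg _)
      (List.sum_nonneg (by
        intro x hx
        obtain ⟨ζ, -, rfl⟩ := List.mem_map.1 hx
        exact integral_nonneg fun x => abs_nonneg _))]
    exact add_le_add (lintegral_slope_le hg hs h0 ξ) ih

/-- The closed convex hull. -/
def hull (Q : Set Plane) : Set Plane := closure (convexHull ℝ Q)

lemma subset_hull (Q : Set Plane) : Q ⊆ hull Q := (subset_convexHull ℝ Q).trans subset_closure

lemma hull_mono {Q A : Set Plane} (h : Q ⊆ A) : hull Q ⊆ hull A :=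
  closure_mono (convexHull_mono h)

lemma hull_subset {Q A : Set Plane} (h : Q ⊆ A) (hc : Convex ℝ A) (hA : IsClosed A) : hull Q ⊆ A :=
  closure_minimal (convexHull_min h hc) hA

lemma CC.hull {Q : Set Plane} (hQ : IsCompact Q) (hne : Q.Nonempty) : CC (hull Q) :=
  ⟨Metric.isCompact_of_isClosed_isBounded isClosed_closure
    (isBounded_convexHull.2 hQ.isBounded).closure, (convex_convexHull ℝ Q).closure,
    hne.mono (subset_hull Q)⟩

lemma wid_hull_le {Q : Set Plane} (hQ : IsCompact Q) (hne : Q.Nonempty) (ξ : Plane) :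
    wid ξ (hull Q) ≤ wid ξ Q := by
  have hc : IsCompact (cross ξ '' Q) := hQ.image (continuous_cross ξ)
  have h1 : hull Q ⊆ cross ξ ⁻¹' Icc (sInf (cross ξ '' Q)) (sSup (cross ξ '' Q)) := by
    refine hull_subset (fun x hx => ?_) ((convex_Icc _ _).linear_preimage (cross ξ))
      (isClosed_Icc.preimage (continuous_cross ξ))
    exact ⟨csInf_le hc.bddBelow ⟨x, hx, rfl⟩, le_csSup hc.bddAbove ⟨x, hx, rfl⟩⟩
  have hne' : (cross ξ '' hull Q).Nonempty := (hne.mono (subset_hull Q)).image _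
  have h2 : sSup (cross ξ '' hull Q) ≤ sSup (cross ξ '' Q) :=
    csSup_le hne' (by rintro _ ⟨x, hx, rfl⟩; exact (h1 hx).2)
  have h3 : sInf (cross ξ '' Q) ≤ sInf (cross ξ '' hull Q) :=
    le_csInf hne' (by rintro _ ⟨x, hx, rfl⟩; exact (h1 hx).1)
  unfold wid; linarith

lemma per_le_perZ {φ : Plane → ℝ} (hφ : IsNorm φ) {l : List Plane} {δ : ℝ} (hδ1 : δ < 1)
    (hl : (1 - δ) • ball φ ⊆ zon l) {C : Set Plane} (hC : CC C) :
    (1 - δ) * per φ C ≤ perZ l C := by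
  have key : ∀ r > 0, (1 - δ) * per φ C ≤ perZ l C + r * (kap l - (1 - δ) ^ 2 * area (ball φ)) := by
    intro r hr
    have h1 : area (C + (r * (1 - δ)) • ball φ) ≤ area (C + r • zon l) := by
      refine area_mono (hC.add ((CC.zon l).smul r)).compact (add_subset_add_left ?_)
      rw [mul_smul]
      exact smul_set_mono hl
    rw [steiner hφ hC (mul_nonneg hr.le (by linarith)), area_add_zon l hr.le hC] at h1
    have : r * ((1 - δ) * per φ C) ≤ r * (perZ l C + r * (kap l - (1 - δ) ^ 2 * area (ball φ))) := by
      nlinarith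
    exact le_of_mul_le_mul_left this hr
  have ht : Tendsto (fun r : ℝ => perZ l C + r * (kap l - (1 - δ) ^ 2 * area (ball φ))) (𝓝[>] 0)
      (𝓝 (perZ l C)) := by
    have : Continuous fun r : ℝ => perZ l C + r * (kap l - (1 - δ) ^ 2 * area (ball φ)) := by
      fun_prop
    have h := this.tendsto 0
    simp only [zero_mul, add_zero] at h
    exact h.mono_left nhdsWithin_le_nhds
  exact ge_of_tendsto ht (eventually_mem_nhdsWithin.mono fun δ hδ => key δ hδ)

lemma sum_perZ_le_tot (l : List Plane) {S : Finset (Set Plane)} {A : Set Plane} (hA : IsCompact A)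
    (hS : ∀ Q ∈ S, IsCompact Q ∧ IsConnected Q ∧ Q ⊆ A)
    (hsep : ∀ Q ∈ S, ∀ Q' ∈ S, Q ≠ Q' → Sep A Q Q') :
    ∑ Q ∈ S, ENNReal.ofReal (perZ l (hull Q)) ≤ tot l A := by
  induction l with
  | nil => simp [perZ]
  | cons ξ l ih =>
    have h1 := sum_wid_le_slope (ξ := ξ) hA hS hsep
    have h2 : tot (ξ :: l) A = slope ξ A + tot l A := by simp [tot]
    rw [h2]
    refine le_trans ?_ (add_le_add h1 ih)
    rw [← Finset.sum_add_distrib]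
    refine Finset.sum_le_sum fun Q hQ => ?_
    rw [perZ, List.map_cons, List.sum_cons]
    refine ENNReal.ofReal_add_le.trans (add_le_add (ENNReal.ofReal_le_ofReal ?_) le_rfl)
    linarith [wid_hull_le (hS Q hQ).1 (hS Q hQ).2.1.nonempty ξ]

/-- Up to small measure, a superlevel set is covered by finitely many convex sets whose total
perimeter is controlled. -/
lemma exists_hulls {φ g : Plane → ℝ} (hφ : IsNorm φ) (hg : Continuous g) (hs : HasCompactSupport g)
    {l : List Plane} {δ : ℝ} (hδ1 : δ < 1) (hl : (1 - δ) • ball φ ⊆ zon l) {t : ℝ} (ht : 0 < t)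
    (hnull : volume {x | g x = t} = 0) {ε : ℝ≥0∞} (hε : 0 < ε) :
    ∃ (N : ℕ) (f : Fin N → Set Plane), (∀ i, CC (f i)) ∧ (∀ i, f i ⊆ hull (lev g t)) ∧
      volume (lev g t \ ⋃ i, f i) ≤ ε ∧
      ENNReal.ofReal ((1 - δ) * ∑ i, per φ (f i)) ≤ tot l (lev g t) := by
  have hA := isCompact_lev hg hs ht
  obtain ⟨S, h1, h2, h3⟩ := exists_components hA (U := {x | t < g x})
    (isOpen_lt continuous_const hg) (fun x hx => le_of_lt (show t < g x from hx)) hε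
  refine ⟨S.card, fun i => hull (S.equivFin.symm i), fun i => ?_, fun i => ?_, ?_, ?_⟩
  · have := h1 _ (S.equivFin.symm i).2
    exact CC.hull this.1 this.2.1.nonempty
  · exact hull_mono (h1 _ (S.equivFin.symm i).2).2.2
  · have h4 : lev g t \ ⋃ i, hull (S.equivFin.symm i) ⊆
        {x | g x = t} ∪ ({x | t < g x} \ ⋃ Q ∈ S, Q) := by
      rintro x ⟨hx, hx'⟩
      rcases eq_or_lt_of_le (show t ≤ g x from hx) with h | h
      · exact Or.inl h.symm
      · refine Or.inr ⟨h, fun hc => hx' ?_⟩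
        obtain ⟨Q, hQ, hxQ⟩ := mem_iUnion₂.1 hc
        exact mem_iUnion.2 ⟨S.equivFin ⟨Q, hQ⟩, subset_hull _ (by simpa using hxQ)⟩
    calc _ ≤ volume {x | g x = t} + volume ({x | t < g x} \ ⋃ Q ∈ S, Q) :=
          (measure_mono h4).trans (measure_union_le _ _)
      _ ≤ ε := by rw [hnull, zero_add]; exact h3
  · refine le_trans ?_ (sum_perZ_le_tot l hA h1 h2)
    rw [Equiv.sum_comp S.equivFin.symm fun Q : S => per φ (hull (Q : Set Plane)),
      Finset.sum_coe_sort S fun Q => per φ (hull Q), Finset.mul_sum,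
      ENNReal.ofReal_sum_of_nonneg]
    · refine Finset.sum_le_sum fun Q hQ => ENNReal.ofReal_le_ofReal ?_
      exact per_le_perZ hφ hδ1 hl (CC.hull (h1 Q hQ).1 (h1 Q hQ).2.1.nonempty)
    · intro Q hQ
      exact mul_nonneg (by linarith) (per_nonneg hφ (CC.hull (h1 Q hQ).1 (h1 Q hQ).2.1.nonempty))

end

section

variable {φ : Plane → ℝ}

lemma four_mul_area_le (hφ : IsNorm φ) {C : Set Plane} (hC : CC C) :
    4 * area (ball φ) * area C ≤ per φ C ^ 2 := by
  obtain ⟨ρ, x, h0, -, h⟩ := isoperimetric hφ hC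
  have hW := area_ball_pos hφ
  nlinarith [sq_nonneg (per φ C - 2 * ρ * area (ball φ))]

/-- A finite family of compact convex sets is rearranged into a sequence by decreasing area. -/
lemma exists_antitone_seq {B : Set Plane} {b : Plane} (hb : b ∈ B) {N : ℕ} {f : Fin N → Set Plane}
    (hf : ∀ i, CC (f i)) (hfB : ∀ i, f i ⊆ B) (hφ : IsNorm φ) :
    ∃ D : ℕ → Set Plane, (∀ i, CC (D i)) ∧ (∀ i, D i ⊆ B) ∧ (⋃ i, f i) ⊆ ⋃ i, D i ∧
      (∀ s : Finset ℕ, ∑ i ∈ s, per φ (D i) ≤ ∑ i, per φ (f i)) ∧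
      Antitone fun i => area (D i) := by
  set σ := Tuple.sort fun i => -area (f i)
  have hσ : Monotone ((fun i => -area (f i)) ∘ σ) := Tuple.monotone_sort _
  refine ⟨fun i => if h : i < N then f (σ ⟨i, h⟩) else {b}, fun i => ?_, fun i => ?_, ?_,
    fun s => ?_, fun i k hik => ?_⟩
  · dsimp only; split_ifs with h
    exacts [hf _, CC.singleton b]
  · dsimp only; split_ifs with h
    exacts [hfB _, singleton_subset_iff.2 hb]
  · refine iUnion_subset fun i => ?_
    refine (subset_iUnion (fun i => if h : i < N then f (σ ⟨i, h⟩) else {b})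
      (σ.symm i : ℕ)).trans' ?_
    simp
  · have hnn : ∀ i, 0 ≤ per φ (if h : i < N then f (σ ⟨i, h⟩) else {b}) := fun i => by
      split_ifs with h
      exacts [per_nonneg hφ (hf _), (per_singleton b).ge]
    calc _ ≤ ∑ i ∈ s ∪ Finset.range N, per φ (if h : i < N then f (σ ⟨i, h⟩) else {b}) :=
          Finset.sum_le_sum_of_subset_of_nonneg Finset.subset_union_left fun i _ _ => hnn i
      _ = ∑ i ∈ Finset.range N, per φ (if h : i < N then f (σ ⟨i, h⟩) else {b}) := by
          refine (Finset.sum_subset Finset.subset_union_right fun i _ hi => ?_).symm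
          rw [dif_neg (by simpa using hi), per_singleton]
      _ = ∑ i : Fin N, per φ (f (σ i)) := by
          rw [Finset.sum_range]
          exact Finset.sum_congr rfl fun i _ => by simp
      _ ≤ _ := (Equiv.sum_comp σ fun i => per φ (f i)).le
  · dsimp only
    split_ifs with h h' h'
    · have := hσ (show (⟨i, h'⟩ : Fin N) ≤ ⟨k, h⟩ from hik)
      simpa using this
    · omega
    · rw [area_singleton]; exact measureReal_nonneg
    · exact le_rfl

lemma area_seq_le (hφ : IsNorm φ) {D : ℕ → Set Plane} (hD : ∀ i, CC (D i))
    (ha : Antitone fun i => area (D i)) {T : ℝ} (hT : ∀ s : Finset ℕ, ∑ i ∈ s, per φ (D i) ≤ T)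
    (i : ℕ) : area (D i) ≤ T ^ 2 / (4 * area (ball φ)) * (1 / ((i : ℝ) + 1) ^ 2) := by
  have hW := area_ball_pos hφ
  have h0 : ∀ i, 0 ≤ area (D i) := fun i => measureReal_nonneg
  have h1 : ∀ k ∈ Finset.range (i + 1), √(4 * area (ball φ) * area (D i)) ≤ per φ (D k) := by
    intro k hk
    refine Real.sqrt_le_iff.2 ⟨per_nonneg hφ (hD k), ?_⟩
    refine le_trans ?_ (four_mul_area_le hφ (hD k))
    have : area (D i) ≤ area (D k) := ha (by simp at hk; omega)
    gcongr
  have h2 := (Finset.card_nsmul_le_sum _ _ _ h1).trans (hT _)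
  simp only [Finset.card_range, nsmul_eq_mul, Nat.cast_add, Nat.cast_one] at h2
  have h3 : ((i + 1 : ℝ) * √(4 * area (ball φ) * area (D i))) ^ 2 ≤ T ^ 2 := by gcongr
  rw [mul_pow, Real.sq_sqrt (by have := h0 i; positivity)] at h3
  rw [div_mul_div_comm, le_div_iff₀ (by positivity)]
  linarith

open TopologicalSpace in
/-- Blaschke selection for sequences of sequences of compact convex sets. -/
lemma exists_limit_seq {B : Set Plane} (hB : IsCompact B) {D : ℕ → ℕ → Set Plane}
    (hD : ∀ n i, CC (D n i)) (hDB : ∀ n i, D n i ⊆ B) :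
    ∃ (A : ℕ → Set Plane) (k : ℕ → ℕ), StrictMono k ∧ (∀ i, CC (A i)) ∧
      ∀ i, ∀ ε > 0, ∀ᶠ n in atTop, D (k n) i ⊆ Metric.cthickening ε (A i) ∧
        A i ⊆ Metric.cthickening ε (D (k n) i) := by
  set F : ℕ → ℕ → NonemptyCompacts Plane := fun n i =>
    ⟨⟨D n i, (hD n i).compact⟩, (hD n i).nonempty⟩
  have hc : IsCompact (Set.pi univ fun _ : ℕ => {L : NonemptyCompacts Plane | (L : Set Plane) ⊆ B}) :=
    isCompact_univ_pi fun _ => NonemptyCompacts.isCompact_subsets_of_isCompact hB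
  obtain ⟨A, -, k, hk, hA⟩ := hc.tendsto_subseq (x := F) fun n i _ => hDB n i
  rw [tendsto_pi_nhds] at hA
  have key : ∀ i, ∀ ε > 0, ∀ᶠ n in atTop, D (k n) i ⊆ Metric.cthickening ε (A i : Set Plane) ∧
        (A i : Set Plane) ⊆ Metric.cthickening ε (D (k n) i) := by
    intro i ε hε
    filter_upwards [Metric.tendsto_nhds.1 (hA i) ε hε] with n hn
    rw [Metric.NonemptyCompacts.dist_eq] at hn
    change Metric.hausdorffDist (D (k n) i) (A i : Set Plane) < ε at hn
    have hfin : Metric.hausdorffEDist (D (k n) i) (A i : Set Plane) ≠ ⊤ :=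
      Metric.hausdorffEDist_ne_top_of_nonempty_of_bounded (hD _ _).nonempty (A i).nonempty
        (hD _ _).compact.isBounded (A i).isCompact.isBounded
    have hle : Metric.hausdorffEDist (D (k n) i) (A i : Set Plane) ≤ ENNReal.ofReal ε := by
      rw [← ENNReal.ofReal_toReal hfin]
      exact ENNReal.ofReal_le_ofReal hn.le
    refine ⟨fun x hx => (Metric.infEDist_le_hausdorffEDist_of_mem hx).trans hle, fun x hx => ?_⟩
    rw [Metric.hausdorffEDist_comm] at hle
    exact (Metric.infEDist_le_hausdorffEDist_of_mem hx).trans hle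
  refine ⟨fun i => A i, k, hk, fun i => ⟨(A i).isCompact, ?_, (A i).nonempty⟩, key⟩
  intro x hx y hy a b ha hb hab
  change _ ∈ (A i : Set Plane)
  rw [← (A i).isCompact.isClosed.closure_eq, Metric.closure_eq_iInter_cthickening]
  refine mem_iInter₂.2 fun ε hε => ?_
  obtain ⟨n, h1, h2⟩ := (key i (ε / 2) (by positivity)).exists
  have h3 := (hD (k n) i).convex.cthickening (ε / 2) (h2 hx) (h2 hy) ha hb hab
  have h4 := Metric.cthickening_subset_of_subset (ε / 2) h1 h3
  have h5 := Metric.cthickening_cthickening_subset (by positivity) (by positivity) _ h4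
  rwa [add_halves] at h5

lemma cthickening_subset (hφ : IsNorm φ) : ∃ M > 0, ∀ {A : Set Plane}, IsCompact A → ∀ ε > 0,
    Metric.cthickening ε A ⊆ A + (M * ε) • ball φ := by
  obtain ⟨M, hM, h⟩ := hφ.le_mul
  refine ⟨M, hM, fun {A} hA ε hε => ?_⟩
  rw [hA.cthickening_eq_biUnion_closedBall hε.le]
  refine iUnion₂_subset fun y hy x hx => ⟨y, hy, x - y, ?_, add_sub_cancel _ _⟩
  rw [mem_smul_ball hφ (by positivity)]
  refine (h _).trans ?_
  rw [mem_closedBall_iff_norm] at hx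
  gcongr

lemma volume_eventually_mem_le {α : Type*} [MeasurableSpace α] {μ : Measure α} {S : ℕ → Set α}
    {c : ℝ≥0∞} (h : ∀ n, μ (S n) ≤ c) : μ {x | ∀ᶠ n in atTop, x ∈ S n} ≤ c := by
  have h1 : {x | ∀ᶠ n in atTop, x ∈ S n} = ⋃ n, ⋂ m, S (n + m) := by
    ext x
    simp only [eventually_atTop, mem_ofPred_eq, mem_iUnion, mem_iInter]
    exact exists_congr fun n => ⟨fun h m => h _ (by omega), fun h m hm => by
      have := h (m - n); rwa [Nat.add_sub_cancel' hm] at this⟩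
  rw [h1, Monotone.measure_iUnion]
  · exact iSup_le fun n => (measure_mono (iInter_subset _ 0)).trans (h _)
  · intro n m hnm x hx
    simp only [mem_iInter] at hx ⊢
    intro k
    have := hx (m - n + k)
    rwa [← add_assoc, Nat.add_sub_cancel' hnm] at this

/-- Limit of finite families of compact convex sets with bounded total perimeter. -/
lemma exists_limit_family (hφ : IsNorm φ) {K : Set Plane} (hK : CC K) {N : ℕ → ℕ}
    {f : ∀ n, Fin (N n) → Set Plane} (hf : ∀ n i, CC (f n i)) {δ : ℕ → ℝ} (hδ0 : ∀ n, 0 ≤ δ n)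
    (hδ1 : ∀ n, δ n ≤ 1) (hδ : Tendsto δ atTop (𝓝 0))
    (hfK : ∀ n i, f n i ⊆ Metric.cthickening (δ n) K) {P : ℕ → ℝ} {p : ℝ}
    (hP : Tendsto P atTop (𝓝 p)) (hfP : ∀ n, ∑ i, per φ (f n i) ≤ P n) {E : Set Plane}
    (hE : ∀ᵐ x, x ∈ E → ∀ᶠ n in atTop, x ∈ ⋃ i, f n i) :
    ∃ A : ℕ → Set Plane, (∀ i, CC (A i)) ∧ (∀ i, A i ⊆ K) ∧
      (∀ s : Finset ℕ, ∑ i ∈ s, per φ (A i) ≤ p) ∧ ∀ᵐ x, x ∈ E → x ∈ ⋃ i, A i := by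
  obtain ⟨b, hb⟩ := hK.nonempty
  have hb' : ∀ n, b ∈ Metric.cthickening (δ n) K := fun n =>
    Metric.self_subset_cthickening _ hb
  choose D hD hDK hfD hDP hanti using fun n => exists_antitone_seq (hb' n) (hf n) (hfK n) hφ
  have hDP' : ∀ n (s : Finset ℕ), ∑ i ∈ s, per φ (D n i) ≤ P n := fun n s =>
    (hDP n s).trans (hfP n)
  have hB : IsCompact (Metric.cthickening 1 K) := hK.compact.cthickening
  obtain ⟨A, k, hk, hA, hconv⟩ := exists_limit_seq hB hD fun n i =>
    (hDK n i).trans (Metric.cthickening_mono (hδ1 n) K)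
  obtain ⟨T, hT⟩ := hP.bddAbove_range
  have hT' : ∀ n, P n ≤ T := fun n => hT ⟨n, rfl⟩
  obtain ⟨M, hM, hthick⟩ := cthickening_subset hφ
  have hkt := hk.tendsto_atTop
  have hclosed : ∀ {C : Set Plane} {x : Plane}, IsCompact C →
      (∀ ε > 0, x ∈ Metric.cthickening ε C) → x ∈ C := fun {C x} hC h => by
    rw [← hC.isClosed.closure_eq, Metric.closure_eq_iInter_cthickening]
    exact mem_iInter₂.2 h
  refine ⟨A, hA, fun i x hx => ?_, fun s => ?_, ?_⟩
  · refine hclosed hK.compact fun ε hε => ?_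
    obtain ⟨n, h1, h2⟩ := ((hconv i (ε / 2) (by positivity)).and
      ((hδ.comp hkt).eventually (gt_mem_nhds (half_pos hε)))).exists
    have h3 := Metric.cthickening_subset_of_subset (ε / 2) (hDK (k n) i) (h1.2 hx)
    have h4 := Metric.cthickening_cthickening_subset (by positivity) (hδ0 _) _ h3
    exact Metric.cthickening_mono (by simp only [Function.comp] at h2; linarith) _ h4
  · have hW := area_ball_pos hφ
    have hs : ∀ ε > 0, ∑ i ∈ s, per φ (A i) ≤ p + s.card * (M * ε * (2 * area (ball φ))) := by
      intro ε hε
      refine ge_of_tendsto ((hP.comp hkt).add_const _) ?_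
      filter_upwards [(eventually_all_finset s).2 fun i _ => hconv i ε hε] with n hn
      have : ∀ i ∈ s, per φ (A i) ≤ per φ (D (k n) i) + M * ε * (2 * area (ball φ)) := by
        intro i hi
        have h1 := (hn i hi).2.trans (hthick (hD (k n) i).compact ε hε)
        have h2 := per_mono hφ (hA i) ((hD _ i).add ((CC.ball hφ).smul _)) h1
        rwa [per_add hφ (hD _ i) ((CC.ball hφ).smul _), per_smul hφ (CC.ball hφ) (by positivity),
          per_ball hφ] at h2
      refine (Finset.sum_le_sum this).trans ?_
      rw [Finset.sum_add_distrib, Finset.sum_const, nsmul_eq_mul]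
      exact add_le_add_left (hDP' _ s) _
    have ht : Tendsto (fun ε : ℝ => p + s.card * (M * ε * (2 * area (ball φ)))) (𝓝[>] 0) (𝓝 p) := by
      have : Continuous fun ε : ℝ => p + s.card * (M * ε * (2 * area (ball φ))) := by fun_prop
      have h := this.tendsto 0
      simp only [mul_zero, zero_mul, add_zero] at h
      exact h.mono_left nhdsWithin_le_nhds
    exact ge_of_tendsto ht (eventually_mem_nhdsWithin.mono hs)
  · set c : ℕ → ℝ := fun i => T ^ 2 / (4 * area (ball φ)) * (1 / ((i : ℝ) + 1) ^ 2)
    have hc0 : ∀ i, 0 ≤ c i := fun i => by have := area_ball_pos hφ; positivity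
    have hcs : Summable c := by
      refine Summable.mul_left _ ?_
      have := (summable_nat_add_iff 1).2 (Real.summable_one_div_nat_pow.2 (one_lt_two))
      simpa using this
    have hvol : ∀ n i, volume (D n i) ≤ ENNReal.ofReal (c i) := fun n i => by
      rw [← ENNReal.ofReal_toReal (hD n i).compact.measure_lt_top.ne]
      exact ENNReal.ofReal_le_ofReal (area_seq_le hφ (hD n) (hanti n)
        (fun s => (hDP' n s).trans (hT' n)) i)
    have htail := ENNReal.tendsto_sum_nat_add (fun i => ENNReal.ofReal (c i))
      hcs.tsum_ofReal_ne_top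
    have hbad : volume (⋂ I : ℕ, {x | ∀ᶠ n in atTop, x ∈ ⋃ i, D (k n) (i + I)}) = 0 := by
      refine le_antisymm (ge_of_tendsto' htail fun I => ?_) bot_le
      refine (measure_mono (iInter_subset _ I)).trans (volume_eventually_mem_le fun n => ?_)
      exact (measure_iUnion_le _).trans (ENNReal.tsum_le_tsum fun i => hvol _ _)
    have hbad' := measure_eq_zero_iff_ae_notMem.1 hbad
    filter_upwards [hE, hbad'] with x hx hxb hxE
    simp only [mem_iInter, not_forall] at hxb
    obtain ⟨I, hI⟩ := hxb
    have h1 : ∃ᶠ n in atTop, ∃ i ∈ Finset.range I, x ∈ D (k n) i := by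
      refine (Filter.not_eventually.1 hI).mp ((hkt.eventually (hx hxE)).mono fun n hn hn' => ?_)
      obtain ⟨i, hi⟩ := mem_iUnion.1 (hfD _ hn)
      refine ⟨i, ?_, hi⟩
      by_contra hlt
      refine hn' (mem_iUnion.2 ⟨i - I, ?_⟩)
      rwa [Nat.sub_add_cancel (by simpa using hlt)]
    have h2 : ∃ i, ∃ᶠ n in atTop, x ∈ D (k n) i := by
      by_contra! hcon
      refine h1 (((eventually_all_finset (Finset.range I)).2 fun i _ =>
        hcon i).mono ?_)
      rintro n hn ⟨i, hi, hxi⟩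
      exact hn i hi hxi
    obtain ⟨i, hi⟩ := h2
    refine mem_iUnion.2 ⟨i, hclosed (hA i).compact fun ε hε => ?_⟩
    obtain ⟨n, h3, h4⟩ := (hi.and_eventually (hconv i ε hε)).exists
    exact h4.1 h3

end

section

variable {φ : Plane → ℝ}

/-- The asymptotic zonotopal perimeter of the superlevel sets of the mollifications of `u`. -/
def lowTot (l : ℕ → List Plane) (u : Plane → ℝ) (t : ℝ) : ℝ≥0∞ :=
  liminf (fun n => tot (l n) (lev (moll u n) t)) atTop

lemma measurable_lowTot (l : ℕ → List Plane) (u : Plane → ℝ) : Measurable (lowTot l u) :=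
  Measurable.liminf fun n => measurable_tot (l n) (moll u n)

lemma lintegral_lowTot_le {u : Plane → ℝ} {l : ℕ → List Plane} (hl : ZSeq φ l) {Ω : Set Plane}
    (hΩ : Bornology.IsBounded Ω) (h0 : ∀ x ∉ Ω, u x = 0) (hi : Integrable u)
    (hn : ∀ᵐ x, 0 ≤ u x) {T : ℝ} (hT : 0 ≤ T) (h : anisoTV φ u ≤ ENNReal.ofReal T) :
    ∫⁻ t in Ioi 0, lowTot l u t ≤ ENNReal.ofReal T := by
  refine (lintegral_liminf_le fun n => measurable_tot (l n) (moll u n)).trans ?_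
  refine liminf_le_of_frequently_le' (Eventually.frequently (Eventually.of_forall fun n => ?_))
  exact lintegral_tot_le (contDiff_moll hi n) (hasCompactSupport_moll hΩ h0 n)
    (moll_nonneg hn n) (hl.sub n) hT (anisoTV_moll_le hi hT h n)

lemma exists_level_family (hφ : IsNorm φ) {u : Plane → ℝ} {l : ℕ → List Plane} (hl : ZSeq φ l)
    {Ω : Set Plane} (hΩ : Bornology.IsBounded Ω) (hΩc : Convex ℝ Ω) (hΩn : Ω.Nonempty)
    (h0 : ∀ x ∉ Ω, u x = 0) (hi : Integrable u) (j : ℕ)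
    (hp : ∫⁻ t in Ioo (j : ℝ) (j + 1), lowTot l u t ≠ ⊤) :
    ∃ A : ℕ → Set Plane, (∀ i, CC (A i)) ∧ (∀ i, A i ⊆ closure Ω) ∧
      (∀ s : Finset ℕ, ∑ i ∈ s, per φ (A i) ≤ (∫⁻ t in Ioo (j : ℝ) (j + 1), lowTot l u t).toReal) ∧
      ∀ᵐ x, (j + 1 : ℝ) ≤ u x → x ∈ ⋃ i, A i := by
  set p := ∫⁻ t in Ioo (j : ℝ) (j + 1), lowTot l u t with hpdef
  have hprob : IsProbabilityMeasure (volume.restrict (Ioo (j : ℝ) (j + 1))) := ⟨by simp⟩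
  have hg : ∀ n, Continuous (moll u n) := fun n => (contDiff_moll hi n).continuous
  set Z : Set ℝ := ⋃ n, {t : ℝ | 0 < volume {x | moll u n x = t}}
  have hZ : Z.Countable := countable_iUnion fun n =>
    Measure.countable_meas_level_set_pos (hg n).measurable
  have hnull : volume.restrict (Ioo (j : ℝ) (j + 1)) ((Ioo (j : ℝ) (j + 1))ᶜ ∪ Z) = 0 := by
    refine measure_union_null ?_ ?_
    · rw [Measure.restrict_apply measurableSet_Ioo.compl]; simp
    · exact Measure.restrict_le_self.absolutelyContinuous (hZ.measure_zero volume)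
  obtain ⟨t, htn, ht⟩ := exists_notMem_null_le_lintegral
    (measurable_lowTot l u).aemeasurable hnull
  rw [← hpdef] at ht
  simp only [mem_union, mem_compl_iff, not_or, not_not] at htn
  obtain ⟨htj, htZ⟩ := htn
  have ht0 : 0 < t := lt_of_le_of_lt (Nat.cast_nonneg j) htj.1
  have hfreq : ∀ k : ℕ, ∃ᶠ n in atTop,
      tot (l n) (lev (moll u n) t) < p + ENNReal.ofReal (dl k) := fun k => by
    refine frequently_lt_of_liminf_lt (by isBoundedDefault) (ht.trans_lt ?_)
    exact ENNReal.lt_add_right hp (by simpa using dl_pos k)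
  obtain ⟨n, hn, hq⟩ := extraction_forall_of_frequently hfreq
  have hlevel : ∀ k, volume {x | moll u (n k) x = t} = 0 := fun k => by
    by_contra hc
    exact htZ (mem_iUnion.2 ⟨n k, pos_iff_ne_zero.2 hc⟩)
  choose N f hf hfh hfv hfp using fun k => exists_hulls hφ (hg (n k))
    (hasCompactSupport_moll hΩ h0 (n k)) (dl_lt (n k)) (hl.sup (n k)) ht0 (hlevel k)
    (ε := 2⁻¹ ^ k) (by simp [pos_iff_ne_zero])
  have hK : CC (closure Ω) :=
    ⟨Metric.isCompact_of_isClosed_isBounded isClosed_closure hΩ.closure, hΩc.closure, hΩn.closure⟩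
  have hdn : Tendsto (fun k => dl (n k)) atTop (𝓝 0) := dl_tendsto.comp hn.tendsto_atTop
  refine exists_limit_family hφ hK hf (δ := fun k => dl (n k)) (fun k => (dl_pos _).le)
    (fun k => (dl_lt _).le) hdn (fun k i => (hfh k i).trans ?_)
    (P := fun k => (p.toReal + dl k) / (1 - dl (n k))) ?_ (fun k => ?_) ?_
  · refine hull_subset (fun x hx => ?_) (hK.convex.cthickening _) Metric.isClosed_cthickening
    have hx' : t ≤ moll u (n k) x := hx
    exact Metric.cthickening_subset_of_subset _ subset_closure
      (mem_cthickening_of_moll_ne h0 (by linarith : 0 < moll u (n k) x).ne')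
  · have := (tendsto_const_nhds (x := p.toReal)).add dl_tendsto
    have h2 : Tendsto (fun k => (p.toReal + dl k) / (1 - dl (n k))) atTop
        (𝓝 ((p.toReal + 0) / (1 - 0))) :=
      this.div ((tendsto_const_nhds (x := (1 : ℝ))).sub hdn) (by norm_num)
    simpa using h2
  · have h1 := dl_lt (n k)
    rw [le_div_iff₀ (by linarith), mul_comm]
    have h2 := (hfp k).trans (hq k).le
    have h3 := ENNReal.toReal_mono (by finiteness) h2
    rw [ENNReal.toReal_add hp (by finiteness), ENNReal.toReal_ofReal (dl_pos k).le] at h3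
    refine le_trans ?_ h3
    rw [ENNReal.toReal_ofReal]
    exact mul_nonneg (by linarith) (Finset.sum_nonneg fun i _ => per_nonneg hφ (hf k i))
  · have hsum : ∑' k, volume (lev (moll u (n k)) t \ ⋃ i, f k i) ≠ ⊤ := by
      refine ne_top_of_le_ne_top ?_ (ENNReal.tsum_le_tsum hfv)
      rw [ENNReal.tsum_geometric]; simp
    filter_upwards [ae_eventually_notMem hsum, tendsto_moll hi] with x hx1 hx2 hxj
    have hxj' : (j + 1 : ℝ) ≤ u x := hxj
    have h3 : ∀ᶠ k in atTop, t < moll u (n k) x :=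
      (hx2.comp hn.tendsto_atTop).eventually (lt_mem_nhds (by
        have := htj.2; linarith))
    filter_upwards [hx1, h3] with k h4 h5
    by_contra hc
    exact h4 ⟨h5.le, hc⟩

lemma exists_family (hφ : IsNorm φ) {u : Plane → ℝ} {Ω : Set Plane}
    (hΩm : MeasurableSet Ω) (hΩ : Bornology.IsBounded Ω) (hΩc : Convex ℝ Ω) (hΩn : Ω.Nonempty)
    (h0 : ∀ᵐ x, x ∉ Ω → u x = 0) (hi : Integrable u) (hN : ∀ᵐ x, ∃ k : ℕ, u x = k)
    {T : ℝ} (hT : 0 ≤ T) (h : anisoTV φ u ≤ ENNReal.ofReal T) :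
    ∃ C : ℕ × ℕ → Set Plane, (∀ i, CC (C i)) ∧ (∀ i, C i ⊆ closure Ω) ∧
      (Summable fun i => per φ (C i)) ∧ ∑' i, per φ (C i) ≤ T ∧ (Summable fun i => area (C i)) ∧
      ∀ᵐ x, u x ≤ vsum C x := by
  set v := Ω.indicator u with hv
  have huv : u =ᵐ[volume] v := by
    filter_upwards [h0] with x hx
    by_cases hxΩ : x ∈ Ω
    · rw [hv, indicator_of_mem hxΩ]
    · rw [hv, indicator_of_notMem hxΩ, hx hxΩ]
  have hvi : Integrable v := hi.indicator hΩm
  have hv0 : ∀ x ∉ Ω, v x = 0 := fun x hx => indicator_of_notMem hx _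
  have hvn : ∀ᵐ x, 0 ≤ v x := by
    filter_upwards [hN, huv] with x ⟨k, hk⟩ hx
    rw [← hx, hk]; positivity
  have hvT : anisoTV φ v ≤ ENNReal.ofReal T := by
    have : anisoTV φ v = anisoTV φ u := by
      unfold anisoTV
      refine iSup_congr fun η => iSup_congr fun _ => ?_
      congr 1
      exact integral_congr_ae (huv.symm.mono fun x hx => by simp only [hx])
    rwa [this]
  obtain ⟨l, hl'⟩ := exists_zseq hφ
  have hl : ZSeq φ l := ⟨fun n => (hl' n).1, fun n => (hl' n).2⟩
  set p : ℕ → ℝ≥0∞ := fun j => ∫⁻ t in Ioo (j : ℝ) (j + 1), lowTot l v t with hp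
  have hpT : ∑' j, p j ≤ ENNReal.ofReal T := by
    rw [← lintegral_iUnion (fun j => measurableSet_Ioo)]
    · refine le_trans (lintegral_mono_set ?_) (lintegral_lowTot_le hl hΩ hv0 hvi hvn hT hvT)
      exact iUnion_subset fun j x hx => lt_of_le_of_lt (Nat.cast_nonneg j) hx.1
    · intro j k hjk
      refine Set.disjoint_left.2 fun x hx hx' => hjk ?_
      have h1 : (j : ℝ) < k + 1 := hx.1.trans hx'.2
      have h2 : (k : ℝ) < j + 1 := hx'.1.trans hx.2
      norm_cast at h1 h2
      omega
  have hptop : ∀ j, p j ≠ ⊤ := fun j =>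
    ne_top_of_le_ne_top ENNReal.ofReal_ne_top ((ENNReal.le_tsum j).trans hpT)
  choose A hA hAK hAp hAc using fun j => exists_level_family hφ hl hΩ hΩc hΩn hv0 hvi j (hptop j)
  have hnn : ∀ i : ℕ × ℕ, 0 ≤ per φ (A i.1 i.2) := fun i => per_nonneg hφ (hA _ _)
  have hfin : ∀ s : Finset (ℕ × ℕ), ∑ i ∈ s, per φ (A i.1 i.2) ≤ T := by
    intro s
    calc _ ≤ ∑ i ∈ s.image Prod.fst ×ˢ s.image Prod.snd, per φ (A i.1 i.2) :=
          Finset.sum_le_sum_of_subset_of_nonneg Finset.subset_product fun i _ _ => hnn i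
      _ = ∑ j ∈ s.image Prod.fst, ∑ i ∈ s.image Prod.snd, per φ (A j i) :=
          Finset.sum_product _ _ _
      _ ≤ ∑ j ∈ s.image Prod.fst, (p j).toReal := Finset.sum_le_sum fun j _ => hAp j _
      _ = (∑ j ∈ s.image Prod.fst, p j).toReal := (ENNReal.toReal_sum fun j _ => hptop j).symm
      _ ≤ (ENNReal.ofReal T).toReal :=
          ENNReal.toReal_mono ENNReal.ofReal_ne_top ((ENNReal.sum_le_tsum _).trans hpT)
      _ = T := ENNReal.toReal_ofReal hT
  have hps : Summable fun i : ℕ × ℕ => per φ (A i.1 i.2) := summable_of_sum_le hnn hfin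
  have hW := area_ball_pos hφ
  have has : Summable fun i : ℕ × ℕ => area (A i.1 i.2) := by
    refine Summable.of_nonneg_of_le (fun i => measureReal_nonneg) (fun i => ?_)
      (hps.mul_left (T / (4 * area (ball φ))))
    have h1 := four_mul_area_le hφ (hA i.1 i.2)
    have h2 : per φ (A i.1 i.2) ≤ T := by simpa using hfin {i}
    rw [div_mul_eq_mul_div, le_div_iff₀ (by positivity)]
    nlinarith [hnn i]
  refine ⟨fun i => A i.1 i.2, fun i => hA _ _, fun i => hAK _ _, hps,
    hps.tsum_le_of_sum_le hfin, has, ?_⟩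
  filter_upwards [ae_all_iff.2 hAc, ae_finite_mem (fun i : ℕ × ℕ => hA i.1 i.2) has, hN, huv] with
    x h1 h2 ⟨k, hk⟩ h3
  rw [vsum_eq_ncard h2, hk, Nat.cast_le]
  have h4 : ∀ j : Fin k, ∃ i, x ∈ A j i := fun j => by
    refine mem_iUnion.1 (h1 j ?_)
    rw [← h3, hk]
    exact_mod_cast j.2
  choose i hi' using h4
  have h5 : (range fun j : Fin k => ((j : ℕ), i j)) ⊆ {i : ℕ × ℕ | x ∈ A i.1 i.2} := by
    rintro _ ⟨j, rfl⟩; exact hi' j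
  calc k = (range fun j : Fin k => ((j : ℕ), i j)).ncard := by
        rw [← Nat.card_coe_set_eq, Nat.card_range_of_injective]
        · simp
        · intro a b hab
          exact Fin.ext (Prod.ext_iff.1 hab).1
    _ ≤ _ := ncard_le_ncard h5 h2

end

section

variable {φ : Plane → ℝ}

/-- A countable family of compact convex subsets of `K` which minimises the total perimeter among
families with the same total area. -/
structure Opt {ι : Type} (φ : Plane → ℝ) (K : Set Plane) (C : ι → Set Plane) : Prop where
  cc : ∀ i, CC (C i)
  sub : ∀ i, C i ⊆ K
  summable : Summable fun i => area (C i)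
  exchange : ∀ (s : Finset ι) (D : ι → Set Plane), (∀ i ∈ s, CC (D i)) → (∀ i ∈ s, D i ⊆ K) →
    ∑ i ∈ s, area (D i) = ∑ i ∈ s, area (C i) → ∑ i ∈ s, per φ (C i) ≤ ∑ i ∈ s, per φ (D i)

lemma hasSum_exchange {ι : Type} [DecidableEq ι] {f g : ι → ℝ} (s : Finset ι) (hf : Summable f) :
    HasSum (fun i => if i ∈ s then g i else f i)
      (∑' i, f i + (∑ i ∈ s, g i - ∑ i ∈ s, f i)) := by
  have h1 : HasSum (fun i => if i ∈ s then g i - f i else 0) (∑ i ∈ s, (g i - f i)) := by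
    rw [← Finset.sum_congr rfl fun i hi => if_pos hi]
    exact hasSum_sum_of_ne_finset_zero fun i hi => by simp [hi]
  have h2 := hf.hasSum.add h1
  rw [Finset.sum_sub_distrib] at h2
  convert h2 using 2 with i
  split_ifs <;> ring

lemma exists_opt (hφ : IsNorm φ) {Ω : Set Plane} (hΩo : IsOpen Ω) (hΩb : Bornology.IsBounded Ω)
    (hΩc : Convex ℝ Ω) {m : ℝ} (hm : 0 < m) {u : Plane → ℝ} (hu : IsMinimizer φ Ω m u) :
    ∃ C : ℕ × ℕ → Set Plane, Opt φ (closure Ω) C ∧ ∑' i, area (C i) = m ∧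
      u =ᵐ[volume] vsum C := by
  obtain ⟨⟨⟨hi, hTV⟩, h0, hN, hum⟩, hmin⟩ := hu
  have hum' : ∫ x, u x = m := by
    rw [← hum, ← integral_indicator hΩo.measurableSet]
    refine integral_congr_ae ?_
    filter_upwards [h0] with x hx
    by_cases hxΩ : x ∈ Ω
    · rw [indicator_of_mem hxΩ]
    · rw [indicator_of_notMem hxΩ, hx hxΩ]
  have hΩn : Ω.Nonempty := by
    by_contra hc
    rw [not_nonempty_iff_eq_empty] at hc
    rw [hc] at hum; simp at hum; linarith
  set T := (anisoTV φ u).toReal with hT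
  have hT0 : 0 ≤ T := ENNReal.toReal_nonneg
  have hTu : anisoTV φ u = ENNReal.ofReal T := (ENNReal.ofReal_toReal hTV).symm
  obtain ⟨C, hC, hCK, hp, hpT, ha, hle⟩ := exists_family hφ hΩo.measurableSet hΩb hΩc hΩn h0 hi hN
    hT0 hTu.le
  have hcmp : ∀ D : ℕ × ℕ → Set Plane, (∀ i, CC (D i)) → (∀ i, D i ⊆ closure Ω) →
      (Summable fun i => area (D i)) → (Summable fun i => per φ (D i)) →
      ∑' i, area (D i) = m → T ≤ ∑' i, per φ (D i) := by
    intro D hD hDK hDa hDp hDm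
    have h1 := admissible_vsum hφ hΩo hΩc hD hDK hDa hDp
    rw [hDm] at h1
    have h2 := (hmin _ h1).trans (anisoTV_vsum_le hφ hD hDa hDp)
    rw [hTu] at h2
    exact (ENNReal.ofReal_le_ofReal_iff (tsum_nonneg fun i => per_nonneg hφ (hD i))).1 h2
  set M := ∑' i, area (C i) with hM
  have hint : ∫ x, vsum C x = M := integral_vsum hC ha
  have hmM : m ≤ M := by
    rw [← hum', ← hint]
    exact integral_mono_ae hi (integrable_vsum hC ha) hle
  have hMm : M = m := by
    by_contra hne
    have hlt : m < M := lt_of_le_of_ne hmM (Ne.symm hne)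
    have hM0 : 0 < M := hm.trans hlt
    set L := √(m / M) with hL
    have hL0 : 0 < L := Real.sqrt_pos.2 (by positivity)
    have hL2 : L ^ 2 = m / M := Real.sq_sqrt (by positivity)
    have hL1 : L < 1 := by
      rw [hL, Real.sqrt_lt' one_pos, one_pow, div_lt_one hM0]; exact hlt
    obtain ⟨c, hc⟩ := hΩn
    have hper : ∀ i, per φ ({(1 - L) • c} + L • C i) = L * per φ (C i) := fun i => by
      rw [per_add hφ (CC.singleton _) ((hC i).smul L), per_singleton, per_smul hφ (hC i) hL0.le,
        zero_add]
    have harea : ∀ i, area ({(1 - L) • c} + L • C i) = L ^ 2 * area (C i) := fun i => by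
      rw [area_translate, area_smul]
    have h1 := hcmp (fun i => {(1 - L) • c} + L • C i) (fun i => (CC.singleton _).add ((hC i).smul L))
      (fun i => by
        rintro _ ⟨_, rfl, _, ⟨x, hx, rfl⟩, rfl⟩
        exact hΩc.closure (subset_closure hc) (hCK i hx) (by linarith) hL0.le (by ring))
      (by simp only [harea]; exact ha.mul_left _) (by simp only [hper]; exact hp.mul_left _)
      (by simp only [harea]; rw [tsum_mul_left, ← hM, hL2]; field_simp)
    simp only [hper] at h1
    rw [tsum_mul_left] at h1
    have h2 : T ≤ L * T := h1.trans (by gcongr)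
    have h3 : T = 0 := by nlinarith
    have h4 : ∀ i, per φ (C i) = 0 := by
      intro i
      have := hp.le_tsum i fun k _ => per_nonneg hφ (hC k)
      exact le_antisymm (by linarith) (per_nonneg hφ (hC i))
    have h5 : ∀ i, area (C i) = 0 := by
      intro i
      have h6 := four_mul_area_le hφ (hC i)
      have hW := area_ball_pos hφ
      have : 0 ≤ area (C i) := measureReal_nonneg
      rw [h4 i] at h6
      nlinarith
    rw [hM] at hM0
    simp [h5] at hM0
  refine ⟨C, ⟨hC, hCK, ha, ?_⟩, hMm, ?_⟩
  · classical
    intro s D hD hDK hs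
    set D' : ℕ × ℕ → Set Plane := fun i => if i ∈ s then D i else C i with hD'
    have e1 : ∀ i, area (D' i) = if i ∈ s then area (D i) else area (C i) := fun i => by
      simp only [hD']; split_ifs <;> rfl
    have e2 : ∀ i, per φ (D' i) = if i ∈ s then per φ (D i) else per φ (C i) := fun i => by
      simp only [hD']; split_ifs <;> rfl
    have h1 := hasSum_exchange (g := fun i => area (D i)) s ha
    have h2 := hasSum_exchange (g := fun i => per φ (D i)) s hp
    rw [hs, sub_self, add_zero] at h1
    simp only [← e1] at h1
    simp only [← e2] at h2
    have h3 := hcmp D' (fun i => by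
        simp only [hD']; split_ifs with h; exacts [hD i h, hC i]) (fun i => by
        simp only [hD']; split_ifs with h; exacts [hDK i h, hCK i])
      h1.summable h2.summable (by rw [h1.tsum_eq, ← hM, hMm])
    rw [h2.tsum_eq] at h3
    linarith
  · have h1 : 0 ≤ᵐ[volume] fun x => vsum C x - u x := hle.mono fun x hx => sub_nonneg.2 hx
    have h2 := (integral_eq_zero_iff_of_nonneg_ae h1 ((integrable_vsum hC ha).sub hi)).1 (by
      rw [integral_sub (integrable_vsum hC ha) hi, hint, hum', hMm, sub_self])
    filter_upwards [h2] with x hx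
    simp only [Pi.zero_apply] at hx
    linarith

end

section

variable {φ : Plane → ℝ}

/-- `K` is a compact convex set of inradius `R > 0`. -/
structure Inr (φ : Plane → ℝ) (K : Set Plane) (R : ℝ) : Prop where
  norm : IsNorm φ
  cc : CC K
  pos : 0 < R
  ne : (ero φ K R).Nonempty
  null : area (ero φ K R) = 0
  max : ∀ r, 0 ≤ r → (ero φ K r).Nonempty → r ≤ R

variable {K : Set Plane} {R : ℝ}

lemma Inr.ne_of_le (h : Inr φ K R) {r : ℝ} (h0 : 0 ≤ r) (hr : r ≤ R) : (ero φ K r).Nonempty :=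
  h.ne.mono (ero_anti h.norm K h0 hr)

lemma ero_mono {A B : Set Plane} (hAB : A ⊆ B) (r : ℝ) : ero φ A r ⊆ ero φ B r :=
  fun _ hx => mem_ero.2 ((mem_ero.1 hx).trans hAB)

lemma Inr.cball_subset_ero (h : Inr φ K R) {x : Plane} (hx : x ∈ ero φ K R) {r : ℝ} (h0 : 0 ≤ r)
    (hr : r ≤ R) : cball φ x (R - r) ⊆ ero φ K r := by
  rw [← mem_ero, ero_ero h.norm K h0 (by linarith)]
  simpa using hx

lemma Inr.area_ero_pos (h : Inr φ K R) {r : ℝ} (h0 : 0 ≤ r) (hr : r < R) :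
    0 < area (ero φ K r) := by
  obtain ⟨x, hx⟩ := h.ne
  refine lt_of_lt_of_le ?_ (area_mono (isCompact_ero h.norm h.cc.compact r)
    (h.cball_subset_ero hx h0 hr.le))
  rw [area_cball]
  have := area_ball_pos h.norm
  have : 0 < R - r := by linarith
  positivity

lemma Inr.cball_subset_opn (h : Inr φ K R) {x : Plane} (hx : x ∈ ero φ K R) {r : ℝ} (h0 : 0 ≤ r)
    (hr : r ≤ R) : cball φ x R ⊆ opn φ K r := by
  have h1 : cball φ x R = cball φ x (R - r) + r • ball φ := by
    unfold cball
    rw [add_assoc, smul_ball_add h.norm (by linarith) h0, sub_add_cancel]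
  rw [h1]
  exact add_subset_add_right (h.cball_subset_ero hx h0 hr)

lemma Inr.sq_le_area_opn (h : Inr φ K R) {r : ℝ} (h0 : 0 ≤ r) (hr : r ≤ R) :
    R ^ 2 * area (ball φ) ≤ area (opn φ K r) := by
  obtain ⟨x, hx⟩ := h.ne
  rw [← area_cball (φ := φ) x R]
  exact area_mono (h.cc.opn h.norm (h.ne_of_le h0 hr)).compact (h.cball_subset_opn hx h0 hr)

lemma opn_anti (hφ : IsNorm φ) (K : Set Plane) {r s : ℝ} (h0 : 0 ≤ r) (hs : r ≤ s) :
    opn φ K s ⊆ opn φ K r := by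
  have h1 : opn φ K s = opn φ (ero φ K r) (s - r) + r • ball φ := by
    unfold opn
    rw [ero_ero hφ K h0 (by linarith), add_assoc, smul_ball_add hφ (by linarith) h0,
      sub_add_cancel, add_sub_cancel]
  rw [h1]
  exact add_subset_add_right (opn_subset _ _)

lemma Inr.area_opn_anti (h : Inr φ K R) {r s : ℝ} (h0 : 0 ≤ r) (hrs : r ≤ s) (hs : s ≤ R) :
    area (opn φ K s) ≤ area (opn φ K r) :=
  area_mono (h.cc.opn h.norm (h.ne_of_le h0 (hrs.trans hs))).compact (opn_anti h.norm K h0 hrs)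

lemma opn_zero (hφ : IsNorm φ) (K : Set Plane) : opn φ K 0 = K := by
  rw [opn, ero_zero hφ, zero_smul_set (ball_nonempty hφ), add_zero]

lemma Inr.per_opn_eq (h : Inr φ K R) {r : ℝ} (h0 : 0 ≤ r) (hr : r ≤ R) :
    r * per φ (opn φ K r) + area (ero φ K r) = area (opn φ K r) + r ^ 2 * area (ball φ) := by
  rw [per_opn h.norm h.cc h0 (h.ne_of_le h0 hr), area_opn h.norm h.cc h0 (h.ne_of_le h0 hr)]
  ring

/-- The lower bound of the perimeter, together with the strict inequality for sets of small
inradius. -/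
lemma Inr.le_per (h : Inr φ K R) {C : Set Plane} (hC : CC C) (hCK : C ⊆ K)
    (hbig : R ^ 2 * area (ball φ) ≤ area C) {r : ℝ} (h0 : 0 < r) (hr : r ≤ R) :
    area C + r ^ 2 * area (ball φ) ≤ r * per φ C + area (ero φ K r) ∧
      (r * per φ C + area (ero φ K r) ≤ area C + r ^ 2 * area (ball φ) →
        (ero φ C r).Nonempty) := by
  have hφ := h.norm
  have hW := area_ball_pos hφ
  by_cases hne : (ero φ C r).Nonempty
  · refine ⟨?_, fun _ => hne⟩
    have h1 := area_le_ero hφ hC h0.le hne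
    have h2 := area_mono (isCompact_ero hφ h.cc.compact r) (ero_mono (φ := φ) hCK r)
    linarith
  · obtain ⟨ρ, hρ0, hρne, hρn, -⟩ := exists_inradius hφ hC
    have hρr : ρ < r := by
      by_contra! hc
      exact hne (hρne.mono (ero_anti hφ C h0.le hc))
    have h1 := area_le_ero hφ hC hρ0 hρne
    rw [hρn] at h1
    have hc0 : 0 < area C := lt_of_lt_of_le (by have := h.pos; positivity) hbig
    have hρpos : 0 < ρ := by
      rcases hρ0.eq_or_lt with h' | h'
      · rw [← h'] at h1; simp at h1; linarith
      · exact h'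
    have h2 : r ^ 2 * area (ball φ) ≤ area C := le_trans (by gcongr) hbig
    have h3 : r * ρ * area (ball φ) < area C := lt_of_lt_of_le (by
      rw [pow_two]; gcongr) h2
    have h4 : area C + r ^ 2 * area (ball φ) < r * per φ C := by
      refine lt_of_mul_lt_mul_left ?_ hρ0
      nlinarith [mul_pos (sub_pos.2 hρr) (sub_pos.2 h3)]
    have h5 : 0 ≤ area (ero φ K r) := measureReal_nonneg
    exact ⟨by linarith, fun h' => by linarith⟩

lemma Inr.eq_opn_self (h : Inr φ K R) {C : Set Plane} (hC : CC C) (hCK : C ⊆ K)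
    (hbig : R ^ 2 * area (ball φ) ≤ area C) {r : ℝ} (h0 : 0 < r) (hr : r ≤ R)
    (heq : r * per φ C + area (ero φ K r) ≤ area C + r ^ 2 * area (ball φ)) :
    (ero φ C r).Nonempty ∧ opn φ C r = C ∧ (r < R → C = opn φ K r) := by
  have hφ := h.norm
  have hne := (h.le_per hC hCK hbig h0 hr).2 heq
  have h1 := area_le_ero hφ hC h0.le hne
  have h2 := area_mono (isCompact_ero hφ h.cc.compact r) (ero_mono (φ := φ) hCK r)
  have h3 := eq_opn_of_area_eq hφ hC h0 hne (by linarith)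
  refine ⟨hne, h3, fun hlt => ?_⟩
  have h4 : ero φ C r = ero φ K r := (h.cc.ero hφ (h.ne_of_le h0.le hr)).eq_of_area_le
    (isCompact_ero hφ hC.compact r).isClosed (ero_mono hCK r) (h.area_ero_pos h0.le hlt)
    (by linarith)
  rw [← h3]
  unfold opn
  rw [h4]

lemma Inr.area_opn_scaling (h : Inr φ K R) {r s : ℝ} (h0 : 0 ≤ r) (hrs : r ≤ s) (hs : s ≤ R)
    (hr : r < R) : (R - s) ^ 2 * area (opn φ K r) ≤ (R - r) ^ 2 * area (opn φ K s) := by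
  have hφ := h.norm
  obtain ⟨x, hx⟩ := h.ne
  have hR : 0 < R - r := by linarith
  set τ := (s - r) / (R - r) with hτ
  have hτ0 : 0 ≤ τ := div_nonneg (by linarith) hR.le
  have hτ1 : 0 ≤ 1 - τ := by
    rw [sub_nonneg, hτ, div_le_one hR]; linarith
  have hs' : (1 - τ) * r + τ * R = s := by
    have : τ * (R - r) = s - r := div_mul_cancel₀ _ hR.ne'
    linarith
  have hsub : {τ • x} + (1 - τ) • opn φ K r ⊆ opn φ K s := by
    rintro _ ⟨_, rfl, _, ⟨_, ⟨k, hk, _, ⟨b, hb, rfl⟩, rfl⟩, rfl⟩, rfl⟩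
    refine ⟨(1 - τ) • k + τ • x, ?_, ((1 - τ) * r) • b, ?_, ?_⟩
    · rw [mem_ero]
      rintro _ ⟨_, rfl, _, ⟨b', hb', rfl⟩, rfl⟩
      have h1 := mem_ero.1 hk ⟨k, rfl, _, ⟨b', hb', rfl⟩, rfl⟩
      have h2 := mem_ero.1 hx ⟨x, rfl, _, ⟨b', hb', rfl⟩, rfl⟩
      have h3 := h.cc.convex h1 h2 hτ1 hτ0 (by ring)
      convert h3 using 1
      simp only [← hs']
      module
    · refine smul_ball_mono hφ (by positivity) ?_ ⟨b, hb, rfl⟩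
      nlinarith
    · simp only [smul_add]
      module
  have h3 := area_mono (h.cc.opn hφ (h.ne_of_le (h0.trans hrs) hs)).compact hsub
  rw [area_translate, area_smul] at h3
  have h4 : (R - r) * (1 - τ) = R - s := by
    have : τ * (R - r) = s - r := div_mul_cancel₀ _ hR.ne'
    linarith
  rw [← h4, mul_pow, mul_assoc]
  gcongr

end

section

variable {φ : Plane → ℝ} {K : Set Plane} {R : ℝ}

lemma Inr.exists_area_lt (h : Inr φ K R) {c : ℝ} (hc : area (opn φ K R) < c) :
    ∃ s, 0 ≤ s ∧ s < R ∧ area (opn φ K s) < c := by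
  by_contra! hcon
  have hφ := h.norm
  have hR := h.pos
  have hlim : Tendsto (fun n => area (ero φ K (rs R n))) atTop (𝓝 0) := by
    have := tendsto_area_ero hφ h.cc.compact hR.le
    rwa [h.null] at this
  set c' := (c + area (opn φ K R)) / 2 with hc'
  have hev := hlim.eventually (gt_mem_nhds (show (0 : ℝ) < c - c' by linarith))
  obtain ⟨n₀, hn₀⟩ := eventually_atTop.1 hev
  have hsq := h.sq_le_area_opn hR.le le_rfl
  have hpos : ∀ n, 0 < rs R n := fun n => mul_pos hR (one_sub_dl_pos n)
  have hlt : ∀ n, rs R n < R := fun n => by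
    have := mul_lt_mul_of_pos_left (show 1 - dl n < 1 by linarith [dl_pos n]) hR
    simpa [rs] using this
  have hW := area_ball_pos hφ
  have hne : ∀ n, (ero φ K (rs R n)).Nonempty := fun n => h.ne_of_le (hpos n).le (hlt n).le
  have hper : (c' - R ^ 2 * area (ball φ)) / R ≤ per φ (ero φ K R) := by
    refine per_le_of_antitone hφ (A := fun n => ero φ K (rs R (n + n₀)))
      (fun n => h.cc.ero hφ (hne _)) (fun m n hmn => ero_rs_antitone hφ K hR.le (by simpa using hmn))
      (h.cc.ero hφ h.ne) ?_ fun n => ?_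
    · rw [← iInter_ero hφ h.cc.compact.isClosed hR.le]
      refine subset_iInter fun n => (iInter_subset _ n).trans ?_
      exact ero_rs_antitone hφ K hR.le (Nat.le_add_right n n₀)
    · have h1 := hcon _ (hpos (n + n₀)).le (hlt _)
      rw [area_opn hφ h.cc (hpos _).le (hne _)] at h1
      have h2 := hn₀ (n + n₀) (Nat.le_add_left _ _)
      have h3 := per_nonneg hφ (h.cc.ero hφ (hne (n + n₀)))
      rw [div_le_iff₀ hR]
      have h4 : rs R (n + n₀) ^ 2 * area (ball φ) ≤ R ^ 2 * area (ball φ) := by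
        have := (hpos (n + n₀)).le
        have := (hlt (n + n₀)).le
        gcongr
      have h5 : rs R (n + n₀) * per φ (ero φ K (rs R (n + n₀))) ≤
          R * per φ (ero φ K (rs R (n + n₀))) := by
        have := (hlt (n + n₀)).le
        gcongr
      linarith
  rw [div_le_iff₀ hR] at hper
  have := area_opn hφ h.cc hR.le h.ne
  rw [h.null] at this
  linarith

lemma Inr.exists_area_eq (h : Inr φ K R) {c : ℝ} (hc : area (opn φ K R) < c)
    (hc' : c ≤ area K) : ∃ r, 0 ≤ r ∧ r < R ∧ area (opn φ K r) = c := by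
  obtain ⟨s, hs0, hsR, hs⟩ := h.exists_area_lt hc
  have hK0 : 0 ≤ area K := measureReal_nonneg
  have hcont : ContinuousOn (fun r => area (opn φ K r)) (Icc 0 s) := by
    have hRs : 0 < R - s := by linarith
    have key : ∀ a b, 0 ≤ a → a ≤ b → b ≤ s →
        area (opn φ K a) - area (opn φ K b) ≤ (2 * R * area K / (R - s) ^ 2) * (b - a) := by
      intro a b ha hab hb
      have h1 := h.area_opn_scaling ha hab (by linarith) (by linarith)
      have h2 : area (opn φ K a) ≤ area K := area_mono h.cc.compact (opn_subset _ _)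
      have h3 := h.area_opn_anti ha hab (by linarith)
      have h0 : 0 ≤ area (opn φ K a) := measureReal_nonneg
      rw [div_mul_eq_mul_div, le_div_iff₀ (by positivity)]
      have h4 : (R - s) ^ 2 ≤ (R - a) ^ 2 := by gcongr; linarith
      have h5 : (R - a) ^ 2 * (area (opn φ K a) - area (opn φ K b)) ≤
          ((R - a) ^ 2 - (R - b) ^ 2) * area (opn φ K a) := by linarith
      have h6 : (R - a) ^ 2 - (R - b) ^ 2 ≤ 2 * R * (b - a) := by nlinarith
      have h7 : 0 ≤ (R - a) ^ 2 - (R - b) ^ 2 := by nlinarith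
      have h8 : 0 ≤ 2 * R * (b - a) := by nlinarith
      calc (area (opn φ K a) - area (opn φ K b)) * (R - s) ^ 2
          ≤ (area (opn φ K a) - area (opn φ K b)) * (R - a) ^ 2 := by
            gcongr
        _ ≤ ((R - a) ^ 2 - (R - b) ^ 2) * area (opn φ K a) := by linarith
        _ ≤ (2 * R * (b - a)) * area K := by gcongr
        _ = _ := by ring
    set L := 2 * R * area K / (R - s) ^ 2
    have hL : 0 ≤ L := by have := h.pos; positivity
    refine (LipschitzOnWith.of_dist_le_mul (K := ⟨L, hL⟩) fun a ha b hb => ?_).continuousOn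
    rw [Real.dist_eq, Real.dist_eq]
    rcases le_total a b with hab | hab
    · have h1 := key a b ha.1 hab hb.2
      have h3 := h.area_opn_anti ha.1 hab (by linarith [hb.2])
      rw [abs_of_nonneg (by linarith), abs_sub_comm, abs_of_nonneg (by linarith)]
      exact h1
    · have h1 := key b a hb.1 hab ha.2
      have h3 := h.area_opn_anti hb.1 hab (by linarith [ha.2])
      rw [abs_sub_comm, abs_of_nonneg (by linarith), abs_of_nonneg (by linarith)]
      exact h1
  have hmem : c ∈ Icc (area (opn φ K s)) (area (opn φ K 0)) := by
    rw [opn_zero h.norm]; exact ⟨hs.le, hc'⟩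
  obtain ⟨r, hr, hrc⟩ := intermediate_value_Icc' hs0 hcont hmem
  exact ⟨r, hr.1, by linarith [hr.2], hrc⟩

lemma Inr.exists_flat (h : Inr φ K R) {c : ℝ} (hc : R ^ 2 * area (ball φ) ≤ c)
    (hc' : c ≤ area (opn φ K R)) :
    ∃ F, CC F ∧ F ⊆ K ∧ area F = c ∧ R * per φ F = c + R ^ 2 * area (ball φ) := by
  have hφ := h.norm
  obtain ⟨x, hx⟩ := h.ne
  have hS := h.cc.ero hφ h.ne
  have hA := area_opn hφ h.cc h.pos.le h.ne
  rw [h.null] at hA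
  set p := per φ (ero φ K R) with hp
  have hp0 : 0 ≤ p := per_nonneg hφ hS
  have hR := h.pos
  obtain ⟨t, ht0, ht1, htc⟩ : ∃ t, 0 ≤ t ∧ t ≤ 1 ∧ t * (R * p) = c - R ^ 2 * area (ball φ) := by
    rcases (mul_nonneg hR.le hp0).eq_or_lt with h0 | h0
    · exact ⟨0, le_rfl, zero_le_one, by linarith⟩
    · refine ⟨(c - R ^ 2 * area (ball φ)) / (R * p), div_nonneg (by linarith) h0.le, ?_,
        div_mul_cancel₀ _ h0.ne'⟩
      rw [div_le_one h0]; linarith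
  set S := {(1 - t) • x} + t • ero φ K R with hSdef
  have hSC : CC S := (CC.singleton _).add (hS.smul t)
  have hSa : area S = 0 := by rw [hSdef, area_translate, area_smul, h.null, mul_zero]
  have hSp : per φ S = t * p := by
    rw [hSdef, per_add hφ (CC.singleton _) (hS.smul t), per_singleton, per_smul hφ hS ht0, zero_add]
  have hSK : S ⊆ ero φ K R := by
    rintro _ ⟨_, rfl, _, ⟨y, hy, rfl⟩, rfl⟩
    exact hS.convex hx hy (by linarith) ht0 (by ring)
  have hB : CC (R • ball φ) := (CC.ball hφ).smul R
  have hst := steiner hφ hSC hR.le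
  have hF : area (S + R • ball φ) = c := by
    rw [hst, hSa, hSp]; linarith
  refine ⟨S + R • ball φ, hSC.add hB,
    (add_subset_add_right hSK).trans (opn_subset K R), hF, ?_⟩
  rw [per_add hφ hSC hB, per_smul hφ (CC.ball hφ) hR.le, per_ball hφ, hSp]
  linarith

/-- For every admissible area there is a set of least perimeter. -/
lemma Inr.exists_fam (h : Inr φ K R) {c r₀ : ℝ} (hr₀ : 0 ≤ r₀) (hr₀R : r₀ < R)
    (hc : R ^ 2 * area (ball φ) ≤ c) (hc' : c ≤ area (opn φ K r₀)) :
    ∃ r F, r₀ ≤ r ∧ r ≤ R ∧ (c < area (opn φ K r₀) → r₀ < r) ∧ CC F ∧ F ⊆ K ∧ area F = c ∧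
      r * per φ F + area (ero φ K r) = c + r ^ 2 * area (ball φ) := by
  have hopn : ∀ r, 0 ≤ r → r ≤ R → area (opn φ K r) = c → CC (opn φ K r) ∧ opn φ K r ⊆ K ∧
      area (opn φ K r) = c ∧
      r * per φ (opn φ K r) + area (ero φ K r) = c + r ^ 2 * area (ball φ) := fun r h0 hr hrc =>
    ⟨h.cc.opn h.norm (h.ne_of_le h0 hr), opn_subset _ _, hrc, by rw [h.per_opn_eq h0 hr, hrc]⟩
  rcases hc'.eq_or_lt with heq | hlt
  · exact ⟨r₀, opn φ K r₀, le_rfl, hr₀R.le, fun h' => absurd h' (by rw [heq]; exact lt_irrefl _),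
      hopn r₀ hr₀ hr₀R.le heq.symm⟩
  rcases le_or_gt c (area (opn φ K R)) with hle | hgt
  · obtain ⟨F, hF, hFK, hFc, hFp⟩ := h.exists_flat hc hle
    exact ⟨R, F, hr₀R.le, le_rfl, fun _ => hr₀R, hF, hFK, hFc, by rw [h.null, add_zero, hFp]⟩
  · obtain ⟨r, h0, hr, hrc⟩ := h.exists_area_eq hgt
      (hc'.trans (area_mono h.cc.compact (opn_subset _ _)))
    have hrr : r₀ < r := by
      by_contra! hcon
      have := h.area_opn_anti h0 hcon hr₀R.le
      linarith
    exact ⟨r, opn φ K r, hrr.le, hr.le, fun _ => hrr, hopn r h0 hr.le hrc⟩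

end

section

variable {φ : Plane → ℝ} {K : Set Plane} {R : ℝ} {ι : Type} {C : ι → Set Plane}

lemma Opt.exchange_one (hC : Opt φ K C) (i : ι) {D : Set Plane} (hD : CC D) (hDK : D ⊆ K)
    (ha : area D = area (C i)) : per φ (C i) ≤ per φ D := by
  have := hC.exchange {i} (fun _ => D) (fun _ _ => hD) (fun _ _ => hDK) (by simpa using ha)
  simpa using this

lemma Opt.exchange_two (hC : Opt φ K C) {i j : ι} (hij : i ≠ j) {D E : Set Plane} (hD : CC D)
    (hDK : D ⊆ K) (hE : CC E) (hEK : E ⊆ K) (ha : area D + area E = area (C i) + area (C j)) :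
    per φ (C i) + per φ (C j) ≤ per φ D + per φ E := by
  classical
  have := hC.exchange {i, j} (fun k => if k = i then D else E) (fun k _ => by
    split_ifs <;> assumption) (fun k _ => by split_ifs <;> assumption)
    (by simpa [Finset.sum_pair hij, hij.symm] using ha)
  simpa [Finset.sum_pair hij, hij.symm] using this

lemma Inr.cball_subset (h : Inr φ K R) {x : Plane} (hx : x ∈ ero φ K R) {r : ℝ} (h0 : 0 ≤ r)
    (hr : r ≤ R) : cball φ x r ⊆ K :=
  mem_ero.1 (ero_anti h.norm K h0 hr hx)

lemma Opt.eq_cball (hC : Opt φ K C) (h : Inr φ K R) {i : ι} (h0 : 0 < area (C i))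
    (hlt : area (C i) < R ^ 2 * area (ball φ)) :
    ∃ x r, 0 < r ∧ r < R ∧ C i = cball φ x r := by
  have hφ := h.norm
  have hW := area_ball_pos hφ
  set ρ := √(area (C i) / area (ball φ)) with hρ
  have hρpos : 0 < ρ := Real.sqrt_pos.2 (by positivity)
  have hρsq : ρ ^ 2 * area (ball φ) = area (C i) := by
    rw [hρ, Real.sq_sqrt (by positivity), div_mul_cancel₀ _ hW.ne']
  have hρR : ρ < R := by
    refine lt_of_pow_lt_pow_left₀ 2 h.pos.le (lt_of_mul_lt_mul_right ?_ hW.le)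
    rwa [hρsq]
  obtain ⟨x₀, hx₀⟩ := h.ne
  have hle := hC.exchange_one i (CC.cball hφ x₀ ρ) (h.cball_subset hx₀ hρpos.le hρR.le)
    (by rw [area_cball, hρsq])
  rw [per_cball hφ x₀ hρpos.le] at hle
  obtain ⟨r, x, hr0, hsub, hr⟩ := isoperimetric hφ (hC.cc i)
  have hrρ : r = ρ := by
    have h1 : r * per φ (C i) ≤ r * (2 * ρ * area (ball φ)) := by gcongr
    have h2 : (r - ρ) ^ 2 * area (ball φ) ≤ 0 := by nlinarith
    have h3 : (r - ρ) ^ 2 = 0 := by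
      refine le_antisymm ?_ (sq_nonneg _)
      by_contra! hc
      nlinarith [mul_pos hc hW]
    have := pow_eq_zero_iff (two_ne_zero) |>.1 h3
    linarith
  rw [hrρ] at hsub
  refine ⟨x, ρ, hρpos, hρR, ?_⟩
  exact ((hC.cc i).eq_of_area_le (CC.cball hφ x ρ).compact.isClosed hsub h0
    (by rw [area_cball, hρsq])).symm

lemma Opt.eq_of_small (hC : Opt φ K C) (h : Inr φ K R) {i j : ι} (hi0 : 0 < area (C i))
    (hi : area (C i) < R ^ 2 * area (ball φ)) (hj0 : 0 < area (C j))
    (hj : area (C j) < R ^ 2 * area (ball φ)) : i = j := by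
  by_contra hij
  have hφ := h.norm
  have hW := area_ball_pos hφ
  obtain ⟨x, a, ha0, haR, hCi⟩ := hC.eq_cball h hi0 hi
  obtain ⟨y, b, hb0, hbR, hCj⟩ := hC.eq_cball h hj0 hj
  obtain ⟨z, hz⟩ := h.ne
  have hR := h.pos
  have key : ∀ p q, 0 ≤ p → p ≤ R → 0 ≤ q → q ≤ R → p ^ 2 + q ^ 2 = a ^ 2 + b ^ 2 →
      a + b ≤ p + q := by
    intro p q hp hpR hq hqR hpq
    have := hC.exchange_two hij (CC.cball hφ z p) (h.cball_subset hz hp hpR) (CC.cball hφ z q)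
      (h.cball_subset hz hq hqR) (by
        rw [hCi, hCj]; simp only [area_cball]; rw [← add_mul, ← add_mul, hpq])
    rw [hCi, hCj, per_cball hφ _ ha0.le, per_cball hφ _ hb0.le, per_cball hφ _ hp,
      per_cball hφ _ hq] at this
    nlinarith
  rcases le_or_gt (a ^ 2 + b ^ 2) (R ^ 2) with hS | hS
  · have h1 := key (√(a ^ 2 + b ^ 2)) 0 (Real.sqrt_nonneg _) (by
      rw [Real.sqrt_le_left hR.le]; exact hS) le_rfl hR.le (by
      rw [Real.sq_sqrt (by positivity)]; ring)
    have h2 : √(a ^ 2 + b ^ 2) < a + b := by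
      rw [Real.sqrt_lt' (by positivity)]
      nlinarith [mul_pos ha0 hb0]
    linarith
  · have h0 : (0 : ℝ) ≤ a ^ 2 + b ^ 2 - R ^ 2 := by linarith
    set q := √(a ^ 2 + b ^ 2 - R ^ 2) with hq
    have hq2 : q ^ 2 = a ^ 2 + b ^ 2 - R ^ 2 := Real.sq_sqrt h0
    have hqR : q ≤ R := by
      rw [hq, Real.sqrt_le_left hR.le]
      nlinarith
    have h1 := key R q hR.le le_rfl (Real.sqrt_nonneg _) hqR (by rw [hq2]; ring)
    have hq0 : 0 ≤ q := Real.sqrt_nonneg _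
    have h2 : (R * q) ^ 2 < (a * b) ^ 2 := by
      rw [mul_pow, hq2, mul_pow]
      have h3 : 0 < R ^ 2 - a ^ 2 := by nlinarith
      have h4 : 0 < R ^ 2 - b ^ 2 := by nlinarith
      nlinarith [mul_pos h3 h4]
    have h5 : R * q < a * b := lt_of_pow_lt_pow_left₀ 2 (by positivity) h2
    nlinarith

lemma Opt.of_big (hC : Opt φ K C) (h : Inr φ K R) {s : Finset ι} (hs : s.Nonempty)
    (hbig : ∀ i ∈ s, R ^ 2 * area (ball φ) ≤ area (C i)) :
    (∃ r, 0 ≤ r ∧ r < R ∧ ∀ i ∈ s, C i = opn φ K r) ∨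
      ∀ i ∈ s, (ero φ (C i) R).Nonempty ∧ opn φ (C i) R = C i := by
  have hφ := h.norm
  have hN : (0 : ℝ) < s.card := by exact_mod_cast hs.card_pos
  have hKpos : 0 < area K := by
    have := h.area_ero_pos le_rfl h.pos
    rwa [ero_zero hφ] at this
  have hle : ∀ i ∈ s, area (C i) ≤ area K := fun i _ => area_mono h.cc.compact (hC.sub i)
  set a := (∑ i ∈ s, area (C i)) / s.card with ha
  have hsum : ∑ i ∈ s, area (C i) = s.card * a := by
    rw [ha, mul_div_cancel₀ _ hN.ne']
  have haK : a ≤ area K := by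
    rw [ha, div_le_iff₀ hN]
    simpa [mul_comm] using Finset.sum_le_sum hle
  have haR : R ^ 2 * area (ball φ) ≤ a := by
    rw [ha, le_div_iff₀ hN]
    simpa [mul_comm] using Finset.sum_le_sum hbig
  rcases haK.eq_or_lt with haK | haK
  · left
    refine ⟨0, le_rfl, h.pos, fun i hi => ?_⟩
    rw [opn_zero hφ]
    have h1 : ∑ i ∈ s, (area K - area (C i)) = 0 := by
      rw [Finset.sum_sub_distrib, hsum, haK]; simp
    have h2 := (Finset.sum_eq_zero_iff_of_nonneg fun i hi => sub_nonneg.2 (hle i hi)).1 h1 i hi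
    exact h.cc.eq_of_area_le (hC.cc i).compact.isClosed (hC.sub i) hKpos (by linarith)
  · obtain ⟨r, F, -, hrR, hr0, hF, hFK, hFa, hFp⟩ := h.exists_fam le_rfl h.pos haR
      (by rw [opn_zero hφ]; exact haK.le)
    have hr0 : 0 < r := hr0 (by rw [opn_zero hφ]; exact haK)
    have hex := hC.exchange s (fun _ => F) (fun _ _ => hF) (fun _ _ => hFK)
      (by simp [hFa, hsum])
    have h0 : ∀ i ∈ s, 0 ≤ r * per φ (C i) + area (ero φ K r) -
        (area (C i) + r ^ 2 * area (ball φ)) := fun i hi =>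
      sub_nonneg.2 (h.le_per (hC.cc i) (hC.sub i) (hbig i hi) hr0 hrR).1
    have h1 : ∑ i ∈ s, (r * per φ (C i) + area (ero φ K r) -
        (area (C i) + r ^ 2 * area (ball φ))) ≤ 0 := by
      rw [Finset.sum_sub_distrib, Finset.sum_add_distrib, Finset.sum_add_distrib,
        ← Finset.mul_sum, hsum]
      simp only [Finset.sum_const, nsmul_eq_mul] at hex ⊢
      have : r * ∑ i ∈ s, per φ (C i) ≤ r * (s.card * per φ F) := by gcongr
      have h2 : (s.card : ℝ) * (r * per φ F + area (ero φ K r)) =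
        s.card * (a + r ^ 2 * area (ball φ)) := by rw [hFp]
      linarith
    have h2 := (Finset.sum_eq_zero_iff_of_nonneg h0).1 (le_antisymm h1 (Finset.sum_nonneg h0))
    have h3 : ∀ i ∈ s, _ := fun i hi =>
      h.eq_opn_self (hC.cc i) (hC.sub i) (hbig i hi) hr0 hrR (sub_nonpos.1 (h2 i hi).le)
    rcases hrR.lt_or_eq with hlt | rfl
    · exact Or.inl ⟨r, hr0.le, hlt, fun i hi => (h3 i hi).2.2 hlt⟩
    · exact Or.inr fun i hi => ⟨(h3 i hi).1, (h3 i hi).2.1⟩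

lemma Opt.eq_opn_of_small (hC : Opt φ K C) (h : Inr φ K R) {i j : ι} {x : Plane} {ρ : ℝ}
    (hρ : 0 < ρ) (hρR : ρ < R) (hj : C j = cball φ x ρ)
    (hi : R ^ 2 * area (ball φ) ≤ area (C i)) : C i = opn φ K ρ := by
  have hφ := h.norm
  have hW := area_ball_pos hφ
  have hR := h.pos
  have hij : i ≠ j := by
    rintro rfl
    rw [hj, area_cball] at hi
    have : ρ ^ 2 < R ^ 2 := by gcongr
    nlinarith
  obtain ⟨z, hz⟩ := h.ne
  have hex : ∀ F r, CC F → F ⊆ K → 0 ≤ r → r ≤ R →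
      area F + r ^ 2 * area (ball φ) = area (C i) + ρ ^ 2 * area (ball φ) →
      per φ (C i) + 2 * ρ * area (ball φ) ≤ per φ F + 2 * r * area (ball φ) := by
    intro F r hF hFK hr hrR hFr
    have := hC.exchange_two hij hF hFK (CC.cball hφ z r) (h.cball_subset hz hr hrR)
      (by rw [hj, area_cball, area_cball, hFr])
    rwa [hj, per_cball hφ _ hρ.le, per_cball hφ _ hr] at this
  have hCi : ∀ {r}, 0 < r → r ≤ R → _ := fun h0 hr => h.le_per (hC.cc i) (hC.sub i) hi h0 hr
  have hopn : CC (opn φ K ρ) := h.cc.opn hφ (h.ne_of_le hρ.le hρR.le)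
  have hopnp := h.per_opn_eq hρ.le hρR.le
  rcases lt_trichotomy (area (C i)) (area (opn φ K ρ)) with hlt | heq | hgt
  · exfalso
    set d := min (ρ ^ 2 * area (ball φ)) (area (opn φ K ρ) - area (C i)) with hd
    have hd0 : 0 < d := lt_min (by positivity) (by linarith)
    have hd1 : d ≤ ρ ^ 2 * area (ball φ) := min_le_left _ _
    have hd2 : d ≤ area (opn φ K ρ) - area (C i) := min_le_right _ _
    obtain ⟨r, F, hr, hrR, -, hF, hFK, hFa, hFp⟩ := h.exists_fam hρ.le hρR
      (c := area (C i) + d) (by linarith) (by linarith)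
    have h1 := (hCi (hρ.trans_le hr) hrR).1
    have h0 : 0 ≤ ρ ^ 2 - d / area (ball φ) := by
      rw [sub_nonneg, div_le_iff₀ hW]; exact hd1
    set q := √(ρ ^ 2 - d / area (ball φ)) with hq
    have hq0 : 0 ≤ q := Real.sqrt_nonneg _
    have hq2 : q ^ 2 = ρ ^ 2 - d / area (ball φ) := Real.sq_sqrt h0
    have hdq : (ρ - q) * (ρ + q) * area (ball φ) = d := by
      have : d / area (ball φ) * area (ball φ) = d := div_mul_cancel₀ _ hW.ne'
      linear_combination this - hq2 * area (ball φ)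
    have hqρ : q < ρ := by
      refine lt_of_pow_lt_pow_left₀ 2 hρ.le ?_
      rw [hq2]; linarith [div_pos hd0 hW]
    have h2 := hex F q hF hFK hq0 (by linarith) (by rw [hFa]; linear_combination -hdq)
    have h3 : r * (2 * (ρ - q) * area (ball φ)) ≤ (ρ - q) * (ρ + q) * area (ball φ) := by
      have h4 : 2 * (ρ - q) * area (ball φ) ≤ per φ F - per φ (C i) := by linarith
      have h5 := mul_le_mul_of_nonneg_left h4 (hρ.le.trans hr)
      linarith
    have h6 : 0 < (ρ - q) * area (ball φ) := mul_pos (by linarith) hW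
    nlinarith
  · have h1 := hC.exchange_one i hopn (opn_subset _ _) heq.symm
    refine (h.eq_opn_self (hC.cc i) (hC.sub i) hi hρ hρR.le ?_).2.2 hρR
    have : ρ * per φ (C i) ≤ ρ * per φ (opn φ K ρ) := by gcongr
    linarith
  · exfalso
    set d := min (area (C i) - area (opn φ K ρ)) (R ^ 2 * area (ball φ) - ρ ^ 2 * area (ball φ))
      with hd
    have hρR2 : ρ ^ 2 * area (ball φ) < R ^ 2 * area (ball φ) := by gcongr
    have hd0 : 0 < d := lt_min (by linarith) (by linarith)
    have hd1 : d ≤ area (C i) - area (opn φ K ρ) := min_le_left _ _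
    have hd2 : d ≤ R ^ 2 * area (ball φ) - ρ ^ 2 * area (ball φ) := min_le_right _ _
    have hCK : area (C i) ≤ area K := area_mono h.cc.compact (hC.sub i)
    obtain ⟨r, F, hr0, hr, hF, hFK, hFa, hFp⟩ : ∃ r F, 0 < r ∧ r ≤ ρ ∧ CC F ∧ F ⊆ K ∧
        area F = area (C i) - d ∧
        r * per φ F + area (ero φ K r) = area F + r ^ 2 * area (ball φ) := by
      rcases (show area (opn φ K ρ) ≤ area (C i) - d by linarith).eq_or_lt with he | hl
      · exact ⟨ρ, _, hρ, le_rfl, hopn, opn_subset _ _, he, hopnp⟩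
      · obtain ⟨r, hr0, hrR, hr⟩ := h.exists_area_eq (c := area (C i) - d)
          (lt_of_le_of_lt (h.area_opn_anti hρ.le hρR.le le_rfl) hl) (by linarith)
        refine ⟨r, opn φ K r, hr0.lt_of_ne ?_, ?_, h.cc.opn hφ (h.ne_of_le hr0 hrR.le),
          opn_subset _ _, hr, h.per_opn_eq hr0 hrR.le⟩
        · rintro rfl
          rw [opn_zero hφ] at hr
          linarith
        · by_contra! hc
          have := h.area_opn_anti hρ.le hc.le hrR.le
          linarith
    have h1 := (hCi hr0 (hr.trans hρR.le)).1
    set q := √(ρ ^ 2 + d / area (ball φ)) with hq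
    have hq0 : 0 ≤ q := Real.sqrt_nonneg _
    have hq2 : q ^ 2 = ρ ^ 2 + d / area (ball φ) := Real.sq_sqrt (by positivity)
    have hdW : d / area (ball φ) * area (ball φ) = d := div_mul_cancel₀ _ hW.ne'
    have hdq : (q - ρ) * (ρ + q) * area (ball φ) = d := by
      linear_combination hdW + hq2 * area (ball φ)
    have hqR : q ≤ R := by
      rw [hq, Real.sqrt_le_left hR.le]
      refine le_of_mul_le_mul_right ?_ hW
      rw [add_mul, hdW]; linarith
    have hqρ : ρ < q := by
      refine lt_of_pow_lt_pow_left₀ 2 hq0 ?_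
      rw [hq2]; linarith [div_pos hd0 hW]
    have h2 := hex F q hF hFK hq0 hqR (by rw [hFa]; linear_combination hdq)
    have h3 : (q - ρ) * (ρ + q) * area (ball φ) ≤ r * (2 * (q - ρ) * area (ball φ)) := by
      have h4 : per φ (C i) - per φ F ≤ 2 * (q - ρ) * area (ball φ) := by linarith
      have h5 := mul_le_mul_of_nonneg_left h4 hr0.le
      linarith
    have h6 : 0 < (q - ρ) * area (ball φ) := mul_pos (by linarith) hW
    nlinarith

end

section

variable {φ : Plane → ℝ} {K : Set Plane} {R : ℝ} {ι : Type} {C : ι → Set Plane}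

lemma Opt.add_area_le (hC : Opt φ K C) (h : Inr φ K R) {i j : ι} (hij : i ≠ j)
    (hi : R * per φ (C i) = area (C i) + R ^ 2 * area (ball φ))
    (hj : R * per φ (C j) = area (C j) + R ^ 2 * area (ball φ))
    (hib : R ^ 2 * area (ball φ) ≤ area (C i)) (hjb : R ^ 2 * area (ball φ) ≤ area (C j)) :
    area (opn φ K R) + R ^ 2 * area (ball φ) ≤ area (C i) + area (C j) := by
  by_contra! hlt
  have hφ := h.norm
  have hW := area_ball_pos hφ
  have hR := h.pos
  obtain ⟨z, hz⟩ := h.ne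
  have hsq := h.sq_le_area_opn hR.le le_rfl
  have hRW : 0 < R ^ 2 * area (ball φ) := by positivity
  set A := area (C i) + area (C j) with hA
  set σ := max (A - area (opn φ K R)) 0 with hσ
  have hσ0 : 0 ≤ σ := le_max_right _ _
  have hσ1 : A - area (opn φ K R) ≤ σ := le_max_left _ _
  have hσR : σ < R ^ 2 * area (ball φ) := max_lt (by linarith) hRW
  have hσ2 : R ^ 2 * area (ball φ) ≤ A - σ := by
    rcases max_cases (A - area (opn φ K R)) 0 with ⟨h1, -⟩ | ⟨h1, -⟩ <;> rw [hσ, h1] <;> linarith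
  obtain ⟨F, hF, hFK, hFa, hFp⟩ := h.exists_flat hσ2 (by linarith)
  set q := √(σ / area (ball φ)) with hq
  have hq0 : 0 ≤ q := Real.sqrt_nonneg _
  have hq2 : q ^ 2 * area (ball φ) = σ := by
    rw [hq, Real.sq_sqrt (by positivity), div_mul_cancel₀ _ hW.ne']
  have hqR : q < R := by
    refine lt_of_pow_lt_pow_left₀ 2 hR.le (lt_of_mul_lt_mul_right ?_ hW.le)
    rwa [hq2]
  have h1 := hC.exchange_two hij hF hFK (CC.cball hφ z q) (h.cball_subset hz hq0 hqR.le)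
    (by rw [hFa, area_cball, hq2, ← hA]; ring)
  rw [per_cball hφ z hq0] at h1
  have h2 := mul_le_mul_of_nonneg_left h1 hR.le
  have h3 : 0 < (R - q) ^ 2 * area (ball φ) := by
    have : 0 < R - q := by linarith
    positivity
  nlinarith

lemma CC.exists_line {S : Set Plane} (hS : CC S) (h0 : area S = 0) :
    ∃ p v : Plane, v ≠ 0 ∧ ∀ x ∈ S, ∃ t : ℝ, x = p + t • v := by
  have hint : ¬ (interior S).Nonempty := fun hne => by
    have h1 : 0 < volume (interior S) := isOpen_interior.measure_pos volume hne
    have h2 : volume S = 0 := by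
      rwa [area, measureReal_eq_zero_iff hS.compact.measure_ne_top] at h0
    exact absurd (measure_mono_null interior_subset h2) h1.ne'
  obtain ⟨p, hp⟩ := hS.nonempty
  have hcol : Collinear ℝ S := by
    rw [collinear_iff_finrank_le_one]
    by_contra! hc
    apply hint
    rw [hS.convex.interior_nonempty_iff_affineSpan_eq_top]
    rw [AffineSubspace.affineSpan_eq_top_iff_vectorSpan_eq_top_of_nonempty ℝ Plane Plane ⟨p, hp⟩]
    apply Submodule.eq_top_of_finrank_eq
    have h1 := Submodule.finrank_le (vectorSpan ℝ S)
    have h2 : Module.finrank ℝ (Fin 2 → ℝ) = 2 := by simp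
    refine le_antisymm h1 ?_
    rw [h2]
    exact hc
  obtain ⟨v, hv⟩ := (collinear_iff_of_mem hp).1 hcol
  by_cases hv0 : v = 0
  · refine ⟨p, 1, one_ne_zero, fun x hx => ⟨0, ?_⟩⟩
    obtain ⟨t, ht⟩ := hv x hx
    simpa [hv0] using ht
  · refine ⟨p, v, hv0, fun x hx => ?_⟩
    obtain ⟨t, ht⟩ := hv x hx
    exact ⟨t, by rw [ht, vadd_eq_add, add_comm]⟩

lemma CC.eq_image_Icc {S : Set Plane} (hS : CC S) {p v : Plane} (hv : v ≠ 0)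
    (h : ∀ x ∈ S, ∃ t : ℝ, x = p + t • v) :
    ∃ a b : ℝ, a ≤ b ∧ S = (fun t : ℝ => p + t • v) '' Icc a b := by
  set f : ℝ → Plane := fun t => p + t • v with hf
  have hemb : Topology.IsClosedEmbedding f :=
    (Homeomorph.addLeft p).isClosedEmbedding.comp (isClosedEmbedding_smul_left hv)
  set T := f ⁻¹' S with hT
  have hfT : f '' T = S := by
    rw [hT, image_preimage_eq_inter_range, inter_eq_left]
    intro x hx
    obtain ⟨t, ht⟩ := h x hx
    exact ⟨t, ht.symm⟩
  have hTc : IsCompact T := hemb.isCompact_preimage hS.compact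
  have hTconv : Convex ℝ T := by
    intro x hx y hy c d hc hd hcd
    have := hS.convex hx hy hc hd hcd
    change f _ ∈ S
    convert this using 1
    simp only [hf, smul_add, smul_smul]
    have : p = c • p + d • p := by rw [← add_smul, hcd, one_smul]
    nth_rewrite 1 [this]
    simp only [smul_eq_mul]
    module
  have hTne : T.Nonempty := by
    rw [← image_nonempty (f := f), hfT]; exact hS.nonempty
  refine ⟨sInf T, sSup T, csInf_le_csSup hTne hTc.bddBelow hTc.bddAbove, ?_⟩
  rw [← eq_Icc_csInf_csSup_of_connected_bdd_closed ⟨hTne, hTconv.isPreconnected⟩ hTc.bddBelow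
    hTc.bddAbove hTc.isClosed, hfT]

/-- The segment from the origin to `v`. -/
def sg (v : Plane) : Set Plane := (fun t : ℝ => t • v) '' Icc 0 1

lemma CC.sg (v : Plane) : CC (sg v) where
  compact := isCompact_Icc.image (by fun_prop)
  convex := by
    have := (convex_Icc (0 : ℝ) 1).is_linear_image (f := fun t : ℝ => t • v)
      ⟨fun x y => add_smul x y v, fun c x => by rw [smul_eq_mul, mul_smul]⟩
    exact this
  nonempty := ⟨0, 0, by simp, by simp⟩

lemma per_sg_pos (hφ : IsNorm φ) {v : Plane} (hv : v ≠ 0) : 0 < per φ (sg v) := by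
  rcases (per_nonneg hφ (CC.sg v)).eq_or_lt with h0 | h0
  swap
  · exact h0
  exfalso
  have h1 := steiner hφ (CC.sg v) zero_le_one
  rw [← h0, one_smul] at h1
  have hsgn : area (sg v) = 0 := by
    have h2 := four_mul_area_le hφ (CC.sg v)
    rw [← h0] at h2
    have := area_ball_pos hφ
    have h3 : 0 ≤ area (sg v) := measureReal_nonneg
    nlinarith
  have hsub : ball φ ⊆ sg v + ball φ := fun x hx => ⟨0, ⟨0, by simp, by simp⟩, x, hx, by simp⟩
  have h3 := ((CC.sg v).add (CC.ball hφ)).eq_of_area_le (CC.ball hφ).compact.isClosed hsub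
    (by rw [h1, hsgn]; simpa using area_ball_pos hφ) (by rw [h1, hsgn]; simp)
  have hpos := hφ.pos hv
  have h4 : (φ v)⁻¹ • v ∈ ball φ := by
    change φ _ ≤ 1
    rw [hφ.smul_eq, abs_of_pos (inv_pos.2 hpos), inv_mul_cancel₀ hpos.ne']
  have h5 : v + (φ v)⁻¹ • v ∈ sg v + ball φ := ⟨v, ⟨1, by simp, by simp⟩, _, h4, rfl⟩
  rw [← h3] at h5
  change φ _ ≤ 1 at h5
  have h6 : v + (φ v)⁻¹ • v = (1 + (φ v)⁻¹) • v := by module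
  rw [h6, hφ.smul_eq, abs_of_pos (by positivity), add_mul, inv_mul_cancel₀ hpos.ne'] at h5
  linarith

lemma image_Icc_eq (p v : Plane) {a b : ℝ} (hab : a ≤ b) :
    (fun t : ℝ => p + t • v) '' Icc a b = {p + a • v} + (b - a) • sg v := by
  ext x
  constructor
  · rintro ⟨t, ht, rfl⟩
    rcases hab.eq_or_lt with rfl | hlt
    · have : t = a := le_antisymm ht.2 ht.1
      exact ⟨_, rfl, 0, ⟨0, ⟨0, by simp, by simp⟩, by simp⟩, by simp [this]⟩
    · have h0 : 0 < b - a := by linarith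
      refine ⟨_, rfl, _, ⟨_, ⟨(t - a) / (b - a), ⟨div_nonneg (by linarith [ht.1]) h0.le, ?_⟩, rfl⟩,
        rfl⟩, ?_⟩
      · rw [div_le_one h0]; linarith [ht.2]
      · simp only [smul_smul, mul_div_cancel₀ _ h0.ne']
        module
  · rintro ⟨_, rfl, _, ⟨_, ⟨s, hs, rfl⟩, rfl⟩, rfl⟩
    refine ⟨a + (b - a) * s, ⟨?_, ?_⟩, ?_⟩
    · nlinarith [hs.1]
    · nlinarith [hs.2]
    · simp only [smul_smul]; module

lemma per_image_Icc (hφ : IsNorm φ) (p v : Plane) {a b : ℝ} (hab : a ≤ b) :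
    per φ ((fun t : ℝ => p + t • v) '' Icc a b) = (b - a) * per φ (sg v) := by
  rw [image_Icc_eq p v hab, per_add hφ (CC.singleton _) ((CC.sg v).smul _), per_singleton,
    per_smul hφ (CC.sg v) (by linarith), zero_add]

/-- In the degenerate case the sets of an optimal family are the neighbourhoods of pairwise
intersecting segments of a line. -/
lemma Opt.exists_segments (hC : Opt φ K C) (h : Inr φ K R) {s : Finset ι}
    (hbig : ∀ i ∈ s, R ^ 2 * area (ball φ) ≤ area (C i))
    (hs : ∀ i ∈ s, (ero φ (C i) R).Nonempty ∧ opn φ (C i) R = C i) :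
    ∃ (p v : Plane) (a b : ι → ℝ),
      (∀ i ∈ s, C i = (fun t : ℝ => p + t • v) '' Icc (a i) (b i) + R • ball φ) ∧
      ∀ i ∈ s, ∀ j ∈ s, a i ≤ b j := by
  have hφ := h.norm
  have hR := h.pos
  obtain ⟨p, v, hv, hline⟩ := (h.cc.ero hφ h.ne).exists_line h.null
  have hsub : ∀ i, ero φ (C i) R ⊆ ero φ K R := fun i => ero_mono (hC.sub i) R
  have hex : ∀ i : ι, ∃ a b : ℝ, i ∈ s → a ≤ b ∧
      ero φ (C i) R = (fun t : ℝ => p + t • v) '' Icc a b := by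
    intro i
    by_cases hi : i ∈ s
    · obtain ⟨a, b, hab⟩ := ((hC.cc i).ero hφ (hs i hi).1).eq_image_Icc hv
        fun x hx => hline x (hsub i hx)
      exact ⟨a, b, fun _ => hab⟩
    · exact ⟨0, 0, fun h => absurd h hi⟩
  choose a b hab using hex
  obtain ⟨a₀, b₀, hab₀, h₀⟩ := (h.cc.ero hφ h.ne).eq_image_Icc hv hline
  refine ⟨p, v, a, b, fun i hi => ?_, fun i hi j hj => ?_⟩
  · rw [← (hab i hi).2]; exact (hs i hi).2.symm
  have hκ := per_sg_pos hφ hv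
  have hinj : Function.Injective (fun t : ℝ => p + t • v) := fun x y hxy =>
    smul_left_injective ℝ hv (add_left_cancel hxy)
  have hIcc : ∀ i ∈ s, a₀ ≤ a i ∧ b i ≤ b₀ := fun i hi => by
    have := hsub i
    rw [(hab i hi).2, h₀, image_subset_image_iff hinj] at this
    exact ⟨(this (left_mem_Icc.2 (hab i hi).1)).1, (this (right_mem_Icc.2 (hab i hi).1)).2⟩
  rcases eq_or_ne i j with rfl | hij
  · exact (hab i hi).1
  have harea : ∀ i ∈ s, area (C i) =
      R * ((b i - a i) * per φ (sg v)) + R ^ 2 * area (ball φ) ∧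
      R * per φ (C i) = area (C i) + R ^ 2 * area (ball φ) := fun i hi => by
    have h0 : area (ero φ (C i) R) = 0 :=
      le_antisymm ((area_mono (isCompact_ero hφ h.cc.compact R) (hsub i)).trans h.null.le)
        measureReal_nonneg
    have h1 := area_opn hφ (hC.cc i) hR.le (hs i hi).1
    have h2 := per_opn hφ (hC.cc i) hR.le (hs i hi).1
    rw [(hs i hi).2, h0] at h1
    rw [(hs i hi).2] at h2
    refine ⟨?_, ?_⟩
    · rw [h1, (hab i hi).2, per_image_Icc hφ p v (hab i hi).1]; ring
    · rw [h1, h2]; ring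
  have h1 := hC.add_area_le h hij (harea i hi).2 (harea j hj).2 (hbig i hi) (hbig j hj)
  have h2 := area_opn hφ h.cc hR.le h.ne
  rw [h.null, h₀, per_image_Icc hφ p v hab₀] at h2
  rw [h2, (harea i hi).1, (harea j hj).1] at h1
  have h3 : (R * per φ (sg v)) * (b₀ - a₀) ≤
      (R * per φ (sg v)) * ((b i - a i) + (b j - a j)) := by linarith
  have h4 := le_of_mul_le_mul_left h3 (by positivity)
  by_contra! hlt
  linarith [hIcc i hi, hIcc j hj]

end

section

variable {φ : Plane → ℝ} {Ω : Set Plane} {R : ℝ}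

lemma isOpen_wulffBall (hφ : IsNorm φ) (x : Plane) (r : ℝ) : IsOpen (wulffBall φ x r) :=
  isOpen_lt (hφ.continuous.comp (continuous_id.sub continuous_const)) continuous_const

lemma mem_wulffBall_self (hφ : IsNorm φ) (x : Plane) {r : ℝ} (hr : 0 < r) :
    x ∈ wulffBall φ x r := by
  change φ (x - x) < r
  rwa [sub_self, hφ.map_zero]

lemma convex_wulffBall (hφ : IsNorm φ) (x : Plane) (r : ℝ) : Convex ℝ (wulffBall φ x r) := by
  intro y hy z hz a b ha hb hab
  change φ _ < r
  have h1 : a • y + b • z - x = a • (y - x) + b • (z - x) := by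
    have : x = a • x + b • x := by rw [← add_smul, hab, one_smul]
    nth_rewrite 1 [this]
    module
  have h2 := hφ.add_le (a • (y - x)) (b • (z - x))
  rw [hφ.smul_eq, hφ.smul_eq, abs_of_nonneg ha, abs_of_nonneg hb] at h2
  rw [h1]
  refine h2.trans_lt ?_
  exact (convex_Iio r) hy hz ha hb hab

lemma mem_cball (hφ : IsNorm φ) {x y : Plane} {r : ℝ} (hr : 0 ≤ r) :
    y ∈ cball φ x r ↔ φ (y - x) ≤ r := by
  rw [cball, singleton_add, mem_image]
  constructor
  · rintro ⟨z, hz, rfl⟩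
    rw [add_sub_cancel_left]
    exact (mem_smul_ball hφ hr).1 hz
  · exact fun h => ⟨y - x, (mem_smul_ball hφ hr).2 h, add_sub_cancel _ _⟩

lemma wulffBall_subset_cball (hφ : IsNorm φ) (x : Plane) {r : ℝ} (hr : 0 ≤ r) :
    wulffBall φ x r ⊆ cball φ x r := fun _ hy => (mem_cball hφ hr).2 (le_of_lt hy)

lemma closure_wulffBall (hφ : IsNorm φ) (x : Plane) {r : ℝ} (hr : 0 < r) :
    closure (wulffBall φ x r) = cball φ x r := by
  refine (closure_minimal (wulffBall_subset_cball hφ x hr.le)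
    (CC.cball hφ x r).compact.isClosed).antisymm fun y hy => ?_
  rw [mem_cball hφ hr.le] at hy
  have h1 : Tendsto (fun t : ℝ => x + t • (y - x)) (𝓝[<] 1) (𝓝 y) := by
    have : Continuous fun t : ℝ => x + t • (y - x) := by fun_prop
    have h2 := (this.tendsto 1).mono_left (nhdsWithin_le_nhds (s := Iio 1))
    simpa using h2
  refine mem_closure_of_tendsto h1 ?_
  have h3 : ∀ᶠ t : ℝ in 𝓝[<] 1, t ∈ Ioo (0 : ℝ) 1 := Ioo_mem_nhdsLT zero_lt_one
  filter_upwards [h3] with t ht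
  change φ _ < r
  rw [add_sub_cancel_left, hφ.smul_eq, abs_of_pos ht.1]
  calc t * φ (y - x) ≤ t * r := by have := ht.1.le; gcongr
    _ < 1 * r := by have := ht.2; gcongr
    _ = r := one_mul r

/-- A nonempty bounded convex open set together with its inradius. -/
structure Dom (φ : Plane → ℝ) (Ω : Set Plane) (R : ℝ) : Prop where
  isOpen : IsOpen Ω
  bdd : Bornology.IsBounded Ω
  convex : Convex ℝ Ω
  nonempty : Ω.Nonempty
  inr : Inr φ (closure Ω) R

lemma exists_dom (hφ : IsNorm φ) (hΩo : IsOpen Ω) (hΩb : Bornology.IsBounded Ω)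
    (hΩc : Convex ℝ Ω) (hne : Ω.Nonempty) : ∃ R, Dom φ Ω R := by
  have hK : CC (closure Ω) := ⟨hΩb.isCompact_closure, hΩc.closure, hne.closure⟩
  obtain ⟨ρ, h0, h1, h2, h3⟩ := exists_inradius hφ hK
  refine ⟨ρ, hΩo, hΩb, hΩc, hne, hφ, hK, h0.lt_of_ne ?_, h1, h2, h3⟩
  rintro rfl
  rw [ero_zero hφ, area, measureReal_eq_zero_iff hK.compact.measure_ne_top] at h2
  exact absurd (measure_mono_null subset_closure h2) (hΩo.measure_pos volume hne).ne'

lemma Dom.interior_closure (h : Dom φ Ω R) : interior (closure Ω) = Ω := by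
  rw [h.convex.interior_closure_eq_interior_of_nonempty_interior
    (by rw [h.isOpen.interior_eq]; exact h.nonempty), h.isOpen.interior_eq]

lemma Dom.wulffBall_subset_iff (h : Dom φ Ω R) {x : Plane} {r : ℝ} (hr : 0 < r) :
    wulffBall φ x r ⊆ Ω ↔ x ∈ ero φ (closure Ω) r := by
  have hφ := h.inr.norm
  rw [mem_ero]
  constructor
  · intro hs
    rw [← closure_wulffBall hφ x hr]
    exact closure_mono hs
  · intro hs
    rw [← h.interior_closure]
    exact interior_maximal ((wulffBall_subset_cball hφ x hr.le).trans hs) (isOpen_wulffBall hφ x r)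

lemma Dom.maxInradius_eq (h : Dom φ Ω R) : maxInradius φ Ω = R := by
  have : IsGreatest {R | 0 < R ∧ ∃ x, wulffBall φ x R ⊆ Ω} R := by
    constructor
    · obtain ⟨x, hx⟩ := h.inr.ne
      exact ⟨h.inr.pos, x, (h.wulffBall_subset_iff h.inr.pos).2 hx⟩
    · rintro r ⟨hr, x, hx⟩
      exact h.inr.max r hr.le ⟨x, (h.wulffBall_subset_iff hr).1 hx⟩
  exact this.csSup_eq

lemma isOpen_plaquette (hφ : IsNorm φ) (hΩ : IsOpen Ω) (r : ℝ) : IsOpen (plaquette φ Ω r) := by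
  unfold plaquette
  split_ifs
  · exact hΩ
  · exact isOpen_iUnion fun x => isOpen_iUnion fun _ => isOpen_wulffBall hφ x r

lemma convex_iUnion_wulffBall (hφ : IsNorm φ) {S : Set Plane} (hS : Convex ℝ S) (r : ℝ) :
    Convex ℝ (⋃ x ∈ S, wulffBall φ x r) := by
  have : (⋃ x ∈ S, wulffBall φ x r) = S + wulffBall φ 0 r := by
    ext y
    simp only [mem_iUnion, Set.mem_add, exists_prop]
    constructor
    · rintro ⟨x, hx, hy⟩
      exact ⟨x, hx, y - x, by change φ (y - x - 0) < r; rwa [sub_zero], add_sub_cancel _ _⟩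
    · rintro ⟨x, hx, z, hz, rfl⟩
      refine ⟨x, hx, ?_⟩
      change φ _ < r at hz ⊢
      rwa [add_sub_cancel_left, ← sub_zero z]
  rw [this]
  exact hS.add (convex_wulffBall hφ 0 r)

lemma closure_iUnion_wulffBall (hφ : IsNorm φ) (S : Set Plane) {r : ℝ} (hr : 0 < r) :
    S + r • ball φ ⊆ closure (⋃ x ∈ S, wulffBall φ x r) ∧
      (⋃ x ∈ S, wulffBall φ x r) ⊆ S + r • ball φ := by
  constructor
  · rintro _ ⟨x, hx, b, hb, rfl⟩
    have h1 : x + b ∈ cball φ x r := ⟨x, rfl, b, hb, rfl⟩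
    rw [← closure_wulffBall hφ x hr] at h1
    exact closure_mono (subset_biUnion_of_mem (u := fun x => wulffBall φ x r) hx) h1
  · refine iUnion₂_subset fun x hx => (wulffBall_subset_cball hφ x hr.le).trans ?_
    exact add_subset_add_right (singleton_subset_iff.2 hx)

lemma Dom.plaquette_eq (h : Dom φ Ω R) {r : ℝ} (hr : 0 < r) :
    plaquette φ Ω r = ⋃ x ∈ ero φ (closure Ω) r, wulffBall φ x r := by
  rw [plaquette, if_neg hr.ne']
  simp only [h.wulffBall_subset_iff hr]

lemma Dom.convex_plaquette (h : Dom φ Ω R) {r : ℝ} (h0 : 0 ≤ r) :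
    Convex ℝ (plaquette φ Ω r) := by
  rcases h0.eq_or_lt with rfl | hr
  · rw [plaquette, if_pos rfl]; exact h.convex
  · rw [h.plaquette_eq hr]
    exact convex_iUnion_wulffBall h.inr.norm (convex_er h.convex.closure _) r

lemma Dom.closure_plaquette (h : Dom φ Ω R) {r : ℝ} (h0 : 0 ≤ r) (hr : r ≤ R) :
    closure (plaquette φ Ω r) = opn φ (closure Ω) r := by
  have hφ := h.inr.norm
  rcases h0.eq_or_lt with rfl | hr0
  · rw [plaquette, if_pos rfl, opn_zero hφ]
  · rw [h.plaquette_eq hr0]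
    have := closure_iUnion_wulffBall hφ (ero φ (closure Ω) r) hr0
    exact (closure_minimal this.2 (h.inr.cc.opn hφ (h.inr.ne_of_le h0 hr)).compact.isClosed).antisymm
      this.1

lemma ae_eq_closure {P : Set Plane} (hP : Convex ℝ P) : P =ᵐ[volume] closure P :=
  (closure_ae_eq_of_null_frontier (hP.addHaar_frontier volume)).symm

lemma closure_densityPoints {A P : Set Plane} (hP : IsOpen P) (hA : A =ᵐ[volume] P) :
    closure (densityPoints A) = closure P := by
  have hvol : ∀ (x : Plane) (r : ℝ), volume (A ∩ Metric.ball x r) =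
      volume (P ∩ Metric.ball x r) := fun x r =>
    measure_congr (hA.inter (ae_eq_refl _))
  refine (closure_minimal (fun x hx => ?_) isClosed_closure).antisymm (closure_mono fun x hx => ?_)
  · by_contra hxP
    obtain ⟨ε, hε, hball⟩ := Metric.isOpen_iff.1 isClosed_closure.isOpen_compl x hxP
    have h1 : ∀ᶠ r : ℝ in 𝓝[>] 0,
        volume (A ∩ Metric.ball x r) / volume (Metric.ball x r) = 0 := by
      filter_upwards [Ioo_mem_nhdsGT hε] with r hr
      have : P ∩ Metric.ball x r = ∅ := by
        rw [eq_empty_iff_forall_notMem]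
        rintro y ⟨hyP, hy⟩
        exact hball (Metric.ball_subset_ball hr.2.le hy) (subset_closure hyP)
      rw [hvol, this, measure_empty, ENNReal.zero_div]
    have h2 := tendsto_nhds_unique (hx.congr' h1) tendsto_const_nhds
    exact one_ne_zero h2
  · obtain ⟨ε, hε, hball⟩ := Metric.isOpen_iff.1 hP x hx
    refine tendsto_const_nhds.congr' ?_
    filter_upwards [Ioo_mem_nhdsGT hε] with r hr
    rw [hvol, inter_eq_right.2 ((Metric.ball_subset_ball hr.2.le).trans hball),
      ENNReal.div_self (Metric.measure_ball_pos volume x hr.1).ne' measure_ball_lt_top.ne]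

lemma essSup_eq {u : Plane → ℝ} {j : ℕ} (hj : IsEssSup u j) {N : ℕ} {P : Set Plane}
    (hP : IsOpen P) (hne : P.Nonempty) (hle : ∀ᵐ x ∂volume, u x ≤ N)
    (hge : ∀ᵐ x ∂volume, x ∈ P → (N : ℝ) ≤ u x) : j = N := by
  have h1 : (j : ℝ) ≤ N := hj.2 N hle
  refine le_antisymm (by exact_mod_cast h1) ?_
  by_contra! hlt
  have h2 : ∀ᵐ x ∂volume, x ∉ P := by
    filter_upwards [hj.1, hge] with x hx hx' hxP
    have := (hx' hxP).trans hx
    have : N ≤ j := by exact_mod_cast this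
    omega
  have h3 : volume P = 0 := by
    have := ae_iff.1 h2
    simpa using this
  exact (hP.measure_pos volume hne).ne' h3

/-- A set whose frontier is covered by balls of radius `r` contained in it is the union of such
balls. -/
lemma Dom.opn_eq_of_rWCond (h : Dom φ Ω R) {r : ℝ} (hr : 0 < r) (hW : rWCond φ Ω r) :
    opn φ (closure Ω) r = closure Ω ∧ r ≤ R := by
  have hφ := h.inr.norm
  have hfr : frontier Ω ⊆ opn φ (closure Ω) r := by
    intro x hx
    obtain ⟨y, hy, hxy⟩ := hW x hx
    have h1 := (h.wulffBall_subset_iff hr).1 hy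
    have h2 := frontier_subset_closure hxy
    rw [closure_wulffBall hφ y hr] at h2
    exact add_subset_add_right (singleton_subset_iff.2 h1) h2
  have hfne : (frontier Ω).Nonempty := by
    rw [nonempty_frontier_iff]
    refine ⟨h.nonempty, fun hu => ?_⟩
    have := h.bdd
    rw [hu] at this
    exact NoncompactSpace.noncompact_univ (X := Plane) (Metric.isCompact_of_isClosed_isBounded
      isClosed_univ this)
  obtain ⟨y₀, hy₀⟩ := hfne.mono hfr
  have hne : (ero φ (closure Ω) r).Nonempty := by
    obtain ⟨e, he, _⟩ := hy₀
    exact ⟨e, he⟩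
  refine ⟨(opn_subset _ _).antisymm fun z hz => ?_, h.inr.max r hr.le hne⟩
  by_contra hzn
  have hO := h.inr.cc.opn hφ hne
  obtain ⟨f, c, hfc, hcz⟩ := geometric_hahn_banach_closed_point hO.convex hO.compact.isClosed hzn
  obtain ⟨w, hwK, hw⟩ := h.inr.cc.compact.exists_isMaxOn ⟨z, hz⟩ f.continuous.continuousOn
  have hwz : f z ≤ f w := hw hz
  by_cases hwi : w ∈ Ω
  · have h1 : Tendsto (fun t : ℝ => w + t • (z - y₀)) (𝓝[>] 0) (𝓝 w) := by
      have : Continuous fun t : ℝ => w + t • (z - y₀) := by fun_prop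
      have h2 := (this.tendsto 0).mono_left (nhdsWithin_le_nhds (s := Ioi 0))
      simpa using h2
    obtain ⟨t, ht, ht0⟩ := ((h1.eventually (h.isOpen.mem_nhds hwi)).and
      self_mem_nhdsWithin).exists
    have h3 : f (w + t • (z - y₀)) ≤ f w := hw (subset_closure ht)
    rw [map_add, map_smul, map_sub, smul_eq_mul] at h3
    have h4 := hfc y₀ hy₀
    have : 0 < t * (f z - f y₀) := mul_pos ht0 (by linarith)
    linarith
  · have h1 : w ∈ frontier Ω := by
      rw [h.isOpen.frontier_eq]; exact ⟨hwK, hwi⟩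
    have := hfc w (hfr h1)
    linarith

lemma Dom.maxRollRadius_spec (h : Dom φ Ω R) : 0 ≤ maxRollRadius φ Ω ∧ maxRollRadius φ Ω ≤ R ∧
    ∀ r, 0 ≤ r → r ≤ maxRollRadius φ Ω → opn φ (closure Ω) r = closure Ω := by
  have hφ := h.inr.norm
  set T := {r | 0 < r ∧ rWCond φ Ω r} with hT
  have hle : ∀ r ∈ T, r ≤ R := fun r hr => (h.opn_eq_of_rWCond hr.1 hr.2).2
  have hbdd : BddAbove T := ⟨R, hle⟩
  have h0 : 0 ≤ maxRollRadius φ Ω := Real.sSup_nonneg fun r hr => hr.1.le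
  have hR : maxRollRadius φ Ω ≤ R := Real.sSup_le hle h.inr.pos.le
  refine ⟨h0, hR, ?_⟩
  have hdown : ∀ r s, 0 ≤ r → r ≤ s → opn φ (closure Ω) s = closure Ω →
      opn φ (closure Ω) r = closure Ω := fun r s hr hrs hs =>
    (opn_subset _ _).antisymm (hs.symm.le.trans (opn_anti hφ _ hr hrs))
  have hstrict : ∀ r, 0 ≤ r → r < maxRollRadius φ Ω → opn φ (closure Ω) r = closure Ω := by
    intro r hr hlt
    have hTne : T.Nonempty := by
      by_contra hcon
      rw [not_nonempty_iff_eq_empty] at hcon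
      rw [maxRollRadius, ← hT, hcon, Real.sSup_empty] at hlt
      linarith
    obtain ⟨s, hs, hrs⟩ := exists_lt_of_lt_csSup hTne hlt
    exact hdown r s hr hrs.le (h.opn_eq_of_rWCond hs.1 hs.2).1
  set ρ := maxRollRadius φ Ω with hρ
  have hmax : opn φ (closure Ω) ρ = closure Ω := by
    rcases h0.eq_or_lt with h00 | hpos
    · rw [← h00, opn_zero hφ]
    refine eq_opn_of_area_eq hφ h.inr.cc hpos (h.inr.ne_of_le h0 hR) ?_
    have hlim : Tendsto (fun n => area (ero φ (closure Ω) (rs ρ n)) + rs ρ n * per φ (closure Ω) -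
        rs ρ n ^ 2 * area (ball φ)) atTop (𝓝 (area (ero φ (closure Ω) ρ) +
        ρ * per φ (closure Ω) - ρ ^ 2 * area (ball φ))) :=
      ((tendsto_area_ero hφ h.inr.cc.compact h0).add ((rs_tendsto ρ).mul_const _)).sub
        (((rs_tendsto ρ).pow 2).mul_const _)
    refine (tendsto_nhds_unique hlim (tendsto_const_nhds.congr fun n => ?_)).le
    have hr0 := rs_nonneg h0 n
    have hlt : rs ρ n < ρ := by
      have := mul_lt_mul_of_pos_left (show 1 - dl n < 1 by linarith [dl_pos n]) hpos
      simpa [rs] using this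
    have hne := h.inr.ne_of_le hr0 (hlt.le.trans hR)
    have h1 := area_opn hφ h.inr.cc hr0 hne
    have h2 := per_opn hφ h.inr.cc hr0 hne
    rw [hstrict _ hr0 hlt] at h1 h2
    rw [h1, h2]; ring
  exact fun r hr hle => hdown r ρ hr hle hmax

end

section

variable {φ : Plane → ℝ} {K Ω : Set Plane} {R : ℝ} {ι : Type} {C : ι → Set Plane}

lemma Opt.exists_finset (hC : Opt φ K C) (h : Inr φ K R) :
    ∃ s : Finset ι, ∀ i, i ∈ s ↔ 0 < area (C i) := by
  have hRW : 0 < R ^ 2 * area (ball φ) := mul_pos (pow_pos h.pos 2) (area_ball_pos h.norm)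
  have h1 : {i | ¬ area (C i) < R ^ 2 * area (ball φ)}.Finite :=
    hC.summable.tendsto_cofinite_zero.eventually (gt_mem_nhds hRW)
  have h2 : {i | 0 < area (C i) ∧ area (C i) < R ^ 2 * area (ball φ)}.Finite :=
    Set.Subsingleton.finite fun i hi j hj => hC.eq_of_small h hi.1 hi.2 hj.1 hj.2
  have h3 : {i | 0 < area (C i)}.Finite := (h1.union h2).subset fun i hi => by
    by_cases hlt : area (C i) < R ^ 2 * area (ball φ)
    · exact Or.inr ⟨hi, hlt⟩
    · exact Or.inl hlt
  exact ⟨h3.toFinset, fun i => by simp⟩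

lemma Opt.vsum_ae (hC : Opt φ K C) [Countable ι] {s : Finset ι}
    (hs : ∀ i, i ∈ s ↔ 0 < area (C i)) :
    vsum C =ᵐ[volume] fun x => ∑ i ∈ s, (C i).indicator (1 : Plane → ℝ) x := by
  have h1 : ∀ᵐ x ∂volume, ∀ i, i ∉ s → x ∉ C i := by
    rw [ae_all_iff]
    intro i
    by_cases hi : i ∈ s
    · exact Eventually.of_forall fun x h => absurd hi h
    · have h0 : area (C i) = 0 :=
        le_antisymm (not_lt.1 fun h => hi ((hs i).2 h)) measureReal_nonneg
      rw [area, measureReal_eq_zero_iff (hC.cc i).compact.measure_ne_top] at h0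
      filter_upwards [measure_eq_zero_iff_ae_notMem.1 h0] with x hx _ using hx
  filter_upwards [h1] with x hx
  rw [vsum_eq_tsum]
  exact tsum_eq_sum fun i hi => by simp [hx i hi]

lemma iUnion_wulffBall_eq_plaquette (S : Set Plane) (hR : 0 < R) :
    (⋃ x ∈ S, wulffBall φ x R) = plaquette φ (⋃ x ∈ S, wulffBall φ x R) R := by
  rw [plaquette, if_neg hR.ne']
  refine Subset.antisymm (iUnion₂_subset fun x hx => ?_) (iUnion₂_subset fun x hx => hx)
  have h1 := subset_biUnion_of_mem (u := fun x => wulffBall φ x R) hx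
  exact subset_iUnion₂ (s := fun x (_ : wulffBall φ x R ⊆ ⋃ x ∈ S, wulffBall φ x R) =>
    wulffBall φ x R) x h1

lemma exists_superlevel (hφ : IsNorm φ) (hR : 0 < R) {s : Finset ι} {p v : Plane} {a b : ι → ℝ}
    (hC : ∀ i ∈ s, C i = (fun t : ℝ => p + t • v) '' Icc (a i) (b i) + R • ball φ)
    (hab : ∀ i ∈ s, ∀ j ∈ s, a i ≤ b j) {u : Plane → ℝ}
    (hu : u =ᵐ[volume] fun x => ∑ i ∈ s, (C i).indicator (1 : Plane → ℝ) x) {j : ℕ} (hj : 1 ≤ j) :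
    ∃ F : Set Plane, Convex ℝ F ∧ F = plaquette φ F R ∧
      closure (densityPoints {x | (j : ℝ) ≤ u x}) = closure F := by
  classical
  set f : ℝ → Plane := fun t => p + t • v with hf
  have hfaff : ∀ x y c d : ℝ, c + d = 1 → f (c * x + d * y) = c • f x + d • f y := by
    intro x y c d hcd
    simp only [hf, smul_add, smul_smul]
    have : p = c • p + d • p := by rw [← add_smul, hcd, one_smul]
    nth_rewrite 1 [this]
    module
  set T : Set ℝ := {t | j ≤ (s.filter fun i => t ∈ Icc (a i) (b i)).card} with hT
  set F : Set Plane := ⋃ x ∈ f '' T, wulffBall φ x R with hF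
  have hTconv : Convex ℝ T := by
    rcases s.eq_empty_or_nonempty with rfl | hs
    · intro x hx
      simp [hT] at hx; omega
    obtain ⟨i₀, hi₀, hmax⟩ := s.exists_max_image a hs
    set t₀ := a i₀
    have ht₀ : ∀ i ∈ s, t₀ ∈ Icc (a i) (b i) := fun i hi => ⟨hmax i hi, hab i₀ hi₀ i hi⟩
    have hstar : ∀ x ∈ T, ∀ w, w ∈ uIcc x t₀ → w ∈ T := by
      intro x hx w hw
      refine le_trans hx (Finset.card_le_card fun i hi => ?_)
      rw [Finset.mem_filter] at hi ⊢
      exact ⟨hi.1, uIcc_subset_Icc hi.2 (ht₀ i hi.1) hw⟩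
    have : T.OrdConnected := ⟨fun x hx y hy w hw => by
      rcases le_total w t₀ with h | h
      · exact hstar x hx w (mem_uIcc.2 (Or.inl ⟨hw.1, h⟩))
      · exact hstar y hy w (mem_uIcc.2 (Or.inr ⟨h, hw.2⟩))⟩
    exact this.convex
  have hSconv : Convex ℝ (f '' T) := by
    rintro _ ⟨x, hx, rfl⟩ _ ⟨y, hy, rfl⟩ c d hc hd hcd
    exact ⟨c * x + d * y, hTconv hx hy hc hd hcd, hfaff x y c d hcd⟩
  have hFconv : Convex ℝ F := convex_iUnion_wulffBall hφ hSconv R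
  have hFopen : IsOpen F :=
    isOpen_iUnion fun x => isOpen_iUnion fun _ => isOpen_wulffBall hφ x R
  refine ⟨F, hFconv, iUnion_wulffBall_eq_plaquette _ hR, closure_densityPoints hFopen ?_⟩
  have hmem : ∀ i ∈ s, ∀ x, x ∈ C i ↔ ∃ t ∈ Icc (a i) (b i), φ (x - f t) ≤ R := by
    intro i hi x
    rw [hC i hi]
    constructor
    · rintro ⟨_, ⟨t, ht, rfl⟩, z, hz, rfl⟩
      exact ⟨t, ht, by rw [add_sub_cancel_left]; exact (mem_smul_ball hφ hR.le).1 hz⟩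
    · rintro ⟨t, ht, hx⟩
      exact ⟨f t, ⟨t, ht, rfl⟩, x - f t, (mem_smul_ball hφ hR.le).2 hx, add_sub_cancel _ _⟩
  have hG : {x | j ≤ (s.filter fun i => x ∈ C i).card} = f '' T + R • ball φ := by
    ext x
    constructor
    · intro hx
      set I := s.filter fun i => x ∈ C i with hI
      have hIne : I.Nonempty := Finset.card_pos.1 (lt_of_lt_of_le hj hx)
      have hIt : ∀ i : ι, ∃ t, i ∈ I → t ∈ Icc (a i) (b i) ∧ φ (x - f t) ≤ R := fun i => by
        by_cases hi : i ∈ I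
        · rw [hI, Finset.mem_filter] at hi
          obtain ⟨t, ht⟩ := (hmem i hi.1 x).1 hi.2
          exact ⟨t, fun _ => ht⟩
        · exact ⟨0, fun h => absurd h hi⟩
      choose t ht using hIt
      obtain ⟨k, hk, hkmin⟩ := I.exists_min_image t hIne
      obtain ⟨l, hl, hlmax⟩ := I.exists_max_image a hIne
      have hkl : t k ≤ t l := hkmin l hl
      have hal : a l ≤ t l := (ht l hl).1.1
      have hIs : ∀ i ∈ I, i ∈ s := fun i hi => (Finset.mem_filter.1 hi).1
      set w := max (t k) (a l) with hw
      have hwle : w ≤ t l := max_le hkl hal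
      have hwI : ∀ i ∈ I, w ∈ Icc (a i) (b i) := fun i hi =>
        ⟨(hlmax i hi).trans (le_max_right _ _),
          max_le ((hkmin i hi).trans (ht i hi).1.2) (hab l (hIs l hl) i (hIs i hi))⟩
      have hseg : w ∈ segment ℝ (t k) (t l) := by
        rw [segment_eq_Icc hkl]; exact ⟨le_max_left _ _, hwle⟩
      obtain ⟨c, d, hc, hd, hcd, hcdw⟩ := hseg
      have hxw : φ (x - f w) ≤ R := by
        rw [← hcdw, smul_eq_mul, smul_eq_mul, hfaff _ _ _ _ hcd]
        have h1 : x - (c • f (t k) + d • f (t l)) = c • (x - f (t k)) + d • (x - f (t l)) := by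
          have : x = c • x + d • x := by rw [← add_smul, hcd, one_smul]
          nth_rewrite 1 [this]
          module
        have h2 := hφ.add_le (c • (x - f (t k))) (d • (x - f (t l)))
        rw [hφ.smul_eq, hφ.smul_eq, abs_of_nonneg hc, abs_of_nonneg hd] at h2
        rw [h1]
        exact h2.trans ((convex_Iic R) (ht k hk).2 (ht l hl).2 hc hd hcd)
      refine ⟨f w, ⟨w, ?_, rfl⟩, x - f w, (mem_smul_ball hφ hR.le).2 hxw, add_sub_cancel _ _⟩
      refine le_trans hx (Finset.card_le_card fun i hi => ?_)
      exact Finset.mem_filter.2 ⟨hIs i hi, hwI i hi⟩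
    · rintro ⟨_, ⟨t, ht, rfl⟩, z, hz, rfl⟩
      refine le_trans ht (Finset.card_le_card fun i hi => ?_)
      rw [Finset.mem_filter] at hi ⊢
      refine ⟨hi.1, (hmem i hi.1 _).2 ⟨t, hi.2, ?_⟩⟩
      rw [add_sub_cancel_left]; exact (mem_smul_ball hφ hR.le).1 hz
  have hsub := closure_iUnion_wulffBall hφ (f '' T) hR
  have h1 : {x | j ≤ (s.filter fun i => x ∈ C i).card} =ᵐ[volume] F := by
    rw [hG]
    exact (hsub.1.eventuallyLE.trans (ae_eq_closure hFconv).symm.le).antisymm hsub.2.eventuallyLE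
  refine EventuallyEq.trans ?_ h1
  filter_upwards [hu] with x hx
  have h2 : u x = ((s.filter fun i => x ∈ C i).card : ℝ) := by
    rw [hx, Finset.card_filter]
    push_cast
    exact Finset.sum_congr rfl fun i _ => by simp [indicator_apply]
  change ((j : ℝ) ≤ u x) = (j ≤ (s.filter fun i => x ∈ C i).card)
  rw [h2, Nat.cast_le]

end

section

variable {φ : Plane → ℝ} {Ω : Set Plane} {R : ℝ} {ι : Type} {C : ι → Set Plane}

lemma two_layers {u : Plane → ℝ} {jbar : ℕ} (hj : IsEssSup u jbar) {W P : Set Plane}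
    (hWo : IsOpen W) (hPo : IsOpen P) (hWP : W ⊆ P) (hne : W.Nonempty) {N : ℕ} (hN : 1 ≤ N)
    (hu : u =ᵐ[volume] fun x => W.indicator (1 : Plane → ℝ) x +
      ((N : ℝ) - 1) * P.indicator (1 : Plane → ℝ) x) :
    jbar = N ∧ closure (densityPoints {x | (N : ℝ) ≤ u x}) = closure W ∧
      ∀ j : ℕ, 1 ≤ j → j < N → closure (densityPoints {x | (j : ℝ) ≤ u x}) = closure P := by
  have hN' : (1 : ℝ) ≤ N := by exact_mod_cast hN
  have hval : ∀ᵐ x ∂volume, (x ∈ W → u x = N) ∧ (x ∉ W → x ∈ P → u x = N - 1) ∧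
      (x ∉ P → u x = 0) := by
    filter_upwards [hu] with x hx
    refine ⟨fun h => ?_, fun h h' => ?_, fun h => ?_⟩
    · simp [hx, h, hWP h]
    · simp [hx, h, h']
    · have : x ∉ W := fun h' => h (hWP h')
      simp [hx, h, this]
  refine ⟨essSup_eq hj hWo hne ?_ ?_, closure_densityPoints hWo ?_, fun j hj1 hjN =>
    closure_densityPoints hPo ?_⟩
  · filter_upwards [hval] with x hx
    by_cases hW : x ∈ W
    · exact (hx.1 hW).le
    · by_cases hP : x ∈ P
      · rw [hx.2.1 hW hP]; linarith
      · rw [hx.2.2 hP]; linarith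
  · filter_upwards [hval] with x hx hW
    exact (hx.1 hW).ge
  · filter_upwards [hval] with x hx
    change ((N : ℝ) ≤ u x) = (x ∈ W)
    refine propext ⟨fun h => ?_, fun h => (hx.1 h).ge⟩
    by_contra hW
    by_cases hP : x ∈ P
    · rw [hx.2.1 hW hP] at h; linarith
    · rw [hx.2.2 hP] at h; linarith
  · have hj1' : (1 : ℝ) ≤ j := by exact_mod_cast hj1
    have hjN' : (j : ℝ) + 1 ≤ N := by exact_mod_cast hjN
    filter_upwards [hval] with x hx
    change ((j : ℝ) ≤ u x) = (x ∈ P)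
    refine propext ⟨fun h => ?_, fun hP => ?_⟩
    · by_contra hP
      rw [hx.2.2 hP] at h; linarith
    · by_cases hW : x ∈ W
      · rw [hx.1 hW]; linarith
      · rw [hx.2.1 hW hP]; linarith

lemma ae_two_layers {u : Plane → ℝ} {s : Finset ι}
    (hu : u =ᵐ[volume] fun x => ∑ i ∈ s, (C i).indicator (1 : Plane → ℝ) x) {i₀ : ι}
    (hi₀ : i₀ ∈ s) {W P : Set Plane} (hW : W =ᵐ[volume] C i₀)
    (hP : ∀ i ∈ s, i ≠ i₀ → P =ᵐ[volume] C i) :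
    u =ᵐ[volume] fun x => W.indicator (1 : Plane → ℝ) x +
      ((s.card : ℝ) - 1) * P.indicator (1 : Plane → ℝ) x := by
  classical
  have h1 : ∀ᵐ x ∂volume, ∀ i ∈ s, i ≠ i₀ → (x ∈ P ↔ x ∈ C i) := by
    rw [eventually_all_finset]
    intro i hi
    by_cases hii : i = i₀
    · exact Eventually.of_forall fun x h => absurd hii h
    · filter_upwards [hP i hi hii] with x hx _ using iff_of_eq hx
  filter_upwards [hu, hW, h1] with x hx hxW hxP
  have hxW : x ∈ W ↔ x ∈ C i₀ := iff_of_eq hxW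
  have h2 : ∑ i ∈ s.erase i₀, (C i).indicator (1 : Plane → ℝ) x =
      ∑ i ∈ s.erase i₀, P.indicator (1 : Plane → ℝ) x := by
    refine Finset.sum_congr rfl fun i hi => ?_
    rw [Finset.mem_erase] at hi
    simp [indicator_apply, hxP i hi.2 hi.1]
  rw [hx, ← Finset.add_sum_erase s _ hi₀, h2, Finset.sum_const, Finset.card_erase_of_mem hi₀,
    nsmul_eq_mul, Nat.cast_sub (Finset.card_pos.2 ⟨i₀, hi₀⟩), Nat.cast_one]
  simp [indicator_apply, hxW]

end

end Wulff

open Wulff in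
/-- Complete characterization of minimizers of problem (1) in a
bounded convex open set `Ω ⊆ ℝ²`. With `j̄ = ‖u‖_∞` and
`E_j = densityPoints {u ≥ j}`, one of the four cases (a)–(d) holds. -/
theorem minimizer_characterization (φ : (Fin 2 → ℝ) → ℝ) (hφ : IsNorm φ)
    (Ω : Set (Fin 2 → ℝ)) (hΩopen : IsOpen Ω) (hΩbdd : Bornology.IsBounded Ω)
    (hΩconv : Convex ℝ Ω) (m : ℝ) (hm : 0 < m)
    (u : (Fin 2 → ℝ) → ℝ) (hu : IsMinimizer φ Ω m u)
    (jbar : ℕ) (hjbar : IsEssSup u jbar) :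
    -- (a)
    (∃ r ∈ Ico (maxRollRadius φ Ω) (maxInradius φ Ω),
      (∀ j : ℕ, 1 ≤ j → j ≤ jbar →
        closure (densityPoints {x | (j : ℝ) ≤ u x}) = closure (plaquette φ Ω r)) ∧
      u =ᵐ[volume] fun x =>
        (jbar : ℝ) * (plaquette φ Ω r).indicator (1 : (Fin 2 → ℝ) → ℝ) x) ∨
    -- (b)
    (∃ r ∈ Ioo (maxRollRadius φ Ω) (maxInradius φ Ω), ∃ x ∈ Ω,
      wulffBall φ x r ⊆ plaquette φ Ω r ∧
      closure (densityPoints {y | (jbar : ℝ) ≤ u y}) = closure (wulffBall φ x r) ∧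
      (∀ j : ℕ, 1 ≤ j → j < jbar →
        closure (densityPoints {y | (j : ℝ) ≤ u y}) = closure (plaquette φ Ω r)) ∧
      u =ᵐ[volume] fun y =>
        (wulffBall φ x r).indicator (1 : (Fin 2 → ℝ) → ℝ) y +
          ((jbar : ℝ) - 1) * (plaquette φ Ω r).indicator (1 : (Fin 2 → ℝ) → ℝ) y) ∨
    -- (c)
    (∃ r ∈ Ioc 0 (maxRollRadius φ Ω), ∃ x ∈ Ω,
      wulffBall φ x r ⊆ Ω ∧
      closure (densityPoints {y | (jbar : ℝ) ≤ u y}) = closure (wulffBall φ x r) ∧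
      (∀ j : ℕ, 1 ≤ j → j < jbar →
        closure (densityPoints {y | (j : ℝ) ≤ u y}) = closure Ω) ∧
      u =ᵐ[volume] fun y =>
        (wulffBall φ x r).indicator (1 : (Fin 2 → ℝ) → ℝ) y +
          ((jbar : ℝ) - 1) * Ω.indicator (1 : (Fin 2 → ℝ) → ℝ) y) ∨
    -- (d)
    (∀ j : ℕ, 1 ≤ j → j ≤ jbar → ∃ F : Set (Fin 2 → ℝ), Convex ℝ F ∧
      F = plaquette φ F (maxInradius φ Ω) ∧
      closure (densityPoints {y | (j : ℝ) ≤ u y}) = closure F) := by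
  have hΩne : Ω.Nonempty := by
    by_contra hcon
    rw [not_nonempty_iff_eq_empty] at hcon
    have := hu.1.2.2.2
    rw [hcon, setIntegral_empty] at this
    linarith
  obtain ⟨R, hD⟩ := exists_dom hφ hΩopen hΩbdd hΩconv hΩne
  have hI := hD.inr
  obtain ⟨C, hC, hCm, huC⟩ := exists_opt hφ hΩopen hΩbdd hΩconv hm hu
  obtain ⟨s, hs⟩ := hC.exists_finset hI
  have husum := huC.trans (hC.vsum_ae hs)
  have hsne : s.Nonempty := by
    by_contra hcon
    rw [Finset.not_nonempty_iff_eq_empty] at hcon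
    have h0 : ∀ i, area (C i) = 0 := fun i =>
      le_antisymm (not_lt.1 fun h => by simpa [hcon] using (hs i).2 h) measureReal_nonneg
    simp only [h0, tsum_zero] at hCm
    linarith
  have hcard : 1 ≤ s.card := hsne.card_pos
  obtain ⟨hroll0, hrollR, hroll⟩ := hD.maxRollRadius_spec
  rw [hD.maxInradius_eq]
  have hplaq : ∀ r, 0 ≤ r → r ≤ R → plaquette φ Ω r =ᵐ[volume] opn φ (closure Ω) r :=
    fun r h0 hr => by
      rw [← hD.closure_plaquette h0 hr]; exact ae_eq_closure (hD.convex_plaquette h0)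
  by_cases hsmall : ∃ j ∈ s, area (C j) < R ^ 2 * area (ball φ)
  · obtain ⟨j, hjs, hj⟩ := hsmall
    have hj0 := (hs j).1 hjs
    obtain ⟨x, ρ, hρ, hρR, hCj⟩ := hC.eq_cball hI hj0 hj
    have hxΩ : wulffBall φ x ρ ⊆ Ω := by
      rw [hD.wulffBall_subset_iff hρ, mem_ero, ← hCj]; exact hC.sub j
    have hother : ∀ i ∈ s, i ≠ j → C i = opn φ (closure Ω) ρ := fun i hi hij =>
      hC.eq_opn_of_small hI hρ hρR hCj
        (not_lt.1 fun h => hij (hC.eq_of_small hI ((hs i).1 hi) h hj0 hj))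
    have hWC : wulffBall φ x ρ =ᵐ[volume] C j := by
      rw [hCj, ← closure_wulffBall hφ x hρ]
      exact ae_eq_closure (convex_wulffBall hφ x ρ)
    have hWo := isOpen_wulffBall hφ x ρ
    have hxW := mem_wulffBall_self hφ x hρ
    rcases lt_or_ge (maxRollRadius φ Ω) ρ with hlt | hge
    · right; left
      have hu2 := ae_two_layers husum hjs hWC (P := plaquette φ Ω ρ) fun i hi hij => by
        rw [hother i hi hij]; exact hplaq ρ hρ.le hρR.le
      have hWP : wulffBall φ x ρ ⊆ plaquette φ Ω ρ := by
        rw [plaquette, if_neg hρ.ne']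
        exact subset_iUnion₂ (s := fun x (_ : wulffBall φ x ρ ⊆ Ω) => wulffBall φ x ρ) x hxΩ
      obtain ⟨rfl, h1, h2⟩ := two_layers hjbar hWo (isOpen_plaquette hφ hΩopen ρ) hWP
        ⟨x, hxW⟩ hcard hu2
      exact ⟨ρ, ⟨hlt, hρR⟩, x, hxΩ hxW, hWP, h1, h2, hu2⟩
    · right; right; left
      have hu2 := ae_two_layers husum hjs hWC (P := Ω) fun i hi hij => by
        rw [hother i hi hij, hroll ρ hρ.le hge]; exact ae_eq_closure hΩconv
      obtain ⟨rfl, h1, h2⟩ := two_layers hjbar hWo hΩopen hxΩ ⟨x, hxW⟩ hcard hu2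
      exact ⟨ρ, ⟨hρ, hge⟩, x, hxΩ hxW, hxΩ, h1, h2, hu2⟩
  · push Not at hsmall
    have hflat : (∀ i ∈ s, (ero φ (C i) R).Nonempty ∧ opn φ (C i) R = C i) →
        ∀ j : ℕ, 1 ≤ j → j ≤ jbar → ∃ F : Set (Fin 2 → ℝ), Convex ℝ F ∧
          F = plaquette φ F R ∧ closure (densityPoints {y | (j : ℝ) ≤ u y}) = closure F := by
      intro hfl j hj1 _
      obtain ⟨p, v, a, b, hCi, hab⟩ := hC.exists_segments hI hsmall hfl
      exact exists_superlevel hφ hI.pos hCi hab husum hj1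
    rcases hC.of_big hI hsne hsmall with ⟨r, hr0, hrR, hCr⟩ | hfl
    · have hmax : ∀ i ∈ s, C i = opn φ (closure Ω) (max r (maxRollRadius φ Ω)) := by
        intro i hi
        rw [hCr i hi]
        rcases le_total r (maxRollRadius φ Ω) with h | h
        · rw [max_eq_right h, hroll r hr0 h, hroll _ hroll0 le_rfl]
        · rw [max_eq_left h]
      rcases (max_le hrR.le hrollR).lt_or_eq with hlt | heq
      · left
        set ρ := max r (maxRollRadius φ Ω) with hρ
        have hρ0 : 0 ≤ ρ := hr0.trans (le_max_left _ _)
        obtain ⟨i₀, hi₀⟩ := hsne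
        have hP : ∀ i ∈ s, plaquette φ Ω ρ =ᵐ[volume] C i := fun i hi => by
          rw [hmax i hi]; exact hplaq ρ hρ0 hlt.le
        have hu2 := ae_two_layers husum hi₀ (hP i₀ hi₀) fun i hi _ => hP i hi
        have hPne : (plaquette φ Ω ρ).Nonempty := by
          rw [← closure_nonempty_iff, hD.closure_plaquette hρ0 hlt.le]
          exact (hI.cc.opn hφ (hI.ne_of_le hρ0 hlt.le)).nonempty
        have hPo := isOpen_plaquette hφ hΩopen ρ
        obtain ⟨rfl, h1, h2⟩ := two_layers hjbar hPo hPo Subset.rfl hPne hcard hu2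
        refine ⟨ρ, ⟨le_max_right _ _, hlt⟩, fun j hj1 hj2 => ?_, ?_⟩
        · rcases hj2.lt_or_eq with h | rfl
          · exact h2 j hj1 h
          · exact h1
        · filter_upwards [hu2] with x hx
          rw [hx]; ring
      · right; right; right
        refine hflat fun i hi => ?_
        have hroll' : maxRollRadius φ Ω = R := by
          rcases max_choice r (maxRollRadius φ Ω) with h | h <;> rw [h] at heq
          · exact absurd heq hrR.ne
          · exact heq
        have hK : C i = closure Ω := by
          rw [hmax i hi, heq, hroll R hI.pos.le hroll'.ge]
        rw [hK]
        exact ⟨hI.ne, hroll R hI.pos.le hroll'.ge⟩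
    · exact Or.inr (Or.inr (Or.inr (hflat hfl)))

end
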